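/- Let G be an acylindrically hyperbolic group. Then the set of acylindrically hyperbolic structures on G has cardinality at least 2^{ℵ₀}; moreover, there is an order embedding of the poset (𝒫(ℕ), ⊆) of all subsets of ℕ ordered by inclusion into the set of acylindrically hyperbolic structures on G ordered by domination. -/

import Mathlib

noncomputable section

open Metric

/-- The Gromov product of `x` and `y` at `w` with respect to a distance function `d`. -/
def gromovProd {α : Type*} (d : α → α → ℝ) (w x y : α) : ℝ :=
  (d w x + d w y - d x y) / 2

/-- Gromov hyperbolicity via the four-point condition, for an arbitrary distance function. -/
def FourPointHyperbolic {α : Type*} (d : α → α → ℝ) : Prop :=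
  ∃ δ : ℝ, 0 ≤ δ ∧ ∀ w x y z : α,
    min (gromovProd d w x z) (gromovProd d w z y) - δ ≤ gromovProd d w x y

/-- A geodesic from `x` to `y`, parametrized by arc length on `[0, dist x y]`. -/
def IsGeodesicSeg {X : Type*} [MetricSpace X] (x y : X) (f : ℝ → X) : Prop :=
  f 0 = x ∧ f (dist x y) = y ∧
    ∀ s ∈ Set.Icc (0 : ℝ) (dist x y), ∀ t ∈ Set.Icc (0 : ℝ) (dist x y),
      dist (f s) (f t) = |s - t|

/-- A geodesic metric space: any two points are joined by a geodesic. -/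
def GeodesicSpace (X : Type*) [MetricSpace X] : Prop :=
  ∀ x y : X, ∃ f : ℝ → X, IsGeodesicSeg x y f

/-- The image (as a set) of a geodesic segment from `x` to `y`. -/
def geodSet {X : Type*} [MetricSpace X] (x y : X) (f : ℝ → X) : Set X :=
  f '' Set.Icc (0 : ℝ) (dist x y)

/-- `p` lies within distance `δ` of the set `S` (i.e. in the closed `δ`-neighborhood). -/
def WithinDistOf {X : Type*} [MetricSpace X] (δ : ℝ) (p : X) (S : Set X) : Prop :=
  ∃ q ∈ S, dist p q ≤ δ

/-- Rips condition: each side of every geodesic triangle is contained in the union of the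
closed `δ`-neighborhoods of the other two sides. -/
def RipsHyperbolic (X : Type*) [MetricSpace X] (δ : ℝ) : Prop :=
  ∀ x y z : X, ∀ fxy fyz fxz : ℝ → X,
    IsGeodesicSeg x y fxy → IsGeodesicSeg y z fyz → IsGeodesicSeg x z fxz →
      (∀ p ∈ geodSet x y fxy, WithinDistOf δ p (geodSet y z fyz ∪ geodSet x z fxz)) ∧
      (∀ p ∈ geodSet y z fyz, WithinDistOf δ p (geodSet x y fxy ∪ geodSet x z fxz)) ∧
      (∀ p ∈ geodSet x z fxz, WithinDistOf δ p (geodSet x y fxy ∪ geodSet y z fyz))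

/-- An (isometric) action of a group `G` on a metric space `X`. -/
structure IsIsomAction (G : Type*) [Group G] (X : Type*) [MetricSpace X]
    (act : G → X → X) : Prop where
  act_one : ∀ x : X, act 1 x = x
  act_mul : ∀ (g h : G) (x : X), act (g * h) x = act g (act h x)
  isometry : ∀ (g : G) (x y : X), dist (act g x) (act g y) = dist x y

/-- A cobounded action: some (hence any) orbit is coarsely dense. -/
def CoboundedAction {G X : Type*} [Group G] [MetricSpace X] (act : G → X → X) : Prop :=
  ∃ (x : X) (R : ℝ), 0 ≤ R ∧ ∀ y : X, ∃ g : G, dist y (act g x) ≤ R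

/-- A quasi-isometric embedding between two "spaces" given by distance functions. -/
def IsQIEmbWith {α β : Type*} (dα : α → α → ℝ) (dβ : β → β → ℝ) (f : α → β) : Prop :=
  ∃ A B : ℝ, 1 ≤ A ∧ 0 ≤ B ∧ ∀ x y : α,
    dα x y / A - B ≤ dβ (f x) (f y) ∧ dβ (f x) (f y) ≤ A * dα x y + B

/-- The image of `f` is coarsely dense. -/
def CoarselyDenseWith {α β : Type*} (dβ : β → β → ℝ) (f : α → β) : Prop :=
  ∃ C : ℝ, 0 ≤ C ∧ ∀ y : β, ∃ x : α, dβ (f x) y ≤ C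

/-- A quasi-isometry between two "spaces" given by distance functions. -/
def IsQuasiIsometryWith {α β : Type*} (dα : α → α → ℝ) (dβ : β → β → ℝ) (f : α → β) : Prop :=
  IsQIEmbWith dα dβ f ∧ CoarselyDenseWith dβ f

/-- The standard distance on `ℤ`. -/
def zdist : ℤ → ℤ → ℝ := fun m n => |(m : ℝ) - (n : ℝ)|

/-- `g` is loxodromic for the action `act`: for some basepoint `x`, the orbit map
`n ↦ g ^ n • x` is a quasi-isometric embedding of `ℤ`. -/
def LoxodromicWith {G α : Type*} [Group G] (d : α → α → ℝ) (act : G → α → α) (g : G) : Prop :=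
  ∃ x : α, IsQIEmbWith zdist d (fun n : ℤ => act (g ^ n) x)

/-- Acylindricity of an action, with respect to a distance function. -/
def AcylindricalWith {G α : Type*} (d : α → α → ℝ) (act : G → α → α) : Prop :=
  ∀ ε : ℝ, 0 < ε → ∃ (R : ℝ) (N : ℕ), 0 ≤ R ∧ ∀ x y : α, R ≤ d x y →
    {g : G | d x (act g x) ≤ ε ∧ d y (act g y) ≤ ε}.Finite ∧
    Nat.card {g : G | d x (act g x) ≤ ε ∧ d y (act g y) ≤ ε} ≤ N

/-- Two subsets are within finite Hausdorff distance of each other. -/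
def FinHausdorffClose {α : Type*} (d : α → α → ℝ) (A B : Set α) : Prop :=
  ∃ C : ℝ, (∀ a ∈ A, ∃ b ∈ B, d a b ≤ C) ∧ (∀ b ∈ B, ∃ a ∈ A, d a b ≤ C)

/-- The positive (`pos = true`) or negative (`pos = false`) orbit ray of `g` at `x`. -/
def orbitRay {G α : Type*} [Group G] (act : G → α → α) (g : G) (x : α) (pos : Bool) : Set α :=
  Set.range fun n : ℕ => act (g ^ (if pos then (n : ℤ) else -(n : ℤ))) x

/-- Independence of two loxodromic elements with respect to the basepoint `x`: no orbit ray of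
`g` is within finite Hausdorff distance of an orbit ray of `h`. -/
def IndepWith {G α : Type*} [Group G] (d : α → α → ℝ) (act : G → α → α) (x : α)
    (g h : G) : Prop :=
  ∀ s t : Bool, ¬ FinHausdorffClose d (orbitRay act g x s) (orbitRay act h x t)

/-- A group is virtually cyclic if it has a cyclic subgroup of finite index. -/
def VirtuallyCyclic (G : Type*) [Group G] : Prop :=
  ∃ H : Subgroup G, IsCyclic ↥H ∧ H.FiniteIndex

/-- `S` is a generating set of `G`. -/
def IsGenSet {G : Type*} [Group G] (S : Set G) : Prop :=
  Subgroup.closure S = ⊤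

/-- The word length of `g` with respect to `S`: the least `n` such that `g` is a product of
`n` elements of `S ∪ S⁻¹`. -/
def wordLength {G : Type*} [Group G] (S : Set G) (g : G) : ℕ :=
  sInf {n : ℕ | ∃ l : List G, l.length = n ∧ (∀ s ∈ l, s ∈ S ∨ s⁻¹ ∈ S) ∧ l.prod = g}

/-- The word metric `d_S(g,h) = ‖g⁻¹h‖_S` on `G`. -/
def wordDist {G : Type*} [Group G] (S : Set G) : G → G → ℝ :=
  fun g h => (wordLength S (g⁻¹ * h) : ℝ)

/-- `S ⪯ T` : `S` is dominated by `T`, i.e. `sup_{t ∈ T} ‖t‖_S < ∞`. -/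
def GenSetDominated {G : Type*} [Group G] (S T : Set G) : Prop :=
  ∃ M : ℕ, ∀ t ∈ T, wordLength S t ≤ M

/-- Equivalence of generating sets: mutual domination. -/
def GenSetEquiv {G : Type*} [Group G] (S T : Set G) : Prop :=
  GenSetDominated S T ∧ GenSetDominated T S

/-- The left multiplication action of a group on itself. -/
def leftTranslation {G : Type*} [Group G] : G → G → G := fun g x => g * x

universe uX uG

/-- A bundled isometric action of `G` on a geodesic, δ-hyperbolic (Rips condition)
metric space. -/
structure GrpActHypSpace (G : Type uG) [Group G] : Type (max uG (uX + 1)) where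
  carrier : Type uX
  [inst : MetricSpace carrier]
  act : G → carrier → carrier
  isIsomAction : IsIsomAction G carrier act
  δ : ℝ
  δ_nonneg : 0 ≤ δ
  geodesic : GeodesicSpace carrier
  rips : RipsHyperbolic carrier δ

attribute [instance] GrpActHypSpace.inst

/-- Property (NL): no isometric action of `G` on a geodesic Gromov-hyperbolic metric space
has a loxodromic element. -/
def PropNL (G : Type uG) [Group G] : Prop :=
  ∀ A : GrpActHypSpace.{uX, uG} G, ∀ g : G,
    ¬ LoxodromicWith (fun a b : A.carrier => dist a b) A.act g

/-- A generating set giving an acylindrically hyperbolic structure: the Cayley graph is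
Gromov hyperbolic (four-point condition) and the left multiplication action is acylindrical. -/
def IsAHGenSet {G : Type*} [Group G] (S : Set G) : Prop :=
  IsGenSet S ∧ FourPointHyperbolic (wordDist S) ∧ AcylindricalWith (wordDist S) leftTranslation

/-- The set of acylindrically hyperbolic structures on `G`: equivalence classes, under mutual
domination, of generating sets giving acylindrically hyperbolic structures. -/
def AHStructures (G : Type*) [Group G] : Type _ :=
  Quot fun S T : {S : Set G // IsAHGenSet S} => GenSetEquiv S.1 T.1

/-- `G` is acylindrically hyperbolic: not virtually cyclic and admits an acylindrical
isometric action with unbounded orbits on a geodesic δ-hyperbolic space. -/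
def AcylindricallyHyperbolic (G : Type uG) [Group G] : Prop :=
  ¬ VirtuallyCyclic G ∧
    ∃ A : GrpActHypSpace.{uX, uG} G,
      AcylindricalWith (fun a b : A.carrier => dist a b) A.act ∧
      ∃ x : A.carrier, ¬ Bornology.IsBounded (Set.range fun g : G => A.act g x)

/-- A system of blocks: each block `b` has a past side `P b` and a future side `Q b`. -/
structure BlockSys (X B : Type*) where
  P : B → Set X
  Q : B → Set X
  flip : B → B
  idx : B → ℕ
  base : B → X
  P_flip : ∀ b, P (flip b) = Q b
  Q_flip : ∀ b, Q (flip b) = P b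
  idx_flip : ∀ b, idx (flip b) = idx b
  disj : ∀ b x, x ∈ P b → x ∉ Q b
  base_P : ∀ b, base b ∉ P b
  base_Q : ∀ b, base b ∉ Q b
  no_grid : ∀ D C : ℕ → B,
    (∀ i j, i < j → j < 6 → ∀ x, x ∈ Q (D i) ∨ x ∈ P (D j)) →
    (∀ i j, i < j → j < 6 → ∀ x, x ∈ Q (C i) ∨ x ∈ P (C j)) →
    (∃ x y, ∀ i < 6, x ∈ P (D i) ∧ y ∈ Q (D i)) →
    (∃ x y, ∀ i < 6, x ∈ P (C i) ∧ y ∈ Q (C i)) →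
    ∃ i < 6, ∃ j < 6, (∀ x, x ∈ Q (D i) ∨ x ∈ P (C j)) ∨ (∀ x, x ∈ Q (D i) ∨ x ∈ Q (C j)) ∨
      (∀ x, x ∈ P (D i) ∨ x ∈ P (C j)) ∨ (∀ x, x ∈ Q (C j) ∨ x ∈ P (D i))
  bdd : ∀ x y, ∃ M : ℕ, ∀ n, ∀ D : ℕ → B,
    (∀ i j, i < j → j < n → ∀ p, p ∈ Q (D i) ∨ p ∈ P (D j)) →
    (∀ i < n, x ∈ P (D i) ∧ y ∈ Q (D i)) → n ≤ M
  base_sep : ∀ b x y, x ∈ P b → y ∈ Q b → ∀ c d : B,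
    (∀ p, p ∈ Q c ∨ p ∈ P d) → x ∈ P c → y ∈ P c → base b ∈ Q c →
    x ∈ P d → y ∈ P d → base b ∈ Q d → False

namespace BlockSys

variable {X B : Type*} (𝔅 : BlockSys X B)

/-- `c` lies after `b`. -/
def lt (b c : B) : Prop := ∀ x, x ∈ 𝔅.Q b ∨ x ∈ 𝔅.P c

variable {𝔅}

theorem lt.trans {b c d : B} (h : 𝔅.lt b c) (h' : 𝔅.lt c d) : 𝔅.lt b d := fun x =>
  (h x).elim Or.inl fun hx => (h' x).elim (fun hq => absurd hq (𝔅.disj c x hx)) Or.inr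

theorem lt.flip {b c : B} (h : 𝔅.lt b c) : 𝔅.lt (𝔅.flip c) (𝔅.flip b) := fun x => by
  rw [𝔅.P_flip, 𝔅.Q_flip]; exact (h x).symm

variable (𝔅) in
/-- `D 0 < ... < D (n-1)` is a chain of blocks of index in `A` separating `S` from `T`. -/
structure IsChain (A : Set ℕ) (n : ℕ) (S T : Set X) (D : ℕ → B) : Prop where
  idx : ∀ i < n, 𝔅.idx (D i) ∈ A
  lt : ∀ i j, i < j → j < n → 𝔅.lt (D i) (D j)
  left : ∀ i < n, S ⊆ 𝔅.P (D i)
  right : ∀ i < n, T ⊆ 𝔅.Q (D i)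

variable (𝔅) in
/-- There is a chain of length `n` separating `S` from `T`. -/
def Sep (A : Set ℕ) (n : ℕ) (S T : Set X) : Prop := ∃ D, 𝔅.IsChain A n S T D

variable {A : Set ℕ} {n m : ℕ} {S T S' T' : Set X}

theorem IsChain.sub {D : ℕ → B} (h : 𝔅.IsChain A n S T D) (s m : ℕ) (hm : s + m ≤ n)
    (hS : ∀ i, s ≤ i → i < s + m → S' ⊆ 𝔅.P (D i)) (hT : ∀ i, s ≤ i → i < s + m → T' ⊆ 𝔅.Q (D i)) :
    𝔅.Sep A m S' T' :=
  ⟨fun i => D (s + i), fun i hi => h.idx _ (by omega), fun i j hij hj => h.lt _ _ (by omega) (by omega),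
    fun i hi => hS _ (by omega) (by omega), fun i hi => hT _ (by omega) (by omega)⟩

theorem Sep.mono (h : 𝔅.Sep A n S T) (hm : m ≤ n) (hS : S' ⊆ S) (hT : T' ⊆ T) :
    𝔅.Sep A m S' T' := by
  obtain ⟨D, hD⟩ := h
  exact hD.sub 0 m (by omega) (fun i _ hi => hS.trans (hD.left i (by omega)))
    (fun i _ hi => hT.trans (hD.right i (by omega)))

theorem Sep.symm (h : 𝔅.Sep A n S T) : 𝔅.Sep A n T S := by
  obtain ⟨D, hD⟩ := h
  refine ⟨fun i => 𝔅.flip (D (n - 1 - i)), fun i hi => ?_, fun i j hij hj => ?_, fun i hi => ?_,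
    fun i hi => ?_⟩
  · rw [𝔅.idx_flip]; exact hD.idx _ (by omega)
  · exact (hD.lt _ _ (by omega) (by omega)).flip
  · rw [𝔅.P_flip]; exact hD.right _ (by omega)
  · rw [𝔅.Q_flip]; exact hD.left _ (by omega)

theorem IsChain.mem_P {D : ℕ → B} (h : 𝔅.IsChain A n S T D) {i j : ℕ} (hij : i < j) (hj : j < n)
    {y : X} (hy : y ∉ 𝔅.Q (D i)) : y ∈ 𝔅.P (D j) :=
  (h.lt i j hij hj y).resolve_left hy

theorem IsChain.mem_Q {D : ℕ → B} (h : 𝔅.IsChain A n S T D) {i j : ℕ} (hij : i < j) (hj : j < n)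
    {y : X} (hy : y ∉ 𝔅.P (D j)) : y ∈ 𝔅.Q (D i) :=
  (h.lt i j hij hj y).resolve_right hy

theorem IsChain.position {D : ℕ → B} (h : 𝔅.IsChain A n S T D) (y : X) :
    ∃ p ≤ n, (∀ i < p, y ∈ 𝔅.Q (D i)) ∧ (∀ i, p < i → i < n → y ∈ 𝔅.P (D i)) := by
  classical
  have hex : ∃ i, i < n → y ∉ 𝔅.Q (D i) := ⟨n, fun h => absurd h (lt_irrefl _)⟩
  refine ⟨Nat.find hex, ?_, fun i hi => ?_, fun i hi hin => ?_⟩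
  · exact Nat.find_min' hex fun h => absurd h (lt_irrefl _)
  · have := Nat.find_min hex hi
    push Not at this
    exact this.2
  · exact h.mem_P hi hin (Nat.find_spec hex (by omega))

theorem Sep.split (h : 𝔅.Sep A n S T) (y : X) :
    ∃ p q, n ≤ p + q + 1 ∧ 𝔅.Sep A p S (insert y T) ∧ 𝔅.Sep A q (insert y S) T := by
  obtain ⟨D, hD⟩ := h
  obtain ⟨p, hp, h1, h2⟩ := hD.position y
  refine ⟨p, n - p - 1, by omega, hD.sub 0 p (by omega) (fun i _ hi => hD.left _ (by omega))
    (fun i _ hi => Set.insert_subset (h1 _ (by omega)) (hD.right _ (by omega))), ?_⟩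
  rcases Nat.lt_or_ge p n with hpn | hpn
  · exact hD.sub (p + 1) _ (by omega) (fun i hi hi' => Set.insert_subset (h2 _ (by omega) (by omega))
      (hD.left _ (by omega))) (fun i _ hi => hD.right _ (by omega))
  · have : n - p - 1 = 0 := by omega
    rw [this]
    exact hD.sub 0 0 (by omega) (fun i hi hi' => by omega) (fun i hi hi' => by omega)

theorem IsChain.split₂ {D : ℕ → B} (hD : 𝔅.IsChain A n S T D) {y w : X} {p q : ℕ} (hpq : p ≤ q)
    (hq : q ≤ n) (hp1 : ∀ i < p, y ∈ 𝔅.Q (D i)) (hp2 : ∀ i, p < i → i < n → y ∈ 𝔅.P (D i))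
    (hq1 : ∀ i < q, w ∈ 𝔅.Q (D i)) (hq2 : ∀ i, q < i → i < n → w ∈ 𝔅.P (D i)) :
    ∃ a b c, n ≤ a + b + c + 2 ∧ 𝔅.Sep A a S (insert y (insert w T)) ∧
      𝔅.Sep A c (insert y (insert w S)) T ∧ 𝔅.Sep A b (insert y S) (insert w T) := by
  refine ⟨p, q - p - 1, n - q - 1, by omega, ?_, ?_, ?_⟩
  · exact hD.sub 0 p (by omega) (fun i _ hi => hD.left _ (by omega)) (fun i _ hi =>
      Set.insert_subset (hp1 _ (by omega)) (Set.insert_subset (hq1 _ (by omega))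
        (hD.right _ (by omega))))
  · rcases Nat.lt_or_ge q n with hqn | hqn
    · exact hD.sub (q + 1) _ (by omega) (fun i _ hi => Set.insert_subset (hp2 _ (by omega) (by omega))
        (Set.insert_subset (hq2 _ (by omega) (by omega)) (hD.left _ (by omega))))
        (fun i _ hi => hD.right _ (by omega))
    · have : n - q - 1 = 0 := by omega
      rw [this]
      exact hD.sub 0 0 (by omega) (fun i hi hi' => by omega) (fun i hi hi' => by omega)
  · rcases Nat.lt_or_ge p q with hpq | hpq
    · exact hD.sub (p + 1) _ (by omega) (fun i _ hi => Set.insert_subset (hp2 _ (by omega) (by omega))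
        (hD.left _ (by omega))) (fun i _ hi => Set.insert_subset (hq1 _ (by omega))
          (hD.right _ (by omega)))
    · have : q - p - 1 = 0 := by omega
      rw [this]
      exact hD.sub 0 0 (by omega) (fun i hi hi' => by omega) (fun i hi hi' => by omega)

theorem Sep.split₂ (h : 𝔅.Sep A n S T) (y w : X) :
    ∃ a b c, n ≤ a + b + c + 2 ∧ 𝔅.Sep A a S (insert y (insert w T)) ∧
      𝔅.Sep A c (insert y (insert w S)) T ∧
      (𝔅.Sep A b (insert y S) (insert w T) ∨ 𝔅.Sep A b (insert w S) (insert y T)) := by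
  obtain ⟨D, hD⟩ := h
  obtain ⟨p, hp, hp1, hp2⟩ := hD.position y
  obtain ⟨q, hq, hq1, hq2⟩ := hD.position w
  rcases le_total p q with hpq | hpq
  · obtain ⟨a, b, c, h1, h2, h3, h4⟩ := hD.split₂ hpq hq hp1 hp2 hq1 hq2
    exact ⟨a, b, c, h1, h2, h3, Or.inl h4⟩
  · obtain ⟨a, b, c, h1, h2, h3, h4⟩ := hD.split₂ hpq hp hq1 hq2 hp1 hp2
    rw [Set.insert_comm] at h2 h3
    exact ⟨a, b, c, h1, h2, h3, Or.inr h4⟩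

theorem IsChain.append {a b i j : ℕ} {D C : ℕ → B} (hD : 𝔅.IsChain A a S T D)
    (hC : 𝔅.IsChain A b S T C) (hi : i < a) (hj : j < b) (hij : 𝔅.lt (D i) (C j)) :
    𝔅.Sep A (i + 1 + (b - j)) S T := by
  have key : ∀ k l, k ≤ i → j ≤ l → l < b → 𝔅.lt (D k) (C l) := by
    intro k l hk hl hlb
    have h1 : 𝔅.lt (D k) (C j) := by
      rcases hk.lt_or_eq with hk | rfl
      · exact (hD.lt _ _ hk hi).trans hij
      · exact hij
    rcases hl.lt_or_eq with hl | rfl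
    · exact h1.trans (hC.lt _ _ hl hlb)
    · exact h1
  refine ⟨fun k => if k ≤ i then D k else C (k - (i + 1) + j), fun k hk => ?_, fun k l hkl hl => ?_,
    fun k hk => ?_, fun k hk => ?_⟩
  · split_ifs
    · exact hD.idx _ (by omega)
    · exact hC.idx _ (by omega)
  · split_ifs
    · exact hD.lt _ _ hkl (by omega)
    · exact key _ _ (by omega) (by omega) (by omega)
    · omega
    · exact hC.lt _ _ (by omega) (by omega)
  · split_ifs
    · exact hD.left _ (by omega)
    · exact hC.left _ (by omega)
  · split_ifs
    · exact hD.right _ (by omega)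
    · exact hC.right _ (by omega)

theorem IsChain.mono {D : ℕ → B} (h : 𝔅.IsChain A n S T D) (hS : S' ⊆ S) (hT : T' ⊆ T) :
    𝔅.IsChain A n S' T' D :=
  ⟨h.idx, h.lt, fun i hi => hS.trans (h.left i hi), fun i hi => hT.trans (h.right i hi)⟩

theorem Sep.join {a b : ℕ} {x y z : X} (h : 𝔅.Sep A a S (insert y T)) (h' : 𝔅.Sep A b (insert y S) T)
    (hx : x ∈ S) (hz : z ∈ T) : 𝔅.Sep A (a + b - 10) S T := by
  rcases Nat.lt_or_ge a 6 with ha | ha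
  · exact h'.mono (by omega) (Set.subset_insert _ _) le_rfl
  rcases Nat.lt_or_ge b 6 with hb | hb
  · exact h.mono (by omega) le_rfl (Set.subset_insert _ _)
  obtain ⟨D, hD⟩ := h
  obtain ⟨C, hC⟩ := h'
  have Dx : ∀ i < a, x ∈ 𝔅.P (D i) := fun i hi => hD.left i hi hx
  have Dy : ∀ i < a, y ∈ 𝔅.Q (D i) := fun i hi => hD.right i hi (Set.mem_insert _ _)
  have Dz : ∀ i < a, z ∈ 𝔅.Q (D i) := fun i hi => hD.right i hi (Set.mem_insert_of_mem _ hz)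
  have Cx : ∀ i < b, x ∈ 𝔅.P (C i) := fun i hi => hC.left i hi (Set.mem_insert_of_mem _ hx)
  have Cy : ∀ i < b, y ∈ 𝔅.P (C i) := fun i hi => hC.left i hi (Set.mem_insert _ _)
  have Cz : ∀ i < b, z ∈ 𝔅.Q (C i) := fun i hi => hC.right i hi hz
  obtain ⟨i, hi, j, hj, hh⟩ := 𝔅.no_grid (fun i => D (a - 6 + i)) C
    (fun i j hij hj => hD.lt _ _ (by omega) (by omega))
    (fun i j hij hj => hC.lt _ _ (by omega) (by omega))
    ⟨x, y, fun i hi => ⟨Dx _ (by omega), Dy _ (by omega)⟩⟩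
    ⟨y, z, fun i hi => ⟨Cy _ (by omega), Cz _ (by omega)⟩⟩
  have hlt : 𝔅.lt (D (a - 6 + i)) (C j) := by
    rcases hh with hh | hh | hh | hh
    · exact hh
    · rcases hh x with h | h
      · exact absurd h (𝔅.disj _ _ (Dx _ (by omega)))
      · exact absurd h (𝔅.disj _ _ (Cx _ (by omega)))
    · rcases hh z with h | h
      · exact absurd (Dz _ (by omega)) (𝔅.disj _ _ h)
      · exact absurd (Cz _ (by omega)) (𝔅.disj _ _ h)
    · rcases hh y with h | h
      · exact absurd h (𝔅.disj _ _ (Cy _ (by omega)))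
      · exact absurd (Dy _ (by omega)) (𝔅.disj _ _ h)
  have := (hD.mono le_rfl (Set.subset_insert y T)).append (hC.mono (Set.subset_insert y S) le_rfl)
    (by omega) (by omega) hlt
  exact this.mono (by omega) le_rfl le_rfl

theorem Sep.not_cross {a b : ℕ} {x y z w : X} (h : 𝔅.Sep A a {x, y} {z, w})
    (h' : 𝔅.Sep A b {y, z} {w, x}) : a ≤ 5 ∨ b ≤ 5 := by
  by_contra! hab
  obtain ⟨D, hD⟩ := h
  obtain ⟨C, hC⟩ := h'
  have Dx : ∀ i < a, x ∈ 𝔅.P (D i) := fun i hi => hD.left i hi (by simp)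
  have Dy : ∀ i < a, y ∈ 𝔅.P (D i) := fun i hi => hD.left i hi (by simp)
  have Dz : ∀ i < a, z ∈ 𝔅.Q (D i) := fun i hi => hD.right i hi (by simp)
  have Dw : ∀ i < a, w ∈ 𝔅.Q (D i) := fun i hi => hD.right i hi (by simp)
  have Cy : ∀ i < b, y ∈ 𝔅.P (C i) := fun i hi => hC.left i hi (by simp)
  have Cz : ∀ i < b, z ∈ 𝔅.P (C i) := fun i hi => hC.left i hi (by simp)
  have Cw : ∀ i < b, w ∈ 𝔅.Q (C i) := fun i hi => hC.right i hi (by simp)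
  have Cx : ∀ i < b, x ∈ 𝔅.Q (C i) := fun i hi => hC.right i hi (by simp)
  obtain ⟨i, hi, j, hj, hh⟩ := 𝔅.no_grid D C
    (fun i j hij hj => hD.lt _ _ (by omega) (by omega))
    (fun i j hij hj => hC.lt _ _ (by omega) (by omega))
    ⟨x, z, fun i hi => ⟨Dx _ (by omega), Dz _ (by omega)⟩⟩
    ⟨y, w, fun i hi => ⟨Cy _ (by omega), Cw _ (by omega)⟩⟩
  have hi : i < a := by omega
  have hj : j < b := by omega
  have d1 := 𝔅.disj (D i)
  have d2 := 𝔅.disj (C j)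
  rcases hh with hh | hh | hh | hh
  · rcases hh x with h | h
    · exact d1 _ (Dx i hi) h
    · exact d2 _ h (Cx j hj)
  · rcases hh y with h | h
    · exact d1 _ (Dy i hi) h
    · exact d2 _ (Cy j hj) h
  · rcases hh w with h | h
    · exact d1 _ h (Dw i hi)
    · exact d2 _ h (Cw j hj)
  · rcases hh z with h | h
    · exact d2 _ (Cz j hj) h
    · exact d1 _ h (Dz i hi)

variable (𝔅) in
/-- The largest number of blocks in a chain separating two points. -/
def N (A : Set ℕ) (x y : X) : ℕ := sSup {n | 𝔅.Sep A n {x} {y}}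

theorem bddAbove_sep (A : Set ℕ) (x y : X) : BddAbove {n | 𝔅.Sep A n {x} {y}} := by
  obtain ⟨M, hM⟩ := 𝔅.bdd x y
  refine ⟨M, fun n hn => ?_⟩
  obtain ⟨D, hD⟩ := hn
  exact hM n D hD.lt fun i hi => ⟨hD.left i hi rfl, hD.right i hi rfl⟩

theorem Sep.le_N {x y : X} (h : 𝔅.Sep A n {x} {y}) : n ≤ 𝔅.N A x y :=
  le_csSup (bddAbove_sep A x y) h

theorem Sep.le_N' {x y : X} (h : 𝔅.Sep A n S T) (hx : x ∈ S) (hy : y ∈ T) : n ≤ 𝔅.N A x y :=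
  (h.mono le_rfl (by simpa using hx) (by simpa using hy)).le_N

theorem Sep.zero [Nonempty B] : 𝔅.Sep A 0 S T :=
  ⟨fun _ => Classical.arbitrary B, fun i hi => by omega, fun i j hi hj => by omega,
    fun i hi => by omega, fun i hi => by omega⟩

theorem IsChain.near_left {D : ℕ → B} {x x' y : X} (hD : 𝔅.IsChain A n {x} {y} D) {j : ℕ}
    (hj : 𝔅.N A x x' < j) (hjn : j < n) : x' ∈ 𝔅.P (D j) := by
  by_contra hx
  have : 𝔅.Sep A j {x} {x'} := hD.sub 0 j (by omega) (fun i hi hi' => hD.left i (by omega))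
    (fun i hi hi' => by simpa using hD.mem_Q (i := i) (by omega) hjn hx)
  have := this.le_N
  omega

theorem IsChain.near_right {D : ℕ → B} {x y y' : X} (hD : 𝔅.IsChain A n {x} {y} D) {j : ℕ}
    (hj : j + 1 + 𝔅.N A y' y < n) : y' ∈ 𝔅.Q (D j) := by
  by_contra hx
  have : 𝔅.Sep A (n - j - 1) {y'} {y} := hD.sub (j + 1) _ (by omega) (fun i hi hi' => by
      simpa using hD.mem_P (j := i) (by omega) (by omega) hx) (fun i hi hi' => hD.right i (by omega))
  have := this.le_N
  omega

theorem four_point_aux {x y z w : X} {a b c a' b' c' : ℕ}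
    (hn : 𝔅.N A x z ≤ a + b + c + 2) (hn' : 𝔅.N A y w ≤ a' + b' + c' + 2)
    (ha : 𝔅.Sep A a {x} {y, w, z}) (hb : 𝔅.Sep A b {y, x} {w, z}) (hc : 𝔅.Sep A c {y, w, x} {z})
    (ha' : 𝔅.Sep A a' {y} {x, z, w}) (hc' : 𝔅.Sep A c' {x, z, y} {w})
    (hb' : 𝔅.Sep A b' {x, y} {z, w} ∨ 𝔅.Sep A b' {z, y} {x, w}) :
    𝔅.N A x z + 𝔅.N A y w ≤ max (𝔅.N A x y + 𝔅.N A z w) (𝔅.N A x w + 𝔅.N A y z) + 66 := by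
  have e1 : a + b + c' ≤ 𝔅.N A x w + 20 := by
    have h1 : 𝔅.Sep A (a + b - 10) {x} {w, z} := ha.join hb (x := x) (z := z) (by simp) (by simp)
    have h2 : 𝔅.Sep A (a + b - 10 + c' - 10) {x} {w} :=
      Sep.join (y := z) (x := x) (z := w) (h1.mono le_rfl le_rfl (by simp [Set.pair_comm]))
        (hc'.mono le_rfl (by intro v; simp; tauto) le_rfl) (by simp) (by simp)
    have := h2.le_N
    omega
  have e2 : a' + b + c ≤ 𝔅.N A y z + 20 := by
    have h1 : 𝔅.Sep A (a' + b - 10) {y} {w, z} :=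
      Sep.join (y := x) (x := y) (z := z) (ha'.mono le_rfl le_rfl (by intro v; simp; tauto))
        (hb.mono le_rfl (by intro v; simp; tauto) le_rfl) (by simp) (by simp)
    have h2 : 𝔅.Sep A (a' + b - 10 + c - 10) {y} {z} :=
      Sep.join (y := w) (x := y) (z := z) h1
        (hc.mono le_rfl (by intro v; simp; tauto) le_rfl) (by simp) (by simp)
    have := h2.le_N
    omega
  rcases hb' with hb' | hb'
  · have e3 : a + b' + c ≤ 𝔅.N A x z + 20 := by
      have h1 : 𝔅.Sep A (a + b' - 10) {x} {w, z} :=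
        Sep.join (y := y) (x := x) (z := z) ha
          (hb'.mono le_rfl (by intro v; simp; tauto) (by intro v; simp; tauto)) (by simp) (by simp)
      have h2 : 𝔅.Sep A (a + b' - 10 + c - 10) {x} {z} :=
        Sep.join (y := w) (x := x) (z := z) h1
          (hc.mono le_rfl (by intro v; simp; tauto) le_rfl) (by simp) (by simp)
      have := h2.le_N
      omega
    have := le_max_right (𝔅.N A x y + 𝔅.N A z w) (𝔅.N A x w + 𝔅.N A y z)
    omega
  · have hx : b ≤ 5 ∨ b' ≤ 5 := Sep.not_cross (𝔅 := 𝔅) (A := A) (x := x) (y := y) (z := z) (w := w)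
      (hb.mono le_rfl (by intro v; simp; tauto) (by intro v; simp; tauto))
      (hb'.mono le_rfl (by intro v; simp; tauto) (by intro v; simp; tauto))
    rcases hx with hx | hx
    · have e3 : a + b' + a' ≤ 𝔅.N A x y + 20 := by
        have h1 : 𝔅.Sep A (a + b' - 10) {x} {z, y} :=
          Sep.join (y := w) (x := x) (z := y) (ha.mono le_rfl le_rfl (by intro v; simp; tauto))
            (hb'.symm.mono le_rfl (by intro v; simp; tauto) (by intro v; simp)) (by simp) (by simp)
        have h2 : 𝔅.Sep A (a + b' - 10 + a' - 10) {x} {y} :=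
          Sep.join (y := z) (x := x) (z := y) h1
            (ha'.symm.mono le_rfl (by intro v; simp; tauto) le_rfl) (by simp) (by simp)
        have := h2.le_N
        omega
      have e4 : c + b' + c' ≤ 𝔅.N A z w + 20 := by
        have h1 : 𝔅.Sep A (c + b' - 10) {z} {x, w} :=
          Sep.join (y := y) (x := z) (z := w) (hc.symm.mono le_rfl le_rfl (by intro v; simp; tauto))
            (hb'.mono le_rfl (by intro v; simp; tauto) le_rfl) (by simp) (by simp)
        have h2 : 𝔅.Sep A (c + b' - 10 + c' - 10) {z} {w} :=
          Sep.join (y := x) (x := z) (z := w) h1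
            (hc'.mono le_rfl (by intro v; simp; tauto) le_rfl) (by simp) (by simp)
        have := h2.le_N
        omega
      have := le_max_left (𝔅.N A x y + 𝔅.N A z w) (𝔅.N A x w + 𝔅.N A y z)
      omega
    · have := le_max_right (𝔅.N A x y + 𝔅.N A z w) (𝔅.N A x w + 𝔅.N A y z)
      omega

variable [Nonempty B]

theorem sep_N (A : Set ℕ) (x y : X) : 𝔅.Sep A (𝔅.N A x y) {x} {y} :=
  Nat.sSup_mem ⟨0, Sep.zero⟩ (bddAbove_sep A x y)

theorem N_symm (A : Set ℕ) (x y : X) : 𝔅.N A x y = 𝔅.N A y x :=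
  le_antisymm (sep_N A x y).symm.le_N (sep_N A y x).symm.le_N

theorem N_self (A : Set ℕ) (x : X) : 𝔅.N A x x = 0 := by
  by_contra h
  obtain ⟨D, hD⟩ := 𝔅.sep_N A x x
  exact 𝔅.disj _ x (hD.left 0 (by omega) rfl) (hD.right 0 (by omega) rfl)

theorem N_mono {A A' : Set ℕ} (h : A ⊆ A') (x y : X) : 𝔅.N A x y ≤ 𝔅.N A' x y := by
  obtain ⟨D, hD⟩ := 𝔅.sep_N A x y
  exact Sep.le_N ⟨D, fun i hi => h (hD.idx i hi), hD.lt, hD.left, hD.right⟩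

theorem N_triangle (A : Set ℕ) (x y z : X) : 𝔅.N A x z ≤ 𝔅.N A x y + 𝔅.N A y z + 1 := by
  obtain ⟨p, q, h, hp, hq⟩ := (𝔅.sep_N A x z).split y
  have := hp.le_N' (x := x) (y := y) (by simp) (by simp)
  have := hq.le_N' (x := y) (y := z) (by simp) (by simp)
  omega

theorem four_point (A : Set ℕ) (x y z w : X) :
    𝔅.N A x z + 𝔅.N A y w ≤ max (𝔅.N A x y + 𝔅.N A z w) (𝔅.N A x w + 𝔅.N A y z) + 66 := by
  obtain ⟨a, b, c, hn, ha, hc, hb⟩ := (𝔅.sep_N A x z).split₂ y w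
  rcases hb with hb | hb
  · obtain ⟨a', b', c', hn', ha', hc', hb'⟩ := (𝔅.sep_N A y w).split₂ x z
    exact four_point_aux hn hn' ha hb hc ha' hc' hb'
  · obtain ⟨a', b', c', hn', ha', hc', hb'⟩ := (𝔅.sep_N A w y).split₂ x z
    have := four_point_aux (x := x) (y := w) (z := z) (w := y) hn hn'
      (by rwa [Set.insert_comm]) hb (by rwa [Set.insert_comm]) ha' hc' hb'
    rw [N_symm A w y, N_symm A w z, max_comm, N_symm A z y] at this
    omega

theorem exists_between (A : Set ℕ) (x y : X) (k : ℕ) (hk : k < 𝔅.N A x y) :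
    ∃ b, 𝔅.N A x (𝔅.base b) ≤ k + 13 ∧ 𝔅.N A (𝔅.base b) y + k ≤ 𝔅.N A x y + 13 := by
  obtain ⟨D, hD⟩ := 𝔅.sep_N A x y
  refine ⟨D k, ?_, ?_⟩
  · obtain ⟨p, q, h, hp, hq⟩ := (𝔅.sep_N A x (𝔅.base (D k))).split y
    have hq1 : q ≤ 1 := by
      by_contra! hq1
      obtain ⟨C, hC⟩ := hq
      exact 𝔅.base_sep (D k) x y (hD.left k hk rfl) (hD.right k hk rfl) (C 0) (C 1)
        (hC.lt 0 1 (by omega) (by omega)) (hC.left 0 (by omega) (by simp))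
        (hC.left 0 (by omega) (by simp)) (hC.right 0 (by omega) (by simp))
        (hC.left 1 (by omega) (by simp)) (hC.left 1 (by omega) (by simp))
        (hC.right 1 (by omega) (by simp))
    have h2 : 𝔅.Sep A (𝔅.N A x y - k - 1) {𝔅.base (D k), x} {y} :=
      hD.sub (k + 1) _ (by omega) (fun i hi hi' => by
        rintro v (rfl | rfl)
        · exact hD.mem_P (i := k) (by omega) (by omega) (𝔅.base_Q _)
        · exact hD.left i (by omega) rfl) (fun i hi hi' => hD.right i (by omega))
    have h3 := (Sep.join (y := 𝔅.base (D k)) (x := x) (z := y)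
      (hp.mono le_rfl le_rfl (by rw [Set.pair_comm])) h2 (by simp) (by simp)).le_N
    omega
  · obtain ⟨p, q, h, hp, hq⟩ := (𝔅.sep_N A (𝔅.base (D k)) y).split x
    have hq1 : p ≤ 1 := by
      by_contra! hq1
      obtain ⟨C, hC⟩ := hp.symm
      exact 𝔅.base_sep (D k) x y (hD.left k hk rfl) (hD.right k hk rfl) (C 0) (C 1)
        (hC.lt 0 1 (by omega) (by omega)) (hC.left 0 (by omega) (by simp))
        (hC.left 0 (by omega) (by simp)) (hC.right 0 (by omega) (by simp))
        (hC.left 1 (by omega) (by simp)) (hC.left 1 (by omega) (by simp))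
        (hC.right 1 (by omega) (by simp))
    have h2 : 𝔅.Sep A k {x} {𝔅.base (D k), y} :=
      hD.sub 0 _ (by omega) (fun i hi hi' => hD.left i (by omega)) (fun i hi hi' => by
        rintro v (rfl | rfl)
        · exact hD.mem_Q (j := k) (by omega) (by omega) (𝔅.base_P _)
        · exact hD.right i (by omega) rfl)
    have h3 := (Sep.join (y := 𝔅.base (D k)) (x := x) (z := y) h2
      (hq.mono le_rfl (by rw [Set.pair_comm]) le_rfl) (by simp) (by simp)).le_N
    omega

end BlockSys

/-- A rough-geodesic hyperbolic distance `ρ` together with a comparable graph metric `w`. -/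
structure RoughHyp {Z : Type*} (ρ : Z → Z → ℝ) (w : Z → Z → ℕ) (δ : ℝ) : Prop where
  one_le : 1 ≤ δ
  nonneg : ∀ x y, 0 ≤ ρ x y
  self_le : ∀ x, ρ x x ≤ δ
  symm : ∀ x y, ρ x y = ρ y x
  tri : ∀ x y z, ρ x z ≤ ρ x y + ρ y z
  hyp : ∀ w x y z, min (gromovProd ρ w x z) (gromovProd ρ w z y) - δ ≤ gromovProd ρ w x y
  btw : ∀ x y (k : ℕ), (k : ℝ) ≤ ρ x y → ∃ z, ρ x z ≤ k + δ ∧ ρ z y ≤ ρ x y - k + δ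
  w_symm : ∀ x y, w x y = w y x
  w_tri : ∀ x y z, w x z ≤ w x y + w y z
  w_geod : ∀ x y, ∃ f : ℕ → Z, f 0 = x ∧ f (w x y) = y ∧
    ∀ i j, i ≤ j → j ≤ w x y → w (f i) (f j) = j - i
  w_le : ∀ x y, (w x y : ℝ) ≤ ρ x y + δ
  step : ∀ x y, w x y ≤ 1 → ρ x y ≤ δ

namespace RoughHyp

variable {Z : Type*} {ρ : Z → Z → ℝ} {w : Z → Z → ℕ} {δ : ℝ} (h : RoughHyp ρ w δ)
include h

theorem four_point (x y z u : Z) :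
    ρ x z + ρ y u ≤ max (ρ x y + ρ z u) (ρ x u + ρ y z) + 2 * δ := by
  have := h.hyp u x z y
  simp only [gromovProd] at this
  have h1 := h.symm u x
  have h2 := h.symm u y
  have h3 := h.symm u z
  rcases min_cases ((ρ u x + ρ u y - ρ x y) / 2) ((ρ u y + ρ u z - ρ y z) / 2) with h4 | h4
  · have := le_max_left (ρ x y + ρ z u) (ρ x u + ρ y z)
    linarith [h4.1]
  · have := le_max_right (ρ x y + ρ z u) (ρ x u + ρ y z)
    linarith [h4.1]

theorem path_log (z : Z) (f : ℕ → Z) (n : ℕ) (hf : ∀ i < n, ρ (f i) (f (i + 1)) ≤ δ) (k : ℕ) :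
    ∀ s L, L ≤ 2 ^ k → s + L ≤ n → ∃ i, s ≤ i ∧ i ≤ s + L ∧
      ρ z (f i) - δ - k * δ ≤ gromovProd ρ z (f s) (f (s + L)) := by
  have hδ := h.one_le
  induction k with
  | zero =>
    intro s L hL hs
    refine ⟨s, le_rfl, by omega, ?_⟩
    rcases Nat.eq_zero_or_pos L with rfl | hL0
    · have := h.self_le (f s)
      simp only [gromovProd, add_zero]
      push_cast; linarith
    · obtain rfl : L = 1 := by simp at hL; omega
      have := hf s (by omega)
      have h1 := h.tri z (f (s + 1)) (f s)
      rw [h.symm (f (s + 1))] at h1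
      simp only [gromovProd]
      push_cast; linarith
  | succ k ih =>
    intro s L hL hs
    rw [pow_succ] at hL
    obtain ⟨i, hi, hi', h1⟩ := ih s (L / 2) (by omega) (by omega)
    obtain ⟨j, hj, hj', h2⟩ := ih (s + L / 2) (L - L / 2) (by omega) (by omega)
    rw [show s + L / 2 + (L - L / 2) = s + L by omega] at h2
    have h3 := h.hyp z (f s) (f (s + L)) (f (s + L / 2))
    push_cast
    rcases min_choice (gromovProd ρ z (f s) (f (s + L / 2)))
      (gromovProd ρ z (f (s + L / 2)) (f (s + L))) with h4 | h4
    · exact ⟨i, by omega, by omega, by linarith⟩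
    · exact ⟨j, by omega, by omega, by linarith⟩

theorem btw_dist {x y : Z} {z z' : Z} {j k : ℝ} (hjk : j ≤ k)
    (h1 : ρ x z ≤ j + δ) (h2 : ρ z y ≤ ρ x y - j + δ)
    (h3 : ρ x z' ≤ k + δ) (h4 : ρ z' y ≤ ρ x y - k + δ) : ρ z z' ≤ k - j + 4 * δ := by
  have := h.four_point x z y z'
  have h5 := h.symm y z'
  rcases max_choice (ρ x z + ρ y z') (ρ x z' + ρ z y) with h6 | h6 <;> linarith [h.one_le]

theorem product_le_of_far {M : ℝ} {κ : ℕ} {z z₁ z₂ : Z} {f : ℕ → Z} {n i₁ i₂ : ℕ}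
    (hf : ∀ i < n, ρ (f i) (f (i + 1)) ≤ δ) (hM : ∀ i ≤ n, M ≤ ρ z (f i))
    (hi₁ : i₁ ≤ n) (hi₂ : i₂ ≤ n) (hfw : ∀ i j, i ≤ j → j ≤ n → w (f i) (f j) = j - i)
    (hlen : ρ (f i₁) (f i₂) + δ ≤ 2 ^ κ)
    (h₁ : M - δ ≤ gromovProd ρ z z₁ (f i₁)) (h₂ : M - δ ≤ gromovProd ρ z (f i₂) z₂) :
    M - (κ + 3) * δ ≤ gromovProd ρ z z₁ z₂ := by
  have hδ := h.one_le
  have key : M - δ - κ * δ ≤ gromovProd ρ z (f i₁) (f i₂) := by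
    have hsymm : ∀ a b, gromovProd ρ z a b = gromovProd ρ z b a := fun a b => by
      simp only [gromovProd]; rw [h.symm a b]; ring
    rcases le_total i₁ i₂ with hle | hle
    · have hw := h.w_le (f i₁) (f i₂)
      rw [hfw _ _ hle hi₂] at hw
      have : i₂ - i₁ ≤ 2 ^ κ := by exact_mod_cast hw.trans hlen
      obtain ⟨i, hi, hi', h3⟩ := h.path_log z f n hf κ i₁ (i₂ - i₁) this (by omega)
      rw [show i₁ + (i₂ - i₁) = i₂ by omega] at h3
      linarith [hM i (by omega)]
    · have hw := h.w_le (f i₂) (f i₁)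
      rw [hfw _ _ hle hi₁] at hw
      rw [h.symm] at hlen
      have : i₁ - i₂ ≤ 2 ^ κ := by exact_mod_cast hw.trans hlen
      obtain ⟨i, hi, hi', h3⟩ := h.path_log z f n hf κ i₂ (i₁ - i₂) this (by omega)
      rw [show i₂ + (i₁ - i₂) = i₁ by omega] at h3
      rw [hsymm]
      linarith [hM i (by omega)]
  have a := h.hyp z z₁ (f i₂) (f i₁)
  have b := h.hyp z z₁ z₂ (f i₂)
  have c1 : M - δ - κ * δ ≤ min (gromovProd ρ z z₁ (f i₁)) (gromovProd ρ z (f i₁) (f i₂)) :=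
    le_min (by nlinarith) key
  have c2 : M - δ - κ * δ - δ ≤ min (gromovProd ρ z z₁ (f i₂)) (gromovProd ρ z (f i₂) z₂) :=
    le_min (by linarith) (by nlinarith)
  linarith

omit h in
theorem exists_two_pow (a b c : ℝ) (hc : 0 < c) :
    ∃ R : ℝ, ∀ M, R ≤ M → a * M + b ≤ 2 ^ ⌊M / c⌋₊ := by
  have h1 : Filter.Tendsto (fun k : ℕ => (2 : ℝ) ^ k / (k : ℝ) ^ 2) Filter.atTop Filter.atTop := by
    have h2 := tendsto_pow_const_div_const_pow_of_one_lt 2 (r := (2 : ℝ)) (by norm_num)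
    have h3 : Filter.Tendsto (fun k : ℕ => (k : ℝ) ^ 2 / (2 : ℝ) ^ k) Filter.atTop
        (nhdsWithin 0 (Set.Ioi 0)) := by
      rw [tendsto_nhdsWithin_iff]
      refine ⟨h2, ?_⟩
      filter_upwards [Filter.eventually_gt_atTop 0] with k hk
      have : (0 : ℝ) < k := by exact_mod_cast hk
      simp only [Set.mem_Ioi]; positivity
    have := h3.inv_tendsto_nhdsGT_zero
    refine this.congr fun k => ?_
    simp
  have h2 := h1.eventually_ge_atTop (2 * |a| * c + |b|)
  obtain ⟨k0, hk0⟩ := Filter.eventually_atTop.1 (h2.and (Filter.eventually_ge_atTop 1))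
  refine ⟨(k0 + 1) * c, fun M hM => ?_⟩
  set k := ⌊M / c⌋₊ with hk
  have hM' : (k0 : ℝ) + 1 ≤ M / c := by rwa [le_div_iff₀ hc]
  have hkk : k0 ≤ k := Nat.le_floor (by linarith)
  obtain ⟨h3, h4⟩ := hk0 k hkk
  have h4' : (1 : ℝ) ≤ k := by exact_mod_cast h4
  have h5 : M / c < k + 1 := Nat.lt_floor_add_one _
  rw [div_lt_iff₀ hc] at h5
  have hM0 : 0 ≤ M := by
    have : (0 : ℝ) ≤ (k0 + 1) * c := by positivity
    linarith
  rw [le_div_iff₀ (by positivity)] at h3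
  calc a * M + b ≤ |a| * M + |b| := by
        gcongr
        · exact le_abs_self a
        · exact le_abs_self b
    _ ≤ |a| * ((k + 1) * c) + |b| := by gcongr
    _ ≤ |a| * ((2 * (k : ℝ) ^ 2) * c) + |b| * (k : ℝ) ^ 2 := by
        have : (k : ℝ) + 1 ≤ 2 * (k : ℝ) ^ 2 := by nlinarith
        have h7 : (1 : ℝ) ≤ (k : ℝ) ^ 2 := by nlinarith
        gcongr
        exact le_mul_of_one_le_right (abs_nonneg _) h7
    _ = (2 * |a| * c + |b|) * (k : ℝ) ^ 2 := by ring
    _ ≤ 2 ^ k := h3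

theorem morse : ∃ R : ℝ, ∀ x y z : Z, ∀ k : ℕ, (k : ℝ) ≤ ρ x y → ρ x z ≤ k + δ →
    ρ z y ≤ ρ x y - k + δ → w x z + w z y ≤ w x y + R := by
  have hδ := h.one_le
  obtain ⟨R, hR⟩ := exists_two_pow 6 (20 * δ) (2 * δ) (by linarith)
  set R' := max R (30 * δ) with hR'
  suffices H : ∀ x y : Z, ∀ k : ℕ, (k : ℝ) ≤ ρ x y → ∃ z, ρ x z ≤ k + δ ∧ ρ z y ≤ ρ x y - k + δ ∧
      ∀ f : ℕ → Z, f 0 = x → f (w x y) = y → (∀ i j, i ≤ j → j ≤ w x y → w (f i) (f j) = j - i) →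
        ∃ i ≤ w x y, ρ z (f i) ≤ R' by
    refine ⟨2 * (R' + 5 * δ), fun x y z k hk h1 h2 => ?_⟩
    obtain ⟨z', h1', h2', h3⟩ := H x y k hk
    obtain ⟨f, f0, f1, hf⟩ := h.w_geod x y
    obtain ⟨i, hi, h4⟩ := h3 f f0 f1 hf
    have e1 := h.btw_dist le_rfl h1 h2 h1' h2'
    have e2 := h.w_le z (f i)
    have e3 := h.tri z z' (f i)
    have e4 := h.w_tri x (f i) z
    have e5 := h.w_tri z (f i) y
    have e6 := hf 0 i (by omega) hi
    have e7 := hf i _ hi le_rfl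
    rw [f0] at e6
    rw [f1] at e7
    rw [h.w_symm (f i) z] at e4
    have : w x z + w z y ≤ w x y + 2 * w z (f i) := by omega
    have : (w x z : ℝ) + w z y ≤ w x y + 2 * w z (f i) := by exact_mod_cast this
    linarith
  intro x y
  have : Nonempty Z := ⟨x⟩
  choose! Zf hZ1 hZ2 using h.btw x y
  suffices H : ∀ f : ℕ → Z, f 0 = x → f (w x y) = y →
      (∀ i j, i ≤ j → j ≤ w x y → w (f i) (f j) = j - i) → ∀ k : ℕ, (k : ℝ) ≤ ρ x y →
        ∃ i ≤ w x y, ρ (Zf k) (f i) ≤ R' from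
    fun k hk => ⟨Zf k, hZ1 k hk, hZ2 k hk, fun f f0 f1 hf => H f f0 f1 hf k hk⟩
  intro f f0 f1 hf
  have hn0 := h.nonneg x y
  have hmin : ∀ k, ∃ i ∈ Finset.range (w x y + 1), ∀ j ∈ Finset.range (w x y + 1),
      ρ (Zf k) (f i) ≤ ρ (Zf k) (f j) := fun k =>
    Finset.exists_min_image _ _ ⟨0, by simp⟩
  choose I hI hImin using hmin
  simp only [Finset.mem_range, Nat.lt_succ_iff] at hI hImin
  obtain ⟨k, hk, hmax⟩ := Finset.exists_max_image (Finset.range (⌊ρ x y⌋₊ + 1))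
    (fun k => ρ (Zf k) (f (I k))) ⟨0, by simp⟩
  simp only [Finset.mem_range, Nat.lt_succ_iff, Nat.le_floor_iff hn0] at hk hmax
  suffices hM : ρ (Zf k) (f (I k)) ≤ R' from fun l hl => ⟨I l, hI l, (hmax l hl).trans hM⟩
  by_contra! hM
  set M := ρ (Zf k) (f (I k)) with hMdef
  have hMR : R < M := (le_max_left _ _).trans_lt hM
  have hMδ : 30 * δ < M := (le_max_right _ _).trans_lt hM
  have hstep : ∀ i < w x y, ρ (f i) (f (i + 1)) ≤ δ := fun i hi =>
    h.step _ _ (by rw [hf i (i + 1) (by omega) (by omega)]; omega)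
  have hfar : ∀ i ≤ w x y, M ≤ ρ (Zf k) (f i) := fun i hi => hImin k i hi
  set H := ⌈2 * M⌉₊ with hH
  have hH1 : 2 * M ≤ H := Nat.le_ceil _
  have hH2 : (H : ℝ) < 2 * M + 1 := Nat.ceil_lt_add_one (by linarith)
  have hzk1 := hZ1 k hk
  have hzk2 := hZ2 k hk
  have left : ∃ z₁ i₁ a, i₁ ≤ w x y ∧ ρ x z₁ ≤ a + δ ∧ ρ z₁ (Zf k) ≤ k - a + 4 * δ ∧
      (k : ℝ) - a ≤ H ∧ ρ z₁ (f i₁) ≤ M ∧ M - δ ≤ gromovProd ρ (Zf k) z₁ (f i₁) := by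
    rcases le_or_gt H k with hHk | hHk
    · have c : ((k - H : ℕ) : ℝ) = k - H := by push_cast [hHk]; ring
      have hle : ((k - H : ℕ) : ℝ) ≤ ρ x y := by rw [c]; linarith [(Nat.cast_nonneg H : (0:ℝ) ≤ H)]
      have e1 := hZ1 _ hle
      have e2 := hZ2 _ hle
      rw [c] at e1 e2
      refine ⟨Zf (k - H), I (k - H), k - H, hI _, e1, ?_, by linarith, hmax _ hle, ?_⟩
      · exact h.btw_dist (by linarith) e1 e2 hzk1 hzk2
      · have e3 := hmax _ hle
        have e4 := hfar _ (hI (k - H))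
        have e5 := h.tri x (Zf (k - H)) y
        have e6 := h.tri (Zf (k - H)) (Zf k) y
        have e7 := h.symm (Zf k) (Zf (k - H))
        simp only [gromovProd]
        linarith
    · have c : (k : ℝ) < H := by exact_mod_cast hHk
      have e1 := h.self_le x
      refine ⟨x, 0, 0, by omega, by linarith, by linarith, by linarith, by rw [f0]; linarith, ?_⟩
      have e2 := hfar 0 (by omega)
      rw [f0] at e2
      simp only [gromovProd, f0]
      linarith
  have right : ∃ z₂ i₂ b, i₂ ≤ w x y ∧ ρ z₂ y ≤ b + δ ∧ ρ (Zf k) z₂ ≤ ρ x y - k - b + 4 * δ ∧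
      ρ x y - k - b ≤ H + 1 ∧ ρ z₂ (f i₂) ≤ M ∧ M - δ ≤ gromovProd ρ (Zf k) (f i₂) z₂ := by
    rcases le_or_gt ((k + H : ℕ) : ℝ) (ρ x y) with hHk | hHk
    · have e1 := hZ1 _ hHk
      have e2 := hZ2 _ hHk
      push_cast at e1 e2
      refine ⟨Zf (k + H), I (k + H), ρ x y - k - H, hI _, by linarith, ?_, by linarith,
        hmax _ hHk, ?_⟩
      · have := h.btw_dist (by linarith) hzk1 hzk2 e1 e2
        linarith
      · have e3 := hmax _ hHk
        have e4 := hfar _ (hI (k + H))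
        have e5 := h.tri x (Zf k) y
        have e6 := h.tri (Zf k) (Zf (k + H)) y
        have e7 := h.symm (f (I (k + H))) (Zf (k + H))
        simp only [gromovProd]
        linarith
    · push_cast at hHk
      have e1 := h.self_le y
      refine ⟨y, w x y, 0, le_rfl, by linarith, by linarith, by linarith, by rw [f1]; linarith, ?_⟩
      have e2 := hfar _ le_rfl
      rw [f1] at e2
      simp only [gromovProd, f1]
      linarith
  obtain ⟨z₁, i₁, a, hi₁, a1, a2, a3, a4, a5⟩ := left
  obtain ⟨z₂, i₂, b, hi₂, b1, b2, b3, b4, b5⟩ := right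
  have hlen : ρ (f i₁) (f i₂) + δ ≤ 2 ^ ⌊M / (2 * δ)⌋₊ := by
    refine le_trans ?_ (hR M hMR.le)
    have e1 := h.tri (f i₁) z₁ (f i₂)
    have e2 := h.tri z₁ (Zf k) (f i₂)
    have e3 := h.tri (Zf k) z₂ (f i₂)
    rw [h.symm] at a4
    linarith
  have fin := h.product_le_of_far (z := Zf k) hstep hfar hi₁ hi₂ hf hlen a5 b5
  have hfl : (⌊M / (2 * δ)⌋₊ : ℝ) * (2 * δ) ≤ M := by
    rw [← le_div_iff₀ (by linarith)]
    exact Nat.floor_le (div_nonneg (by linarith) (by linarith))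
  have e1 := h.tri x z₁ y
  have e2 := h.tri z₁ z₂ y
  have e3 := h.symm (Zf k) z₁
  simp only [gromovProd] at fin
  linarith

theorem product_small : ∀ r : ℝ, 0 ≤ r → ∃ R : ℝ, ∀ x y z : Z, gromovProd ρ z x y ≤ r →
    (w x z : ℝ) + w z y ≤ w x y + R := by
  obtain ⟨R, hR⟩ := h.morse
  have hδ := h.one_le
  intro r hr
  refine ⟨R + 2 * (2 * r + 10 * δ), fun x y z hz => ?_⟩
  simp only [gromovProd] at hz
  have h1 : ∃ k : ℕ, (k : ℝ) ≤ ρ x y ∧ ρ x z ≤ k + 2 * r + 1 ∧ (k : ℝ) ≤ ρ x z := by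
    refine ⟨⌊min (ρ x y) (ρ x z)⌋₊, ?_, ?_, ?_⟩
    · exact (Nat.floor_le (le_min (h.nonneg _ _) (h.nonneg _ _))).trans (min_le_left _ _)
    · have := Nat.lt_floor_add_one (min (ρ x y) (ρ x z))
      have h2 := h.nonneg z y
      have h3 := h.symm z x
      rcases min_choice (ρ x y) (ρ x z) with h1 | h1 <;> rw [h1] at this ⊢ <;> linarith
    · exact (Nat.floor_le (le_min (h.nonneg _ _) (h.nonneg _ _))).trans (min_le_right _ _)
  obtain ⟨k, hk, hk1, hk2⟩ := h1
  obtain ⟨z', e1, e2⟩ := h.btw x y k hk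
  have e3 := hR x y z' k hk e1 e2
  have e4 : ρ z z' ≤ 2 * r + 4 * δ := by
    have e5 := h.four_point x z y z'
    have e6 := h.symm y z'
    have e7 := h.symm z x
    rcases max_choice (ρ x z + ρ y z') (ρ x z' + ρ z y) with h6 | h6 <;> linarith [h.one_le]
  have e5 := h.w_le z z'
  have e6 : (w x z : ℝ) ≤ w x z' + w z z' := by
    rw [h.w_symm z z']; exact_mod_cast h.w_tri x z' z
  have e7 : (w z y : ℝ) ≤ w z z' + w z' y := by exact_mod_cast h.w_tri z z' y
  linarith

theorem exists_center (x y u : Z) : ∃ c, gromovProd ρ c x y ≤ 20 * δ ∧ gromovProd ρ c x u ≤ 20 * δ ∧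
    gromovProd ρ c y u ≤ 20 * δ := by
  have hδ := h.one_le
  have hg : 0 ≤ gromovProd ρ x y u := by
    have := h.tri y x u
    rw [h.symm y x] at this
    simp only [gromovProd]; linarith
  have hfl := Nat.floor_le hg
  have hfl' := Nat.lt_floor_add_one (gromovProd ρ x y u)
  have hle : (⌊gromovProd ρ x y u⌋₊ : ℝ) ≤ ρ x y := by
    refine hfl.trans ?_
    have := h.tri x y u
    simp only [gromovProd]; linarith
  obtain ⟨c, h1, h2⟩ := h.btw x y _ hle
  set k := (⌊gromovProd ρ x y u⌋₊ : ℝ) with hk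
  simp only [gromovProd] at hfl hfl'
  have h3 := h.four_point x c y u
  have e1 := h.symm c x
  have e2 := h.symm y c
  have e3 := h.symm u c
  have e4 := h.symm y u
  refine ⟨c, ?_, ?_, ?_⟩ <;> simp only [gromovProd] <;>
  rcases max_choice (ρ x c + ρ y u) (ρ x u + ρ c y) with h6 | h6 <;> linarith

theorem fourPointHyperbolic : FourPointHyperbolic (fun x y => (w x y : ℝ)) := by
  have hδ := h.one_le
  obtain ⟨R, hR⟩ := h.product_small (21 * δ) (by linarith)
  refine ⟨max 0 R, le_max_left _ _, fun v x y u => ?_⟩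
  obtain ⟨c, h1, h2, h3⟩ := h.exists_center x y u
  have e0 := h.hyp c x y v
  have f1 := hR x u c (by linarith)
  have f2 := hR y u c (by linarith)
  have hRm : R ≤ max 0 R := le_max_right _ _
  have hs : ∀ a b, (w a b : ℝ) = w b a := fun a b => by rw [h.w_symm]
  have t1 : (w x y : ℝ) ≤ w x c + w c y := by exact_mod_cast h.w_tri x c y
  have t2 : (w u v : ℝ) ≤ w u c + w c v := by exact_mod_cast h.w_tri u c v
  have s1 := hs v x
  have s2 := hs v y
  have s3 := hs v u
  have s4 := hs c x
  have s5 := hs c y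
  have s6 := hs c u
  have s7 := hs c v
  have s8 := hs u y
  rcases min_choice (gromovProd ρ c x v) (gromovProd ρ c v y) with h6 | h6
  · have f3 := hR x v c (by linarith)
    refine le_trans (sub_le_sub_right (min_le_right _ _) _) ?_
    simp only [gromovProd]
    linarith
  · have f3 := hR v y c (by linarith)
    refine le_trans (sub_le_sub_right (min_le_left _ _) _) ?_
    simp only [gromovProd]
    linarith

end RoughHyp

section WordLength

variable {G : Type*} [Group G] {S T : Set G}

theorem wordLength_le_of_list (l : List G) (hl : ∀ s ∈ l, s ∈ S ∨ s⁻¹ ∈ S) :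
    wordLength S l.prod ≤ l.length :=
  Nat.sInf_le ⟨l, rfl, hl, rfl⟩

theorem exists_word (hS : IsGenSet S) (g : G) :
    ∃ l : List G, l.length = wordLength S g ∧ (∀ s ∈ l, s ∈ S ∨ s⁻¹ ∈ S) ∧ l.prod = g := by
  have : ({n : ℕ | ∃ l : List G, l.length = n ∧ (∀ s ∈ l, s ∈ S ∨ s⁻¹ ∈ S) ∧ l.prod = g}).Nonempty := by
    have hg : g ∈ Subgroup.closure S := by rw [hS]; trivial
    rw [← Subgroup.mem_toSubmonoid, Subgroup.closure_toSubmonoid] at hg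
    obtain ⟨l, hl, rfl⟩ := Submonoid.exists_list_of_mem_closure hg
    exact ⟨l.length, l, rfl, by simpa using hl, rfl⟩
  exact Nat.sInf_mem this

theorem wordLength_one : wordLength S (1 : G) = 0 := by
  simpa using wordLength_le_of_list (S := S) ([] : List G) (by simp)

theorem wordLength_mem {s : G} (hs : s ∈ S) : wordLength S s ≤ 1 := by
  simpa using wordLength_le_of_list (S := S) [s] (by simp [hs])

theorem wordLength_mul (hS : IsGenSet S) (g h : G) :
    wordLength S (g * h) ≤ wordLength S g + wordLength S h := by
  obtain ⟨l, hl, hl', rfl⟩ := exists_word hS g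
  obtain ⟨m, hm, hm', rfl⟩ := exists_word hS h
  rw [← hl, ← hm, ← List.length_append, ← List.prod_append]
  apply wordLength_le_of_list
  simp only [List.mem_append]
  rintro s (h | h)
  · exact hl' s h
  · exact hm' s h

theorem wordLength_inv_le (hS : IsGenSet S) (g : G) : wordLength S g⁻¹ ≤ wordLength S g := by
  obtain ⟨l, hl, hl', rfl⟩ := exists_word hS g
  rw [← hl, List.prod_inv_reverse]
  refine (wordLength_le_of_list _ ?_).trans (by simp)
  intro s hs
  simp only [List.mem_reverse, List.mem_map] at hs
  obtain ⟨a, ha, rfl⟩ := hs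
  rw [inv_inv]
  exact (hl' a ha).symm

theorem wordLength_inv (hS : IsGenSet S) (g : G) : wordLength S g⁻¹ = wordLength S g :=
  le_antisymm (wordLength_inv_le hS g) (by simpa using wordLength_inv_le hS g⁻¹)

theorem wordLength_le_mul (hS : IsGenSet S) (hT : IsGenSet T) {M : ℕ}
    (hM : ∀ t ∈ T, wordLength S t ≤ M) (g : G) : wordLength S g ≤ M * wordLength T g := by
  obtain ⟨l, hl, hl', rfl⟩ := exists_word hT g
  rw [← hl]
  clear hl
  induction l with
  | nil => simp [wordLength_one]
  | cons a l ih =>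
    have h1 := ih fun s hs => hl' s (by simp [hs])
    have h2 : wordLength S a ≤ M := by
      rcases hl' a (by simp) with h | h
      · exact hM _ h
      · rw [← wordLength_inv hS]; exact hM _ h
    have h3 := wordLength_mul hS a l.prod
    simp only [List.prod_cons, List.length_cons, mul_add, mul_one]
    omega

theorem GenSetDominated.trans {U : Set G} (hS : IsGenSet S) (hT : IsGenSet T)
    (h : GenSetDominated S T) (h' : GenSetDominated T U) : GenSetDominated S U := by
  obtain ⟨M, hM⟩ := h
  obtain ⟨M', hM'⟩ := h'
  exact ⟨M * M', fun u hu => (wordLength_le_mul hS hT hM u).trans (Nat.mul_le_mul_left _ (hM' u hu))⟩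

theorem GenSetDominated.of_subset (h : T ⊆ S) : GenSetDominated S T :=
  ⟨1, fun _ ht => wordLength_mem (h ht)⟩

theorem exists_word_path (hS : IsGenSet S) (x y : G) : ∃ f : ℕ → G, f 0 = x ∧
    f (wordLength S (x⁻¹ * y)) = y ∧ ∀ i j, i ≤ j → j ≤ wordLength S (x⁻¹ * y) →
      wordLength S ((f i)⁻¹ * f j) = j - i := by
  obtain ⟨l, hl, hl', hp⟩ := exists_word hS (x⁻¹ * y)
  rw [← hl]
  have hlast : (l.take l.length).prod = x⁻¹ * y := by rw [List.take_length, hp]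
  have hle : ∀ i j, i ≤ j → j ≤ l.length →
      wordLength S ((x * (l.take i).prod)⁻¹ * (x * (l.take j).prod)) ≤ j - i := by
    intro i j hij hj
    have e : (x * (l.take i).prod)⁻¹ * (x * (l.take j).prod) = ((l.take j).drop i).prod := by
      have := List.prod_take_mul_prod_drop (l.take j) i
      rw [List.take_take, min_eq_left hij] at this
      rw [← this]; group
    rw [e]
    refine (wordLength_le_of_list _ fun s hs => hl' s ?_).trans ?_
    · exact List.mem_of_mem_take (List.mem_of_mem_drop hs)
    · simp; omega
  refine ⟨fun i => x * (l.take i).prod, by simp, by simp only [hlast]; group, fun i j hij hj => ?_⟩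
  refine le_antisymm (hle i j hij hj) ?_
  have h1 := hle 0 i (by omega) (by omega)
  have h2 := hle j l.length hj le_rfl
  have h3 := wordLength_mul hS ((x * (l.take 0).prod)⁻¹ * (x * (l.take i).prod))
    ((x * (l.take i).prod)⁻¹ * (x * (l.take j).prod))
  have h4 := wordLength_mul hS ((x * (l.take 0).prod)⁻¹ * (x * (l.take j).prod))
    ((x * (l.take j).prod)⁻¹ * (x * (l.take l.length).prod))
  have e1 : (x * (l.take 0).prod)⁻¹ * (x * (l.take i).prod) *
    ((x * (l.take i).prod)⁻¹ * (x * (l.take j).prod)) =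
      (x * (l.take 0).prod)⁻¹ * (x * (l.take j).prod) := by group
  have e2 : (x * (l.take 0).prod)⁻¹ * (x * (l.take j).prod) *
    ((x * (l.take j).prod)⁻¹ * (x * (l.take l.length).prod)) = x⁻¹ * y := by
    rw [hlast]; simp; group
  rw [e1] at h3
  rw [e2, ← hl] at h4
  dsimp only
  omega

end WordLength

/-- A left-invariant rough-geodesic hyperbolic distance on a group with acylindrical
left translation action. -/
structure AcylHypDist {G : Type*} [Group G] (D : G → G → ℕ) : Prop where
  inv : ∀ g x y, D (g * x) (g * y) = D x y
  self : ∀ x, D x x = 0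
  symm : ∀ x y, D x y = D y x
  tri : ∀ x y z, D x z ≤ D x y + D y z + 1
  four : ∀ x y z w, D x z + D y w ≤ max (D x y + D z w) (D x w + D y z) + 66
  btw : ∀ x y k, k < D x y → ∃ z, D x z ≤ k + 13 ∧ D z y + k ≤ D x y + 13
  acyl : ∀ ε : ℕ, ∃ R N : ℕ, ∀ x y, R ≤ D x y →
    {g : G | D x (g * x) ≤ ε ∧ D y (g * y) ≤ ε}.Finite ∧
    Nat.card {g : G | D x (g * x) ≤ ε ∧ D y (g * y) ≤ ε} ≤ N

namespace AcylHypDist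

variable {G : Type*} [Group G] {D : G → G → ℕ} (h : AcylHypDist D)
include h

theorem exists_short_word (n : ℕ) : ∀ g, D 1 g ≤ n → ∃ l : List G, l.length ≤ n + 1 ∧
    (∀ s ∈ l, D 1 s ≤ 27) ∧ l.prod = g := by
  induction n using Nat.strong_induction_on with
  | _ n ih =>
  intro g hg
  by_cases h27 : D 1 g ≤ 27
  · exact ⟨[g], by simp, by simpa using h27, by simp⟩
  obtain ⟨z, h1, h2⟩ := h.btw 1 g 14 (by omega)
  have h3 : D 1 (z⁻¹ * g) = D z g := by
    rw [← h.inv z 1]; simp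
  obtain ⟨l, hl, hl', hp⟩ := ih (n - 1) (by omega) (z⁻¹ * g) (by omega)
  refine ⟨z :: l, by simp; omega, ?_, by simp [hp]⟩
  simp only [List.mem_cons, forall_eq_or_imp]
  exact ⟨h1, hl'⟩

theorem isGenSet : IsGenSet {s | D 1 s ≤ 27} := by
  rw [IsGenSet, eq_top_iff]
  intro g _
  obtain ⟨l, _, hl, rfl⟩ := h.exists_short_word _ g le_rfl
  exact Subgroup.list_prod_mem _ fun s hs => Subgroup.subset_closure (hl s hs)

theorem wordLength_le (g : G) : wordLength {s | D 1 s ≤ 27} g ≤ D 1 g + 1 := by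
  obtain ⟨l, hl', hl, rfl⟩ := h.exists_short_word _ g le_rfl
  exact (wordLength_le_of_list l fun s hs => Or.inl (hl s hs)).trans hl'

theorem le_wordLength (g : G) : D 1 g ≤ 28 * wordLength {s | D 1 s ≤ 27} g := by
  obtain ⟨l, hl, hl', rfl⟩ := exists_word h.isGenSet g
  rw [← hl]
  clear hl
  induction l with
  | nil => simp [h.self]
  | cons a l ih =>
    have h1 := ih fun s hs => hl' s (by simp [hs])
    have h2 : D 1 a ≤ 27 := by
      rcases hl' a (by simp) with h3 | h3
      · exact h3
      · have h4 := h.inv a⁻¹ 1 a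
        rw [mul_one, inv_mul_cancel, h.symm] at h4
        rw [← h4]; exact h3
    have h3 := h.tri 1 a (a * l.prod)
    have h4 := h.inv a 1 l.prod
    rw [mul_one] at h4
    simp only [List.prod_cons, List.length_cons, mul_add, mul_one]
    omega

theorem wordDist_le (x y : G) : wordLength {s | D 1 s ≤ 27} (x⁻¹ * y) ≤ D x y + 1 := by
  have := h.inv x⁻¹ x y
  rw [inv_mul_cancel] at this
  rw [← this]
  exact h.wordLength_le _

theorem le_wordDist (x y : G) : D x y ≤ 28 * wordLength {s | D 1 s ≤ 27} (x⁻¹ * y) := by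
  have := h.inv x⁻¹ x y
  rw [inv_mul_cancel] at this
  rw [← this]
  exact h.le_wordLength _

theorem roughHyp : RoughHyp (fun x y => (D x y + 1 : ℝ))
    (fun x y => wordLength {s | D 1 s ≤ 27} (x⁻¹ * y)) 40 where
  one_le := by norm_num
  nonneg x y := by positivity
  self_le x := by rw [h.self]; norm_num
  symm x y := by rw [h.symm]
  tri x y z := by have := h.tri x y z; norm_cast; omega
  hyp w x y z := by
    have := h.four w x z y
    have e1 := h.symm z y
    have e2 := h.symm x z
    simp only [gromovProd]
    rcases max_choice (D w x + D z y) (D w y + D x z) with h1 | h1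
    · rw [h1] at this
      refine le_trans (sub_le_sub_right (min_le_right _ _) _) ?_
      have : (D w z + D x y : ℝ) ≤ D w x + D z y + 66 := by exact_mod_cast this
      linarith
    · rw [h1] at this
      refine le_trans (sub_le_sub_right (min_le_left _ _) _) ?_
      have : (D w z + D x y : ℝ) ≤ D w y + D x z + 66 := by exact_mod_cast this
      linarith
  btw x y k hk := by
    rcases Nat.lt_or_ge k (D x y) with h1 | h1
    · obtain ⟨z, h2, h3⟩ := h.btw x y k h1
      have h2 : (D x z : ℝ) ≤ k + 13 := by exact_mod_cast h2
      have h3 : (D z y + k : ℝ) ≤ D x y + 13 := by exact_mod_cast h3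
      exact ⟨z, by linarith, by linarith⟩
    · refine ⟨y, ?_, ?_⟩
      · have h1 : (D x y : ℝ) ≤ k := by exact_mod_cast h1
        linarith
      · rw [h.self]; push_cast; linarith
  w_symm x y := by rw [← wordLength_inv h.isGenSet]; simp
  w_tri x y z := by
    have := wordLength_mul h.isGenSet (x⁻¹ * y) (y⁻¹ * z)
    rwa [show x⁻¹ * y * (y⁻¹ * z) = x⁻¹ * z by group] at this
  w_geod x y := exists_word_path h.isGenSet x y
  w_le x y := by
    have : (wordLength {s | D 1 s ≤ 27} (x⁻¹ * y) : ℝ) ≤ D x y + 1 := by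
      exact_mod_cast h.wordDist_le x y
    linarith
  step x y hw := by
    have h1 := h.le_wordDist x y
    have : (D x y : ℝ) ≤ 28 := by exact_mod_cast (by omega : D x y ≤ 28)
    linarith

theorem isAHGenSet : IsAHGenSet {s | D 1 s ≤ 27} := by
  refine ⟨h.isGenSet, h.roughHyp.fourPointHyperbolic, fun ε hε => ?_⟩
  obtain ⟨R, N, hRN⟩ := h.acyl (28 * ⌈ε⌉₊)
  refine ⟨R + 1, N, by positivity, fun x y hxy => ?_⟩
  have h1 := h.wordDist_le x y
  have h2 : R ≤ D x y := by
    have : (R + 1 : ℕ) ≤ wordLength {s | D 1 s ≤ 27} (x⁻¹ * y) := by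
      simp only [wordDist] at hxy; exact_mod_cast hxy
    omega
  obtain ⟨h3, h4⟩ := hRN x y h2
  have hle : ∀ u v : G, wordDist {s | D 1 s ≤ 27} u v ≤ ε → D u v ≤ 28 * ⌈ε⌉₊ := by
    intro u v huv
    have h5 := h.le_wordDist u v
    have h6 : wordLength {s | D 1 s ≤ 27} (u⁻¹ * v) ≤ ⌈ε⌉₊ := by
      have := huv.trans (Nat.le_ceil ε)
      simp only [wordDist] at this; exact_mod_cast this
    omega
  have hsub : {g : G | wordDist {s | D 1 s ≤ 27} x (leftTranslation g x) ≤ ε ∧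
      wordDist {s | D 1 s ≤ 27} y (leftTranslation g y) ≤ ε} ⊆
      {g : G | D x (g * x) ≤ 28 * ⌈ε⌉₊ ∧ D y (g * y) ≤ 28 * ⌈ε⌉₊} :=
    fun g hg => ⟨hle _ _ hg.1, hle _ _ hg.2⟩
  exact ⟨h3.subset hsub, (Nat.card_mono h3 hsub).trans h4⟩

end AcylHypDist

/-- A monotone family of hyperbolic distances distinguishing all sets of naturals gives the
desired order embedding. -/
theorem exists_embedding_of_dist {G : Type uG} [Group G] (D : Set ℕ → G → G → ℕ)
    (hD : ∀ A, AcylHypDist (D A)) (hmono : ∀ A B, A ⊆ B → ∀ x y, D A x y ≤ D B x y)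
    (hsep : ∀ A B, ∀ i ∈ A, i ∉ B → ∀ n, ∃ g, D B 1 g = 0 ∧ n ≤ D A 1 g) :
    Cardinal.continuum ≤ Cardinal.mk (AHStructures G) ∧
    ∃ f : Set ℕ → {S : Set G // IsAHGenSet S},
      ∀ A B : Set ℕ, A ⊆ B ↔ GenSetDominated (f A).1 (f B).1 := by
  set f : Set ℕ → {S : Set G // IsAHGenSet S} := fun A => ⟨{s | D A 1 s ≤ 27}, (hD A).isAHGenSet⟩
    with hf
  have key : ∀ A B : Set ℕ, A ⊆ B ↔ GenSetDominated (f A).1 (f B).1 := by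
    intro A B
    refine ⟨fun hAB => GenSetDominated.of_subset fun s hs => (hmono A B hAB 1 s).trans hs, ?_⟩
    rintro ⟨M, hM⟩ i hi
    by_contra hiB
    obtain ⟨g, hg, hg'⟩ := hsep A B i hi hiB (28 * M + 1)
    have h1 := hM g (by simp [hf, hg])
    have h2 := (hD A).le_wordLength g
    have h3 : 28 * wordLength {s | D A 1 s ≤ 27} g ≤ 28 * M := Nat.mul_le_mul_left _ h1
    omega
  refine ⟨?_, f, key⟩
  have hinj : Function.Injective fun A => (Quot.mk _ (f A) : AHStructures G) := by
    intro A B hAB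
    have hequiv : Equivalence fun S T : {S : Set G // IsAHGenSet S} => GenSetEquiv S.1 T.1 :=
      ⟨fun S => ⟨GenSetDominated.of_subset le_rfl, GenSetDominated.of_subset le_rfl⟩,
        fun h => ⟨h.2, h.1⟩, fun {S T U} h h' =>
          ⟨h.1.trans S.2.1 T.2.1 h'.1, h'.2.trans U.2.1 T.2.1 h.2⟩⟩
    have h1 : GenSetEquiv (f A).1 (f B).1 := by
      have := Quot.eqvGen_exact hAB
      rwa [hequiv.eqvGen_iff] at this
    exact Set.Subset.antisymm ((key A B).2 h1.1) ((key B A).2 h1.2)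
  have := Cardinal.mk_le_of_injective (α := ULift.{uG} (Set ℕ)) (β := AHStructures G)
    (f := fun A => Quot.mk _ (f A.down)) fun A B hAB => ULift.down_injective (hinj hAB)
  simpa using this

/-- The integers `x` and `y` differ by at most `c`. -/
abbrev Near (c x y : ℤ) : Prop := x ≤ y + c ∧ y ≤ x + c

/-- Coarse projections `b (u⁻¹ • ·)` of a `G`-set `X` to the translates of an axis, with elliptic
closure `E` of the axis. -/
structure AxisSys (G X : Type*) [Group G] [MulAction G X] where
  o : X
  E : Subgroup G
  b : X → ℤ
  g : G
  t : G
  c : ℤ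
  one_le : 1 ≤ c
  g_mem : g ∈ E
  t_notMem : t ∉ E
  path : ∀ p q, ∃ (L : ℕ) (f : ℕ → X), f 0 = p ∧ f L = q ∧
    ∀ i < L, ∀ u : G, Near c (b (u • f i)) (b (u • f (i + 1)))
  t_near : ∀ v : G, Near c (b (v • t • o)) (b (v • o))
  proj : ∀ u ∉ E, ∀ e ∈ E, Near c (b (u • e • o)) (b (u • o))
  behrstock : ∀ u ∉ E, ∀ p, Near c (b p) (b (u • o)) ∨ Near c (b (u⁻¹ • p)) (b (u⁻¹ • o))
  elem : ∀ e ∈ E, ∀ p q, |b (e • p) - b (e • q)| ≤ |b p - b q| + c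
  shift : ∀ (k : ℤ) p, Near c (b (g ^ k • p)) (b p + k)
  b_o : Near c (b o) 0
  acyl : ∀ r : ℤ, ∃ (M : ℤ) (N : ℕ), ∀ p q, M ≤ |b q - b p| →
    {e : G | e ∈ E ∧ Near r (b (e • p)) (b p) ∧ Near r (b (e • q)) (b q)}.Finite ∧
    {e : G | e ∈ E ∧ Near r (b (e • p)) (b p) ∧ Near r (b (e • q)) (b q)}.ncard ≤ N

/-- An axis system whose projections are constant away from the other axis. -/
structure ExactAxisSys (G X : Type*) [Group G] [MulAction G X] extends AxisSys G X where
  exact : ∀ v ∉ E, ∀ p q, ¬ Near c (b (v⁻¹ • p)) (b (v⁻¹ • o)) →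
    ¬ Near c (b (v⁻¹ • q)) (b (v⁻¹ • o)) → b p = b q

namespace AxisSys

variable {G X : Type*} [Group G] [MulAction G X] (S : AxisSys G X)

/-- The signed coordinate on the axis of `v`. -/
def co (s : Bool) (v : G) (p : X) : ℤ := if s then - S.b (v⁻¹ • p) else S.b (v⁻¹ • p)

variable {S}

theorem co_near {r : ℤ} {s : Bool} {v : G} {p q : X} :
    Near r (S.co s v p) (S.co s v q) ↔ Near r (S.b (v⁻¹ • p)) (S.b (v⁻¹ • q)) := by
  unfold co; cases s <;> simp [Near]; omega

theorem co_near' {r : ℤ} {s : Bool} (s' : Bool) {v : G} {p q : X} :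
    Near r (S.co s v p) (S.co s v q) ↔ Near r (S.co s' v p) (S.co s' v q) := by
  rw [co_near, co_near]

theorem co_near_zero {r : ℤ} {s : Bool} {v : G} {p : X} :
    Near r (S.co s v p) 0 ↔ Near r (S.b (v⁻¹ • p)) 0 := by
  unfold co; cases s <;> simp [Near]; omega

theorem co_smul (s : Bool) (h v : G) (p : X) : S.co s (h * v) (h • p) = S.co s v p := by
  unfold co; simp [mul_smul]

variable (S) in
/-- Two elements define the same axis. -/
def Rel (v w : G) : Prop := v⁻¹ * w ∈ S.E

theorem Rel.symm {v w : G} (h : S.Rel v w) : S.Rel w v := by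
  have := S.E.inv_mem h; simpa [Rel] using this

theorem Rel.trans {u v w : G} (h : S.Rel u v) (h' : S.Rel v w) : S.Rel u w := by
  have := S.E.mul_mem h h'
  rwa [show u⁻¹ * v * (v⁻¹ * w) = u⁻¹ * w by group] at this

theorem Rel.refl (v : G) : S.Rel v v := by simp [Rel, S.E.one_mem]

theorem co_behrstock {v w : G} (h : ¬ S.Rel v w) (s s' : Bool) (p : X) :
    Near S.c (S.co s v p) (S.co s v (w • S.o)) ∨
      Near S.c (S.co s' w p) (S.co s' w (v • S.o)) := by
  rw [co_near, co_near]
  have := S.behrstock _ h (v⁻¹ • p)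
  simpa [mul_smul] using this

theorem co_proj {v w w' : G} (h : ¬ S.Rel v w) (hw : S.Rel w w') (s : Bool) :
    Near S.c (S.co s v (w' • S.o)) (S.co s v (w • S.o)) := by
  rw [co_near]
  have := S.proj _ h _ hw
  simpa [← mul_smul, mul_assoc] using this

theorem co_t (v w : G) (s : Bool) : Near S.c (S.co s v ((w * S.t) • S.o)) (S.co s v (w • S.o)) := by
  rw [co_near]
  have := S.t_near (v⁻¹ * w)
  simpa [← mul_smul, mul_assoc] using this

theorem co_elem {v w : G} (h : S.Rel v w) (s s' : Bool) (p q : X) :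
    |S.co s v p - S.co s v q| ≤ |S.co s' w p - S.co s' w q| + S.c := by
  have := S.elem _ h (w⁻¹ • p) (w⁻¹ • q)
  have e : ∀ (s : Bool) (v : G), |S.co s v p - S.co s v q| = |S.b (v⁻¹ • p) - S.b (v⁻¹ • q)| := by
    intro s v; unfold co; cases s
    · rfl
    · rw [← abs_neg]; simp only [if_true]; congr 1; ring
  rw [e, e]
  simpa [← mul_smul, mul_assoc] using this

theorem co_elem_near {v w : G} (h : S.Rel v w) {s s' : Bool} {p q : X} {r : ℤ}
    (hr : Near r (S.co s' w p) (S.co s' w q)) : Near (r + S.c) (S.co s v p) (S.co s v q) := by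
  have h1 := S.co_elem h s s' p q
  have h2 : |S.co s' w p - S.co s' w q| ≤ r := by rw [abs_le]; omega
  have h3 := abs_le.1 (h1.trans (add_le_add_left h2 S.c))
  omega

/-- Coordinates near the middle axis `u * t` for the element `u * t * g ^ m * t`. -/
theorem co_mid_start (u : G) : Near (2 * S.c) (S.co false (u * S.t) (u • S.o)) 0 := by
  have h1 := S.co_t (u * S.t) u false
  have h2 := S.b_o
  have h3 : S.co false (u * S.t) ((u * S.t) • S.o) = S.b S.o := by
    change S.b ((u * S.t)⁻¹ • (u * S.t) • S.o) = _
    rw [inv_smul_smul]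
  omega

theorem co_self (s : Bool) (u : G) : Near S.c (S.co s u (u • S.o)) 0 := by
  rw [co_near_zero]; simpa using S.b_o

theorem co_shift (u : G) (m : ℤ) (p : X) :
    Near S.c (S.co false (u * S.g ^ m) p) (S.co false u p - m) := by
  have h := S.shift (-m) (u⁻¹ • p)
  have e : S.co false (u * S.g ^ m) p = S.b (S.g ^ (-m) • u⁻¹ • p) := by
    simp [co, mul_smul]
  have e' : S.co false u p = S.b (u⁻¹ • p) := rfl
  rw [e, e']
  omega

theorem rel_g (u : G) (m : ℤ) : S.Rel u (u * S.g ^ m) := by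
  simpa [Rel] using S.E.zpow_mem S.g_mem m

theorem not_rel_t (u : G) : ¬ S.Rel u (u * S.t) := by
  simpa [Rel] using S.t_notMem

/-- The end element of the block of `u` with twist `m`. -/
theorem co_mid_end (u : G) (m : ℤ) :
    Near (3 * S.c) (S.co false (u * S.t) ((u * S.t * S.g ^ m * S.t) • S.o)) m := by
  have h1 := S.co_t (u * S.t) (u * S.t * S.g ^ m) false
  have h2 := S.co_shift (u * S.t) m ((u * S.t * S.g ^ m) • S.o)
  have h3 := S.co_self false (u * S.t * S.g ^ m)
  omega

/-- The beginning element is seen from the end element at the origin. -/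
theorem co_end_mid (s : Bool) (u : G) (m : ℤ) :
    Near (3 * S.c) (S.co s (u * S.t * S.g ^ m * S.t) ((u * S.t) • S.o)) 0 := by
  have h1 := S.co_t (u * S.t * S.g ^ m * S.t) (u * S.t * S.g ^ m) s
  have h2 := S.co_self s (u * S.t * S.g ^ m * S.t)
  have h3 := S.co_proj (fun h => S.not_rel_t (u * S.t * S.g ^ m) h.symm) (S.rel_g (u * S.t) m).symm s
  omega

theorem co_start_mid (s : Bool) (u : G) :
    Near (2 * S.c) (S.co s u ((u * S.t) • S.o)) 0 := by
  have h1 := S.co_t u u s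
  have h2 := S.co_self s u
  omega

end AxisSys

/-- An exact axis system together with scales for blocks. -/
structure BlockAxisSys (G X : Type*) [Group G] [MulAction G X] extends ExactAxisSys G X where
  K : ℤ
  m : ℕ → ℤ
  N₀ : ℕ
  hK : 100 * c ≤ K
  hm : ∀ i, 2 * K + 100 * c ≤ m i
  m_sep : ∀ i j, i ≠ j → 100 * c ≤ |m i - m j|
  acylK : ∀ p q, K - 40 * c ≤ |b q - b p| →
    {e : G | e ∈ E ∧ Near (40 * c) (b (e • p)) (b p) ∧ Near (40 * c) (b (e • q)) (b q)}.Finite ∧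
    {e : G | e ∈ E ∧ Near (40 * c) (b (e • p)) (b p) ∧
      Near (40 * c) (b (e • q)) (b q)}.ncard ≤ N₀

theorem ExactAxisSys.exists_blockAxisSys {G X : Type*} [Group G] [MulAction G X]
    (S : ExactAxisSys G X) : ∃ T : BlockAxisSys G X, T.toExactAxisSys = S := by
  obtain ⟨M, N, h⟩ := S.acyl (40 * S.c)
  have hc := S.one_le
  set K := 100 * S.c + |M| with hKd
  have hM0 := abs_nonneg M
  refine ⟨⟨S, K, fun i => (i + 1) * (2 * K + 100 * S.c), N, by omega, fun i => ?_,
    fun i j hij => ?_, fun p q hpq => h p q ?_⟩, rfl⟩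
  · have : (0 : ℤ) ≤ i := by positivity
    nlinarith
  · rw [show ((i : ℤ) + 1) * (2 * K + 100 * S.c) - (j + 1) * (2 * K + 100 * S.c) =
      (i - j) * (2 * K + 100 * S.c) by ring, abs_mul]
    have h1 : (1 : ℤ) ≤ |(i : ℤ) - j| := Int.one_le_abs (by omega)
    have h2 : 100 * S.c ≤ |2 * K + 100 * S.c| := le_trans (by omega) (le_abs_self _)
    nlinarith [abs_nonneg (2 * K + 100 * S.c)]
  · have := le_abs_self M
    omega

namespace BlockAxisSys

variable {G X : Type*} [Group G] [MulAction G X]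

/-- Blocks: a group element, an index and an orientation. -/
abbrev Blk (G : Type*) := G × ℕ × Bool

/-- The block with the opposite orientation. -/
def rev {G : Type*} (B : Blk G) : Blk G := (B.1, B.2.1, !B.2.2)

@[simp] theorem rev_rev {G : Type*} {B : Blk G} : rev (rev B) = B := by simp [rev]

@[simp] theorem idx_rev {G : Type*} {B : Blk G} : (rev B).2.1 = B.2.1 := rfl

variable (S : BlockAxisSys G X)

/-- The far end of a block with the standard orientation. -/
def far (B : Blk G) : G := B.1 * S.t * S.g ^ S.m B.2.1 * S.t

/-- The beginning axis. -/
def aEnd (B : Blk G) : G := if B.2.2 then S.far B else B.1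

/-- The final axis. -/
def zEnd (B : Blk G) : G := if B.2.2 then B.1 else S.far B

/-- The middle axis. -/
def mid (B : Blk G) : G := B.1 * S.t

/-- The coordinate on the beginning axis. -/
def al (B : Blk G) (p : X) : ℤ := S.co B.2.2 (S.aEnd B) p

/-- The coordinate on the final axis. -/
def om (B : Blk G) (p : X) : ℤ := S.co (!B.2.2) (S.zEnd B) p

/-- The coordinate on the middle axis. -/
def be (B : Blk G) (p : X) : ℤ :=
  if B.2.2 then S.m B.2.1 - S.co false (S.mid B) p else S.co false (S.mid B) p

variable {S} {B C D : Blk G} {p q : X}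

@[simp] theorem aEnd_rev : S.aEnd (rev B) = S.zEnd B := by
  rcases B with ⟨u, i, _ | _⟩ <;> rfl

@[simp] theorem zEnd_rev : S.zEnd (rev B) = S.aEnd B := by
  rcases B with ⟨u, i, _ | _⟩ <;> rfl

@[simp] theorem mid_rev : S.mid (rev B) = S.mid B := rfl

@[simp] theorem al_rev : S.al (rev B) p = S.om B p := by
  rcases B with ⟨u, i, _ | _⟩ <;> rfl

@[simp] theorem om_rev : S.om (rev B) p = S.al B p := by
  rcases B with ⟨u, i, _ | _⟩ <;> rfl

theorem be_rev : S.be (rev B) p = S.m B.2.1 - S.be B p := by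
  rcases B with ⟨u, i, _ | _⟩ <;> simp [be, rev, mid]

theorem be_near {r : ℤ} (s : Bool) : Near r (S.be B p) (S.be B q) ↔
    Near r (S.co s (S.mid B) p) (S.co s (S.mid B) q) := by
  rw [AxisSys.co_near' false]
  unfold be; split_ifs
  · simp only [Near]; omega
  · rfl

theorem co_near_al {r : ℤ} (s : Bool) : Near r (S.al B p) (S.al B q) ↔
    Near r (S.co s (S.aEnd B) p) (S.co s (S.aEnd B) q) := by
  rw [al, al, AxisSys.co_near' s]

theorem not_rel_aEnd_mid : ¬ S.Rel (S.aEnd B) (S.mid B) := by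
  rcases B with ⟨u, i, _ | _⟩
  · exact S.not_rel_t u
  · intro h
    exact S.not_rel_t (u * S.t * S.g ^ S.m i) ((S.rel_g (u * S.t) (S.m i)).symm.trans h.symm)

theorem be_aEnd : Near (3 * S.c) (S.be B (S.aEnd B • S.o)) 0 := by
  have hc := S.one_le
  rcases B with ⟨u, i, _ | _⟩
  · have := S.co_mid_start u
    simp only [be, aEnd, mid] at *
    simp only [Bool.false_eq_true, if_false]
    omega
  · have := S.co_mid_end u (S.m i)
    simp only [be, aEnd, mid, far] at *
    simp only [if_true]
    omega

theorem be_zEnd : Near (3 * S.c) (S.be B (S.zEnd B • S.o)) (S.m B.2.1) := by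
  have := be_aEnd (S := S) (B := rev B)
  rw [be_rev, aEnd_rev] at this
  omega

theorem al_mid : Near (3 * S.c) (S.al B (S.mid B • S.o)) 0 := by
  have hc := S.one_le
  rcases B with ⟨u, i, _ | _⟩
  · have := S.co_start_mid false u
    simp only [al, aEnd, mid, Bool.false_eq_true, if_false]
    omega
  · exact S.co_end_mid true u (S.m i)

theorem al_aEnd : Near S.c (S.al B (S.aEnd B • S.o)) 0 := S.co_self _ _

/-- Far along the beginning axis the middle coordinate vanishes. -/
theorem be_of_al (h : ¬ Near (4 * S.c) (S.al B p) 0) : Near (4 * S.c) (S.be B p) 0 := by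
  have h1 := S.co_behrstock (not_rel_aEnd_mid (S := S) (B := B)) false false p
  rw [← co_near_al, ← be_near] at h1
  have h2 := al_mid (S := S) (B := B)
  have h3 := be_aEnd (S := S) (B := B)
  omega

theorem be_of_om (h : ¬ Near (4 * S.c) (S.om B p) 0) : Near (4 * S.c) (S.be B p) (S.m B.2.1) := by
  have := be_of_al (S := S) (B := rev B) (p := p) (by simpa using h)
  rw [be_rev] at this
  omega

theorem om_of_al (h : ¬ Near (4 * S.c) (S.al B p) 0) : Near (4 * S.c) (S.om B p) 0 := by
  by_contra h'
  have h1 := be_of_al h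
  have h2 := be_of_om h'
  have h3 := S.hm B.2.1
  have h4 := S.hK
  have h5 := S.one_le
  omega

theorem al_zEnd : Near (4 * S.c) (S.al B (S.zEnd B • S.o)) 0 := by
  by_contra h
  have h1 := be_of_al h
  have h2 := be_zEnd (S := S) (B := B)
  have h3 := S.hm B.2.1
  have h4 := S.hK
  have h5 := S.one_le
  omega

theorem om_aEnd : Near (4 * S.c) (S.om B (S.aEnd B • S.o)) 0 := by
  have := al_zEnd (S := S) (B := rev B)
  simpa using this

theorem fst_eq : B.1 = S.aEnd B ∨ B.1 = S.zEnd B := by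
  rcases B with ⟨u, i, _ | _⟩
  · exact Or.inl rfl
  · exact Or.inr rfl

theorem al_base : Near (4 * S.c) (S.al B (B.1 • S.o)) 0 := by
  have hc := S.one_le
  rcases fst_eq (S := S) (B := B) with h | h <;> rw [h]
  · have := al_aEnd (S := S) (B := B); omega
  · exact al_zEnd

theorem om_base : Near (4 * S.c) (S.om B (B.1 • S.o)) 0 := by
  have := al_base (S := S) (B := rev B)
  rwa [al_rev] at this

variable (S) in
/-- The beginning side of a block. -/
def PS (B : Blk G) : Set X := {p | S.al B p < - S.K}

variable (S) in
/-- The final side of a block. -/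
def QS (B : Blk G) : Set X := {p | S.om B p < - S.K}

theorem mem_PS : p ∈ S.PS B ↔ S.al B p < - S.K := Iff.rfl

theorem mem_QS : p ∈ S.QS B ↔ S.om B p < - S.K := Iff.rfl

@[simp] theorem PS_rev : S.PS (rev B) = S.QS B := by ext p; simp [mem_PS, mem_QS]

@[simp] theorem QS_rev : S.QS (rev B) = S.PS B := by ext p; simp [mem_PS, mem_QS]

theorem om_of_PS (h : p ∈ S.PS B) : Near (4 * S.c) (S.om B p) 0 := by
  have h4 := S.hK
  have h5 := S.one_le
  rw [mem_PS] at h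
  exact om_of_al (by omega)

theorem al_of_QS (h : p ∈ S.QS B) : Near (4 * S.c) (S.al B p) 0 := by
  rw [← om_rev]; exact om_of_PS (by simpa using h)

theorem not_QS_of_om {r : ℤ} (h : Near r (S.om B p) 0) (hr : r ≤ S.K) : p ∉ S.QS B := by
  rw [mem_QS]; omega

theorem not_PS_of_al {r : ℤ} (h : Near r (S.al B p) 0) (hr : r ≤ S.K) : p ∉ S.PS B := by
  rw [mem_PS]; omega

theorem c_le_K : 100 * S.c ≤ S.K ∧ 0 < S.c := ⟨S.hK, by linarith [S.one_le]⟩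

theorem disj_PS (h : p ∈ S.PS B) : p ∉ S.QS B :=
  not_QS_of_om (om_of_PS h) (by linarith [S.hK, S.one_le])

variable (S) in
/-- The order on blocks. -/
def Lt (B C : Blk G) : Prop := ∀ p, p ∈ S.QS B ∨ p ∈ S.PS C

theorem Lt.rev (h : S.Lt B C) : S.Lt (rev C) (rev B) := fun p => by simpa using (h p).symm

theorem Lt.not_rel_aEnd (h : S.Lt B C) (hp : p ∈ S.QS C) : ¬ S.Rel (S.aEnd B) (S.aEnd C) := by
  intro hr
  have hK := c_le_K (S := S)
  have h1 : S.aEnd B • S.o ∈ S.PS C := (h _).resolve_left (not_QS_of_om om_aEnd (by linarith))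
  have h2 : p ∈ S.QS B := (h _).resolve_right (fun h => disj_PS h hp)
  have h3 := al_of_QS h2
  have h4 := al_of_QS hp
  have h5 := al_aEnd (S := S) (B := B)
  have h6 : Near (5 * S.c) (S.al B p) (S.al B (S.aEnd B • S.o)) := by omega
  have h7 := S.co_elem_near hr.symm (s := C.2.2) h6
  rw [mem_PS] at h1
  unfold al at h4 h1
  omega

theorem Lt.not_rel_zEnd (h : S.Lt B C) (hp : p ∈ S.PS B) : ¬ S.Rel (S.zEnd B) (S.zEnd C) := by
  have := h.rev.not_rel_aEnd (p := p) (by simpa using hp)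
  simp only [aEnd_rev] at this
  exact fun h => this h.symm

theorem no_grid_aux {F C₀ C₁ C₂ : Blk G} (h01 : S.Lt C₀ C₁) (h12 : S.Lt C₁ C₂)
    (hp : S.aEnd C₁ • S.o ∈ S.QS F) (hF : ¬ S.Rel (S.zEnd F) (S.aEnd C₁)) :
    (∀ q, Near (4 * S.c) (S.om F q) 0 → q ∈ S.QS C₀) ∨
      (∀ q, Near (4 * S.c) (S.om F q) 0 → q ∈ S.PS C₂) := by
  have hK := c_le_K (S := S)
  rw [mem_QS] at hp
  have key : ∀ q, Near (4 * S.c) (S.om F q) 0 →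
      Near S.c (S.al C₁ q) (S.al C₁ (S.zEnd F • S.o)) := fun q hq => by
    have h := S.co_behrstock hF (!F.2.2) C₁.2.2 q
    refine h.resolve_left fun h => ?_
    change Near S.c (S.om F q) (S.om F _) at h
    omega
  by_cases hV : S.al C₁ (S.zEnd F • S.o) < - 50 * S.c
  · refine Or.inr fun q hq => (h12 q).resolve_left ?_
    have := key q hq
    exact not_QS_of_om (om_of_al (by omega)) (by omega)
  · refine Or.inl fun q hq => (h01 q).resolve_right ?_
    have := key q hq
    rw [mem_PS]; omega

theorem base_sep_aux {x y : X} (hx : x ∈ S.PS B) (hy : y ∈ S.QS B) (hCD : S.Lt C D)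
    (hxC : x ∈ S.PS C) (hyC : y ∈ S.PS C) (hC : B.1 • S.o ∈ S.QS C)
    (hxD : x ∈ S.PS D) (hyD : y ∈ S.PS D) (hD : B.1 • S.o ∈ S.QS D) : False := by
  have hK := c_le_K (S := S)
  obtain ⟨W, hr, h1, h2, h3⟩ : ∃ W : Blk G, ¬ S.Rel B.1 (S.zEnd W) ∧
      x ∈ S.PS W ∧ y ∈ S.PS W ∧ B.1 • S.o ∈ S.QS W := by
    by_cases hr : S.Rel B.1 (S.zEnd C)
    · exact ⟨D, fun hr' => hCD.not_rel_zEnd hxC (hr.symm.trans hr'), hxD, hyD, hD⟩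
    · exact ⟨C, hr, hxC, hyC, hC⟩
  have key : ∀ p ∈ S.PS W, ∀ s, Near S.c (S.co s B.1 p) (S.co s B.1 (S.zEnd W • S.o)) :=
    fun p hp s => by
    refine (S.co_behrstock hr s (!W.2.2) p).resolve_right fun h => ?_
    change Near S.c (S.om W p) (S.om W _) at h
    have := om_of_PS hp
    rw [mem_QS] at h3
    omega
  rcases fst_eq (S := S) (B := B) with h | h
  · have k1 := key x h1 B.2.2
    have k2 := key y h2 B.2.2
    rw [h] at k1 k2
    have := al_of_QS hy
    rw [mem_PS] at hx
    unfold al at *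
    omega
  · have k1 := key x h1 (!B.2.2)
    have k2 := key y h2 (!B.2.2)
    rw [h] at k1 k2
    have := om_of_PS hx
    rw [mem_QS] at hy
    unfold om at *
    omega

theorem exists_exit {L : ℕ} {f : ℕ → X} (hx : f 0 ∈ S.PS B) (hy : f L ∈ S.QS B)
    (hf : ∀ i < L, ∀ u : G, Near S.c (S.b (u • f i)) (S.b (u • f (i + 1)))) :
    ∃ t ≤ L, f t ∉ S.PS B ∧ f t ∉ S.QS B := by
  classical
  have hK := c_le_K (S := S)
  have hex : ∃ t, f t ∉ S.PS B := ⟨L, fun h => disj_PS h hy⟩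
  have hL : Nat.find hex ≤ L := Nat.find_le fun h => disj_PS h hy
  refine ⟨Nat.find hex, hL, Nat.find_spec hex, ?_⟩
  obtain ⟨t, ht⟩ : ∃ t, Nat.find hex = t + 1 :=
    Nat.exists_eq_succ_of_ne_zero fun h => Nat.find_spec hex (h ▸ hx)
  have h1 : f t ∈ S.PS B := by
    have := Nat.find_min hex (m := t) (by omega)
    simpa using this
  have h2 : Near S.c (S.al B (f t)) (S.al B (f (t + 1))) :=
    (S.co_near (s := B.2.2)).2 (hf t (by omega) _)
  rw [ht]
  have h3 : f (t + 1) ∉ S.PS B := ht ▸ Nat.find_spec hex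
  rw [mem_PS] at h1 h3
  exact not_QS_of_om (om_of_al (by omega)) (by omega)

end BlockAxisSys

namespace BlockAxisSys

variable {G X : Type*} [Group G] [MulAction G X] {S : BlockAxisSys G X}

/-- Among four consecutive blocks of a chain one is in general position to a given axis. -/
theorem exists_general {D : ℕ → Blk G} (hD : ∀ i j, i < j → j < 6 → S.Lt (D i) (D j))
    {x y : X} (hx : ∀ i < 6, x ∈ S.PS (D i)) (hy : ∀ i < 6, y ∈ S.QS (D i)) (W : G) (p : X) :
    ∃ i, 1 ≤ i ∧ i ≤ 4 ∧ (p ∈ S.PS (D i) ∨ p ∈ S.QS (D i)) ∧ ¬ S.Rel (S.aEnd (D i)) W ∧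
      ¬ S.Rel (S.zEnd (D i)) W := by
  have ha : ∀ i j, i < j → j < 6 → S.Rel (S.aEnd (D i)) W → ¬ S.Rel (S.aEnd (D j)) W :=
    fun i j hij hj h h' => (hD i j hij hj).not_rel_aEnd (hy j hj) (h.trans h'.symm)
  have hz : ∀ i j, i < j → j < 6 → S.Rel (S.zEnd (D i)) W → ¬ S.Rel (S.zEnd (D j)) W :=
    fun i j hij hj h h' => (hD i j hij hj).not_rel_zEnd (hx i (by omega)) (h.trans h'.symm)
  have hp : ∀ i j, i < j → j < 6 → ¬ (p ∈ S.PS (D i) ∨ p ∈ S.QS (D i)) →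
      (p ∈ S.PS (D j) ∨ p ∈ S.QS (D j)) :=
    fun i j hij hj h => Or.inl ((hD i j hij hj p).resolve_left fun hq => h (Or.inr hq))
  by_contra! hcon
  have hc : ∀ i, 1 ≤ i → i ≤ 4 → ¬ (p ∈ S.PS (D i) ∨ p ∈ S.QS (D i)) ∨ S.Rel (S.aEnd (D i)) W ∨
      S.Rel (S.zEnd (D i)) W := by
    intro i h1 h4
    have := hcon i h1 h4
    tauto
  have c1 := hc 1 (by omega) (by omega)
  have c2 := hc 2 (by omega) (by omega)
  have c3 := hc 3 (by omega) (by omega)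
  have c4 := hc 4 (by omega) (by omega)
  have a12 := ha 1 2 (by omega) (by omega)
  have a13 := ha 1 3 (by omega) (by omega)
  have a14 := ha 1 4 (by omega) (by omega)
  have a23 := ha 2 3 (by omega) (by omega)
  have a24 := ha 2 4 (by omega) (by omega)
  have a34 := ha 3 4 (by omega) (by omega)
  have z12 := hz 1 2 (by omega) (by omega)
  have z13 := hz 1 3 (by omega) (by omega)
  have z14 := hz 1 4 (by omega) (by omega)
  have z23 := hz 2 3 (by omega) (by omega)
  have z24 := hz 2 4 (by omega) (by omega)
  have z34 := hz 3 4 (by omega) (by omega)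
  have p12 := hp 1 2 (by omega) (by omega)
  have p13 := hp 1 3 (by omega) (by omega)
  have p14 := hp 1 4 (by omega) (by omega)
  have p23 := hp 2 3 (by omega) (by omega)
  have p24 := hp 2 4 (by omega) (by omega)
  have p34 := hp 3 4 (by omega) (by omega)
  clear hcon hc ha hz hp
  generalize S.Rel (S.aEnd (D 1)) W = r1 at *
  generalize S.Rel (S.aEnd (D 2)) W = r2 at *
  generalize S.Rel (S.aEnd (D 3)) W = r3 at *
  generalize S.Rel (S.aEnd (D 4)) W = r4 at *
  generalize S.Rel (S.zEnd (D 1)) W = s1 at *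
  generalize S.Rel (S.zEnd (D 2)) W = s2 at *
  generalize S.Rel (S.zEnd (D 3)) W = s3 at *
  generalize S.Rel (S.zEnd (D 4)) W = s4 at *
  generalize (p ∈ S.PS (D 1) ∨ p ∈ S.QS (D 1)) = t1 at *
  generalize (p ∈ S.PS (D 2) ∨ p ∈ S.QS (D 2)) = t2 at *
  generalize (p ∈ S.PS (D 3) ∨ p ∈ S.QS (D 3)) = t3 at *
  generalize (p ∈ S.PS (D 4) ∨ p ∈ S.QS (D 4)) = t4 at *
  grind

variable (S) in
/-- The system of blocks associated with an exact axis system. -/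
def toBlockSys : BlockSys X (Blk G) where
  P := S.PS
  Q := S.QS
  flip := rev
  idx B := B.2.1
  base B := B.1 • S.o
  P_flip _ := PS_rev
  Q_flip _ := QS_rev
  idx_flip _ := rfl
  disj _ _ h := disj_PS h
  base_P _ := not_PS_of_al al_base (by linarith [c_le_K (S := S)])
  base_Q _ := not_QS_of_om om_base (by linarith [c_le_K (S := S)])
  base_sep b x y hx hy c d hcd h1 h2 h3 h4 h5 h6 := base_sep_aux hx hy hcd h1 h2 h3 h4 h5 h6
  bdd x y := by
    obtain ⟨L, f, rfl, rfl, hf⟩ := S.path x y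
    refine ⟨L + 1, fun n D hD hxy => ?_⟩
    choose! t ht h1 h2 using fun i (hi : i < n) =>
      S.exists_exit (hxy i hi).1 (hxy i hi).2 hf
    have hlt : ∀ i j, i < j → j < n → t i ≠ t j := fun i j hij hj h => by
      have := hD i j hij hj (f (t i))
      rcases this with h' | h'
      · exact h2 i (by omega) h'
      · exact h1 j hj (h ▸ h')
    have : Finset.card (Finset.range n) ≤ Finset.card (Finset.range (L + 1)) := by
      refine Finset.card_le_card_of_injOn t (fun i hi => ?_) fun i hi j hj h => ?_
      · have := ht i (by simpa using hi)
        simp; omega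
      · by_contra hij
        rcases Nat.lt_or_gt_of_ne hij with h' | h'
        · exact hlt i j h' (by simpa using hj) h
        · exact hlt j i h' (by simpa using hi) h.symm
    simpa using this
  no_grid D C hD hC hxy hxy' := by
    obtain ⟨x, y, hxy⟩ := hxy
    obtain ⟨i, hi1, hi4, hp, ha, hz⟩ := exists_general hD (fun i hi => (hxy i hi).1)
      (fun i hi => (hxy i hi).2) (S.aEnd (C 1)) (S.aEnd (C 1) • S.o)
    have h01 : S.Lt (C 0) (C 1) := hC 0 1 (by omega) (by omega)
    have h12 : S.Lt (C 1) (C 2) := hC 1 2 (by omega) (by omega)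
    rcases hp with hp | hp
    · have hq : ∀ q, q ∈ S.PS (D (i + 1)) ∨ Near (4 * S.c) (S.al (D i) q) 0 := fun q =>
        (hD i (i + 1) (by omega) (by omega) q).symm.imp_right al_of_QS
      refine ⟨i + 1, by omega, ?_⟩
      rcases no_grid_aux (F := rev (D i)) h01 h12 (by simpa using hp) (by simpa using ha)
        with h | h <;> simp only [om_rev] at h
      · exact ⟨0, by omega, Or.inr (Or.inr (Or.inr fun q => (hq q).symm.imp_left (h q)))⟩
      · exact ⟨2, by omega, Or.inr (Or.inr (Or.inl fun q => (hq q).imp_right (h q)))⟩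
    · have hq : ∀ q, q ∈ S.QS (D (i - 1)) ∨ Near (4 * S.c) (S.om (D i) q) 0 := fun q =>
        (hD (i - 1) i (by omega) (by omega) q).imp_right om_of_PS
      refine ⟨i - 1, by omega, ?_⟩
      rcases no_grid_aux h01 h12 hp hz with h | h
      · exact ⟨0, by omega, Or.inr (Or.inl fun q => (hq q).imp_right (h q))⟩
      · exact ⟨2, by omega, Or.inl fun q => (hq q).imp_right (h q)⟩

@[simp] theorem toBlockSys_P : S.toBlockSys.P = S.PS := rfl

@[simp] theorem toBlockSys_Q : S.toBlockSys.Q = S.QS := rfl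

@[simp] theorem toBlockSys_idx (B : Blk G) : S.toBlockSys.idx B = B.2.1 := rfl

@[simp] theorem toBlockSys_lt : S.toBlockSys.lt = S.Lt := rfl

end BlockAxisSys

namespace BlockAxisSys

variable {G X : Type*} [Group G] [MulAction G X] {S : BlockAxisSys G X}

/-- Translation of blocks. -/
def tr (h : G) (B : Blk G) : Blk G := (h * B.1, B.2)

variable {B C C' : Blk G} {h : G} {p q x y : X}

theorem aEnd_tr : S.aEnd (tr h B) = h * S.aEnd B := by
  rcases B with ⟨u, i, _ | _⟩ <;> simp [tr, aEnd, far, mul_assoc]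

theorem zEnd_tr : S.zEnd (tr h B) = h * S.zEnd B := by
  rcases B with ⟨u, i, _ | _⟩ <;> simp [tr, zEnd, far, mul_assoc]

theorem mid_tr : S.mid (tr h B) = h * S.mid B := by simp [tr, mid, mul_assoc]

theorem al_tr : S.al (tr h B) (h • p) = S.al B p := by
  unfold al; rw [aEnd_tr]; exact S.co_smul _ _ _ _

theorem om_tr : S.om (tr h B) (h • p) = S.om B p := by
  unfold om; rw [zEnd_tr]; exact S.co_smul _ _ _ _

theorem mem_PS_tr : p ∈ S.PS (tr h B) ↔ h⁻¹ • p ∈ S.PS B := by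
  rw [mem_PS, mem_PS, ← al_tr (h := h) (B := B) (p := h⁻¹ • p), smul_inv_smul]

theorem mem_QS_tr : p ∈ S.QS (tr h B) ↔ h⁻¹ • p ∈ S.QS B := by
  rw [mem_QS, mem_QS, ← om_tr (h := h) (B := B) (p := h⁻¹ • p), smul_inv_smul]

theorem Lt.tr (hBC : S.Lt B C) (h : G) : S.Lt (tr h B) (tr h C) := fun p => by
  rw [mem_PS_tr, mem_QS_tr]; exact hBC _

theorem sep_tr {A : Set ℕ} {n : ℕ} (hs : S.toBlockSys.Sep A n {x} {y}) (h : G) :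
    S.toBlockSys.Sep A n {h • x} {h • y} := by
  obtain ⟨D, hD⟩ := hs
  refine ⟨fun i => BlockAxisSys.tr h (D i), fun i hi => hD.idx i hi,
    fun i j hij hj => Lt.tr (hD.lt i j hij hj) h, fun i hi => ?_, fun i hi => ?_⟩
  · have := hD.left i hi
    rw [Set.singleton_subset_iff] at this ⊢
    refine mem_PS_tr.2 ?_
    rwa [inv_smul_smul]
  · have := hD.right i hi
    rw [Set.singleton_subset_iff] at this ⊢
    refine mem_QS_tr.2 ?_
    rwa [inv_smul_smul]

instance : Nonempty (Blk G) := ⟨(1, 0, false)⟩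

theorem N_smul (A : Set ℕ) (h : G) (x y : X) :
    S.toBlockSys.N A (h • x) (h • y) = S.toBlockSys.N A x y := by
  apply le_antisymm
  · have := (sep_tr (S.toBlockSys.sep_N A (h • x) (h • y)) h⁻¹).le_N
    simpa using this
  · exact (sep_tr (S.toBlockSys.sep_N A x y) h).le_N

variable (S) in
/-- `C` and `C'` are lined up along the way from `x` to `y`. -/
def Lined (x y : X) (C C' : Blk G) : Prop :=
  ¬ S.Rel (S.zEnd C) (S.aEnd C') ∧ Near S.c (S.om C (S.aEnd C' • S.o)) (S.om C y) ∧
    Near S.c (S.al C' (S.zEnd C • S.o)) (S.al C' x)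

theorem ends_near {v : G} (s : Bool) (hv : ¬ S.Rel v (S.mid B)) :
    Near (3 * S.c) (S.co s v (S.aEnd B • S.o)) (S.co s v (S.zEnd B • S.o)) := by
  have key : ∀ u i, ¬ S.Rel v (u * S.t) →
      Near (3 * S.c) (S.co s v (u • S.o)) (S.co s v ((u * S.t * S.g ^ S.m i * S.t) • S.o)) := by
    intro u i hv
    have h1 := S.co_t v u s
    have h2 := S.co_proj hv (S.rel_g (u * S.t) (S.m i)) s
    have h3 := S.co_t v (u * S.t * S.g ^ S.m i) s
    omega
  rcases B with ⟨u, i, _ | _⟩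
  · exact key u i hv
  · exact (key u i hv).symm

theorem lined_of_near (hy : y ∈ S.QS C) (hx : x ∈ S.PS C) (hx' : x ∈ S.PS C') (hy' : y ∈ S.QS C')
    (h : Near S.c (S.al C' x) (S.al C' (S.aEnd C • S.o)))
    (hm : ¬ S.Rel (S.aEnd C') (S.mid C)) (hz : ¬ S.Rel (S.zEnd C) (S.aEnd C')) :
    S.Lined x y C C' := by
  have hK := c_le_K (S := S)
  have h1 := ends_near (C'.2.2) hm
  change Near _ (S.al C' _) (S.al C' _) at h1
  have h2 := al_of_QS hy'
  have h3 := om_of_PS hx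
  rw [mem_PS] at hx'
  rw [mem_QS] at hy
  have h4 := S.co_behrstock hz (!C.2.2) C'.2.2
  change ∀ p, Near _ (S.om C _) (S.om C _) ∨ Near _ (S.al C' _) (S.al C' _) at h4
  have h5 := h4 x
  have h6 := h4 y
  refine ⟨hz, ?_, ?_⟩ <;> omega

theorem lined_or_lined (hx : x ∈ S.PS C) (hy : y ∈ S.QS C) (hx' : x ∈ S.PS C') (hy' : y ∈ S.QS C')
    (haa : ¬ S.Rel (S.aEnd C) (S.aEnd C')) (ham : ¬ S.Rel (S.aEnd C) (S.mid C'))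
    (hma : ¬ S.Rel (S.aEnd C') (S.mid C)) (hza : ¬ S.Rel (S.zEnd C) (S.aEnd C'))
    (haz : ¬ S.Rel (S.zEnd C') (S.aEnd C)) : S.Lined x y C C' ∨ S.Lined x y C' C := by
  have h4 := S.co_behrstock haa (C.2.2) C'.2.2 x
  change Near _ (S.al C _) (S.al C _) ∨ Near _ (S.al C' _) (S.al C' _) at h4
  rcases h4 with h4 | h4
  · exact Or.inr (lined_of_near hy' hx' hx hy h4 ham haz)
  · exact Or.inl (lined_of_near hy hx hx' hy' h4 hma hza)

theorem co_exact {v w : G} (h : ¬ S.Rel v w) (s s' : Bool)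
    (hp : ¬ Near S.c (S.co s' w p) (S.co s' w (v • S.o)))
    (hq : ¬ Near S.c (S.co s' w q) (S.co s' w (v • S.o))) : S.co s v p = S.co s v q := by
  rw [AxisSys.co_near] at hp hq
  have := S.exact _ h (v⁻¹ • p) (v⁻¹ • q) (by simpa [mul_smul] using hp)
    (by simpa [mul_smul] using hq)
  unfold AxisSys.co; rw [this]

theorem Lined.lt {C₁ C₂ C₃ : Blk G} (h : S.Lined x y C₁ C₂) (h' : S.Lined x y C₂ C₃)
    (hy : y ∈ S.QS C₁) (hx₂ : x ∈ S.PS C₂) (hy₂ : y ∈ S.QS C₂) (hx₃ : x ∈ S.PS C₃) :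
    S.Lt C₁ C₃ := by
  intro q
  by_contra! hq
  obtain ⟨hq1, hq3⟩ := hq
  have hK := c_le_K (S := S)
  have hy2 := al_of_QS hy₂
  have hx2 := om_of_PS hx₂
  rw [mem_QS] at hy hy₂ hq1
  rw [mem_PS] at hx₂ hx₃ hq3
  obtain ⟨h1, h2, h3⟩ := h
  obtain ⟨h1', h2', h3'⟩ := h'
  have hq : Near S.c (S.al C₂ q) (S.al C₂ (S.zEnd C₁ • S.o)) := by
    by_contra hq
    have := co_exact h1 (!C₁.2.2) C₂.2.2 hq (q := y) (by
      change ¬ Near _ (S.al C₂ _) (S.al C₂ _); omega)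
    change S.om C₁ _ = S.om C₁ _ at this
    omega
  have hq2 : Near (4 * S.c) (S.om C₂ q) 0 := om_of_al (by omega)
  have := co_exact (fun h => h1' h.symm) C₃.2.2 (!C₂.2.2) (p := q) (q := x)
    (by change ¬ Near _ (S.om C₂ _) (S.om C₂ _); omega)
    (by change ¬ Near _ (S.om C₂ _) (S.om C₂ _); omega)
  change S.al C₃ _ = S.al C₃ _ at this
  omega

theorem fiber_bound {w : G} {T : Set G}
    (hx : ∀ h ∈ T, ∀ h' ∈ T, Near (40 * S.c) (S.co false w (h⁻¹ • x)) (S.co false w (h'⁻¹ • x)))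
    (hy : ∀ h ∈ T, ∀ h' ∈ T, Near (40 * S.c) (S.co false w (h⁻¹ • y)) (S.co false w (h'⁻¹ • y)))
    (hxy : ∀ h ∈ T, S.K - 40 * S.c ≤ |S.co false w (h⁻¹ • y) - S.co false w (h⁻¹ • x)|) (v : G) :
    {h | h ∈ T ∧ S.Rel v (h * w)}.Finite ∧ {h | h ∈ T ∧ S.Rel v (h * w)}.ncard ≤ S.N₀ := by
  rcases Set.eq_empty_or_nonempty {h | h ∈ T ∧ S.Rel v (h * w)} with he | ⟨h₀, h₀T, h₀v⟩
  · rw [he]; simp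
  obtain ⟨hfin, hcard⟩ := S.acylK (w⁻¹ • h₀⁻¹ • x) (w⁻¹ • h₀⁻¹ • y) (hxy h₀ h₀T)
  have hinj : Set.InjOn (fun h : G => w⁻¹ * h⁻¹ * h₀ * w) {h | h ∈ T ∧ S.Rel v (h * w)} := by
    intro h _ h' _ e
    simpa using e
  have hmaps : Set.MapsTo (fun h : G => w⁻¹ * h⁻¹ * h₀ * w) {h | h ∈ T ∧ S.Rel v (h * w)}
      {e : G | e ∈ S.E ∧
        Near (40 * S.c) (S.b (e • w⁻¹ • h₀⁻¹ • x)) (S.b (w⁻¹ • h₀⁻¹ • x)) ∧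
        Near (40 * S.c) (S.b (e • w⁻¹ • h₀⁻¹ • y)) (S.b (w⁻¹ • h₀⁻¹ • y))} := by
    rintro h ⟨hT, hv⟩
    refine ⟨?_, ?_, ?_⟩
    · have := hv.symm.trans h₀v
      simpa [AxisSys.Rel, mul_assoc] using this
    · have := hx h hT h₀ h₀T
      simpa [mul_smul, AxisSys.co] using this
    · have := hy h hT h₀ h₀T
      simpa [mul_smul, AxisSys.co] using this
  exact ⟨Set.Finite.of_injOn hmaps hinj hfin,
    (Set.ncard_le_ncard_of_injOn _ hmaps hinj hfin).trans hcard⟩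

end BlockAxisSys

/-- A set in which any two members are incompatible or joined by a directed relation without
directed paths of length two is small, if incompatibility has small fibres. -/
theorem Finset.card_le_of_no_path {α : Type*} (F : Finset α) (r bad : α → α → Prop) (n : ℕ)
    (hbad : ∀ a ∈ F, ∀ F' ⊆ F, (∀ b ∈ F', bad a b) → F'.card ≤ n)
    (htot : ∀ a ∈ F, ∀ b ∈ F, bad a b ∨ r a b ∨ r b a)
    (hr : ∀ a ∈ F, ∀ b ∈ F, ∀ c ∈ F, r a b → r b c → False) : F.card ≤ n + n := by
  classical
  have key : ∀ F' ⊆ F, (∀ a ∈ F', ∀ b ∈ F', ¬ r a b) → F'.card ≤ n := by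
    intro F' hF' h
    rcases F'.eq_empty_or_nonempty with rfl | ⟨a, ha⟩
    · simp
    · refine hbad a (hF' ha) F' hF' fun b hb => ?_
      rcases htot a (hF' ha) b (hF' hb) with h1 | h1 | h1
      · exact h1
      · exact absurd h1 (h a ha b hb)
      · exact absurd h1 (h b hb a ha)
  rw [← Finset.card_filter_add_card_filter_not (s := F) (fun a => ∃ b ∈ F, r a b)]
  refine add_le_add (key _ (Finset.filter_subset _ _) fun a ha b hb hab => ?_)
    (key _ (Finset.filter_subset _ _) fun a ha b hb hab => ?_)
  · rw [Finset.mem_filter] at ha hb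
    obtain ⟨c, hc, hbc⟩ := hb.2
    exact hr a ha.1 b hb.1 c hc hab hbc
  · rw [Finset.mem_filter] at ha hb
    exact ha.2 ⟨b, hb.1, hab⟩

namespace BlockAxisSys

variable {G X : Type*} [Group G] [MulAction G X] {S : BlockAxisSys G X}
variable {x y : X} {B₀ B₁ B₂ : Blk G} {T : Set G}

theorem fiber_bound_aEnd (h01 : S.Lt B₀ B₁) (hx₀ : ∀ h ∈ T, h⁻¹ • x ∈ S.PS B₀)
    (hx₁ : ∀ h ∈ T, h⁻¹ • x ∈ S.PS B₁) (hy₁ : ∀ h ∈ T, h⁻¹ • y ∈ S.QS B₁) (v : G) :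
    {h | h ∈ T ∧ S.Rel v (h * S.aEnd B₁)}.Finite ∧
      {h | h ∈ T ∧ S.Rel v (h * S.aEnd B₁)}.ncard ≤ S.N₀ := by
  have hK := c_le_K (S := S)
  have hcase : ∀ h ∈ T, Near S.c (S.al B₁ (h⁻¹ • x)) (S.al B₁ (S.aEnd B₀ • S.o)) := by
    intro h hh
    have hr : ¬ S.Rel (S.aEnd B₁) (S.aEnd B₀) := fun hr => h01.not_rel_aEnd (hy₁ h hh) hr.symm
    refine (S.co_behrstock hr B₁.2.2 B₀.2.2 _).resolve_right fun h' => ?_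
    change Near _ (S.al B₀ _) (S.al B₀ _) at h'
    have h1 := hx₀ h hh
    have h2 : S.aEnd B₁ • S.o ∈ S.QS B₀ := (h01 _).resolve_right
      (not_PS_of_al al_aEnd (by omega))
    have h3 := al_of_QS h2
    rw [mem_PS] at h1
    omega
  have hyn := fun h hh => al_of_QS (hy₁ h hh)
  refine fiber_bound (x := x) (y := y) (fun h hh h' hh' => ?_) (fun h hh h' hh' => ?_)
    (fun h hh => ?_) v
  · rw [← co_near_al]
    have := hcase h hh
    have := hcase h' hh'
    omega
  · rw [← co_near_al]
    have := hyn h hh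
    have := hyn h' hh'
    omega
  · have h1 := hyn h hh
    have h2 := hx₁ h hh
    rw [mem_PS] at h2
    by_contra! h3
    have h4 : Near (S.K - 40 * S.c) (S.al B₁ (h⁻¹ • y)) (S.al B₁ (h⁻¹ • x)) := by
      rw [co_near_al false]
      have := abs_lt.1 h3
      omega
    omega

theorem fiber_bound_zEnd (h12 : S.Lt B₁ B₂) (hx₁ : ∀ h ∈ T, h⁻¹ • x ∈ S.PS B₁)
    (hy₁ : ∀ h ∈ T, h⁻¹ • y ∈ S.QS B₁) (hy₂ : ∀ h ∈ T, h⁻¹ • y ∈ S.QS B₂) (v : G) :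
    {h | h ∈ T ∧ S.Rel v (h * S.zEnd B₁)}.Finite ∧
      {h | h ∈ T ∧ S.Rel v (h * S.zEnd B₁)}.ncard ≤ S.N₀ := by
  have := fiber_bound_aEnd (T := T) (x := y) (y := x) h12.rev (by simpa using hy₂)
    (by simpa using hy₁) (by simpa using hx₁) v
  simpa using this

theorem fiber_bound_mid (hx₁ : ∀ h ∈ T, h⁻¹ • x ∈ S.PS B₁)
    (hy₁ : ∀ h ∈ T, h⁻¹ • y ∈ S.QS B₁) (v : G) :
    {h | h ∈ T ∧ S.Rel v (h * S.mid B₁)}.Finite ∧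
      {h | h ∈ T ∧ S.Rel v (h * S.mid B₁)}.ncard ≤ S.N₀ := by
  have hK := c_le_K (S := S)
  have hx : ∀ h ∈ T, Near (4 * S.c) (S.be B₁ (h⁻¹ • x)) 0 := fun h hh =>
    be_of_al (by have := hx₁ h hh; rw [mem_PS] at this; omega)
  have hy : ∀ h ∈ T, Near (4 * S.c) (S.be B₁ (h⁻¹ • y)) (S.m B₁.2.1) := fun h hh =>
    be_of_om (by have := hy₁ h hh; rw [mem_QS] at this; omega)
  refine fiber_bound (x := x) (y := y) (fun h hh h' hh' => ?_) (fun h hh h' hh' => ?_)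
    (fun h hh => ?_) v
  · rw [← be_near]
    have := hx h hh
    have := hx h' hh'
    omega
  · rw [← be_near]
    have := hy h hh
    have := hy h' hh'
    omega
  · have h1 := hx h hh
    have h2 := hy h hh
    have hm := S.hm B₁.2.1
    by_contra! h3
    have h4 : Near (S.K - 40 * S.c) (S.be B₁ (h⁻¹ • y)) (S.be B₁ (h⁻¹ • x)) := by
      rw [be_near false]
      have := abs_lt.1 h3
      omega
    omega

variable (S) in
/-- Two blocks in special position. -/
def Bad (C C' : Blk G) : Prop :=
  S.Rel (S.aEnd C) (S.aEnd C') ∨ S.Rel (S.aEnd C) (S.mid C') ∨ S.Rel (S.mid C) (S.aEnd C') ∨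
    S.Rel (S.zEnd C) (S.aEnd C') ∨ S.Rel (S.aEnd C) (S.zEnd C')

theorem card_antichain (h01 : S.Lt B₀ B₁) (h12 : S.Lt B₁ B₂) (hx₀ : ∀ h ∈ T, h⁻¹ • x ∈ S.PS B₀)
    (hx₁ : ∀ h ∈ T, h⁻¹ • x ∈ S.PS B₁) (hy₁ : ∀ h ∈ T, h⁻¹ • y ∈ S.QS B₁)
    (hy₂ : ∀ h ∈ T, h⁻¹ • y ∈ S.QS B₂) (F : Finset G) (hF : ∀ h ∈ F, h ∈ T)
    (hlt : ∀ h ∈ F, ∀ h' ∈ F, ¬ S.Lt (tr h B₁) (tr h' B₁)) : F.card ≤ 10 * S.N₀ := by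
  classical
  have hxh : ∀ h ∈ F, x ∈ S.PS (tr h B₁) := fun h hh => mem_PS_tr.2 (hx₁ h (hF h hh))
  have hyh : ∀ h ∈ F, y ∈ S.QS (tr h B₁) := fun h hh => mem_QS_tr.2 (hy₁ h (hF h hh))
  have key := F.card_le_of_no_path (fun h h' => S.Lined x y (tr h B₁) (tr h' B₁))
    (fun h h' => S.Bad (tr h B₁) (tr h' B₁)) (5 * S.N₀) ?_ ?_ ?_
  · omega
  · intro h hh F' hF' hb
    have hsub : (F' : Set G) ⊆
        {h' | h' ∈ T ∧ S.Rel (h * S.aEnd B₁) (h' * S.aEnd B₁)} ∪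
        ({h' | h' ∈ T ∧ S.Rel (h * S.aEnd B₁) (h' * S.mid B₁)} ∪
        ({h' | h' ∈ T ∧ S.Rel (h * S.mid B₁) (h' * S.aEnd B₁)} ∪
        ({h' | h' ∈ T ∧ S.Rel (h * S.zEnd B₁) (h' * S.aEnd B₁)} ∪
        {h' | h' ∈ T ∧ S.Rel (h * S.aEnd B₁) (h' * S.zEnd B₁)}))) := by
      intro h' hh'
      have h1 := hb h' hh'
      have h2 := hF h' (hF' hh')
      simp only [Bad, aEnd_tr, zEnd_tr, mid_tr] at h1
      simp only [Set.mem_union, Set.mem_ofPred_eq]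
      tauto
    have ha := fiber_bound_aEnd h01 hx₀ hx₁ hy₁
    have hz := fiber_bound_zEnd h12 hx₁ hy₁ hy₂
    have hm := fiber_bound_mid hx₁ hy₁
    have h1 := Set.ncard_le_ncard hsub ((ha _).1.union ((hm _).1.union ((ha _).1.union
      ((ha _).1.union (hz _).1))))
    rw [Set.ncard_coe_finset] at h1
    have u1 := Set.ncard_union_le {h' | h' ∈ T ∧ S.Rel (h * S.aEnd B₁) (h' * S.aEnd B₁)} (
        {h' | h' ∈ T ∧ S.Rel (h * S.aEnd B₁) (h' * S.mid B₁)} ∪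
        ({h' | h' ∈ T ∧ S.Rel (h * S.mid B₁) (h' * S.aEnd B₁)} ∪
        ({h' | h' ∈ T ∧ S.Rel (h * S.zEnd B₁) (h' * S.aEnd B₁)} ∪
        {h' | h' ∈ T ∧ S.Rel (h * S.aEnd B₁) (h' * S.zEnd B₁)})))
    have u2 := Set.ncard_union_le {h' | h' ∈ T ∧ S.Rel (h * S.aEnd B₁) (h' * S.mid B₁)}
        ({h' | h' ∈ T ∧ S.Rel (h * S.mid B₁) (h' * S.aEnd B₁)} ∪
        ({h' | h' ∈ T ∧ S.Rel (h * S.zEnd B₁) (h' * S.aEnd B₁)} ∪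
        {h' | h' ∈ T ∧ S.Rel (h * S.aEnd B₁) (h' * S.zEnd B₁)}))
    have u3 := Set.ncard_union_le {h' | h' ∈ T ∧ S.Rel (h * S.mid B₁) (h' * S.aEnd B₁)}
        ({h' | h' ∈ T ∧ S.Rel (h * S.zEnd B₁) (h' * S.aEnd B₁)} ∪
        {h' | h' ∈ T ∧ S.Rel (h * S.aEnd B₁) (h' * S.zEnd B₁)})
    have u4 := Set.ncard_union_le {h' | h' ∈ T ∧ S.Rel (h * S.zEnd B₁) (h' * S.aEnd B₁)}
        {h' | h' ∈ T ∧ S.Rel (h * S.aEnd B₁) (h' * S.zEnd B₁)}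
    have n1 := (ha (h * S.aEnd B₁)).2
    have n2 := (hm (h * S.aEnd B₁)).2
    have n3 := (ha (h * S.mid B₁)).2
    have n4 := (ha (h * S.zEnd B₁)).2
    have n5 := (hz (h * S.aEnd B₁)).2
    omega
  · intro h hh h' hh'
    by_cases hb : S.Bad (tr h B₁) (tr h' B₁)
    · exact Or.inl hb
    · unfold Bad at hb
      push Not at hb
      obtain ⟨b1, b2, b3, b4, b5⟩ := hb
      exact Or.inr (lined_or_lined (hxh h hh) (hyh h hh) (hxh h' hh') (hyh h' hh') b1 b2
        (fun r => b3 r.symm) b4 (fun r => b5 r.symm))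
  · intro h₁ hh₁ h₂ hh₂ h₃ hh₃ h1 h2
    exact hlt h₁ hh₁ h₃ hh₃ (h1.lt h2 (hyh _ hh₁) (hxh _ hh₂) (hyh _ hh₂) (hxh _ hh₃))

variable (S) in
/-- The length of a longest chain separating `x` from `y` and lying before `B`. -/
def rank (A : Set ℕ) (x y : X) (B : Blk G) : ℕ :=
  sSup {k | ∃ D, S.toBlockSys.IsChain A k {x} {y} D ∧ ∀ j < k, S.Lt (D j) B}

theorem rank_bdd (A : Set ℕ) (x y : X) (B : Blk G) :
    BddAbove {k | ∃ D, S.toBlockSys.IsChain A k {x} {y} D ∧ ∀ j < k, S.Lt (D j) B} :=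
  ⟨S.toBlockSys.N A x y, fun _ ⟨D, hD, _⟩ => BlockSys.Sep.le_N ⟨D, hD⟩⟩

theorem rank_spec (A : Set ℕ) (x y : X) (B : Blk G) :
    ∃ D, S.toBlockSys.IsChain A (S.rank A x y B) {x} {y} D ∧
      ∀ j < S.rank A x y B, S.Lt (D j) B :=
  Nat.sSup_mem (s := {k | ∃ D, S.toBlockSys.IsChain A k {x} {y} D ∧ ∀ j < k, S.Lt (D j) B})
    ⟨0, fun _ => (1, 0, false), ⟨by simp, by simp, by simp, by simp⟩, by simp⟩
    (rank_bdd A x y B)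

theorem rank_lt_rank {A : Set ℕ} {B C : Blk G} (h : S.Lt B C) (hB : B.2.1 ∈ A)
    (hx : x ∈ S.PS B) (hy : y ∈ S.QS B) : S.rank A x y B < S.rank A x y C := by
  obtain ⟨D, hD, hDB⟩ := S.rank_spec A x y B
  set k := S.rank A x y B
  refine Nat.lt_of_succ_le (le_csSup (rank_bdd A x y C)
    ⟨fun j => if j < k then D j else B, ⟨?_, ?_, ?_, ?_⟩, ?_⟩)
  · intro i _
    by_cases hi : i < k
    · simpa [hi] using hD.idx i hi
    · simpa [hi] using hB
  · intro i j hij hj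
    have hi : i < k := by omega
    by_cases hj' : j < k
    · simpa [hi, hj'] using hD.lt i j hij hj'
    · simpa [hi, hj'] using hDB i hi
  · intro i _
    by_cases hi : i < k
    · simpa [hi] using hD.left i hi
    · simpa [hi] using hx
  · intro i _
    by_cases hi : i < k
    · simpa [hi] using hD.right i hi
    · simpa [hi] using hy
  · intro j _
    by_cases hi : j < k
    · have := BlockSys.lt.trans (𝔅 := S.toBlockSys) (hDB j hi) h
      simpa [hi] using this
    · simpa [hi] using h

theorem rank_add_le {A : Set ℕ} {D : ℕ → Blk G} {n : ℕ} (i : ℕ)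
    (hD : ∀ j, i ≤ j → j < n → (D j).2.1 ∈ A)
    (hlt : ∀ j k, i ≤ j → j < k → k < n → S.Lt (D j) (D k)) {y' : X}
    (hx : ∀ j, i ≤ j → j < n → x ∈ S.PS (D j)) (hy : ∀ j, i ≤ j → j < n → y' ∈ S.QS (D j))
    (hin : i < n) :
    S.rank A x y (D i) + (n - i) ≤ S.toBlockSys.N A x y' := by
  obtain ⟨C, hC, hCD⟩ := S.rank_spec A x y (D i)
  set k := S.rank A x y (D i)
  have hCD' : ∀ j < k, ∀ l, i ≤ l → l < n → S.Lt (C j) (D l) := by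
    intro j hj l hl hln
    rcases Nat.eq_or_lt_of_le hl with rfl | hl
    · exact hCD j hj
    · exact BlockSys.lt.trans (𝔅 := S.toBlockSys) (hCD j hj) (hlt i l le_rfl hl hln)
  refine BlockSys.Sep.le_N ⟨fun j => if j < k then C j else D (i + (j - k)), ?_, ?_, ?_, ?_⟩
  · intro j hj
    by_cases hi : j < k
    · simpa [hi] using hC.idx j hi
    · simpa [hi] using hD (i + (j - k)) (by omega) (by omega)
  · intro j l hjl hl
    by_cases hj : j < k
    · by_cases hl' : l < k
      · simpa [hj, hl'] using hC.lt j l hjl hl'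
      · simpa [hj, hl'] using hCD' j hj (i + (l - k)) (by omega) (by omega)
    · have hl' : ¬ l < k := by omega
      simpa [hj, hl'] using hlt (i + (j - k)) (i + (l - k)) (by omega) (by omega) (by omega)
  · intro j hj
    by_cases hi : j < k
    · simpa [hi] using hC.left j hi
    · simpa [hi] using hx (i + (j - k)) (by omega) (by omega)
  · intro j hj
    by_cases hi : j < k
    · have := (hCD j hi y').resolve_right fun h => disj_PS h (hy i le_rfl hin)
      simpa [hi] using this
    · simpa [hi] using hy (i + (j - k)) (by omega) (by omega)

theorem acyl_N (A : Set ℕ) (ε : ℕ) (x y : X) (hN : 2 * ε + 8 ≤ S.toBlockSys.N A x y) :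
    {h : G | S.toBlockSys.N A x (h • x) ≤ ε ∧ S.toBlockSys.N A y (h • y) ≤ ε}.Finite ∧
    Nat.card {h : G | S.toBlockSys.N A x (h • x) ≤ ε ∧ S.toBlockSys.N A y (h • y) ≤ ε} ≤
      10 * S.N₀ * (2 * ε + 5) := by
  classical
  set T := {h : G | S.toBlockSys.N A x (h • x) ≤ ε ∧ S.toBlockSys.N A y (h • y) ≤ ε} with hT
  set n := S.toBlockSys.N A x y with hn
  obtain ⟨B, hB⟩ := S.toBlockSys.sep_N A x y
  rw [← hn] at hB
  have hTx : ∀ h ∈ T, S.toBlockSys.N A x (h⁻¹ • x) ≤ ε := fun h hh => by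
    rw [BlockSys.N_symm, ← N_smul A h, smul_inv_smul]; exact hh.1
  have hTy : ∀ h ∈ T, S.toBlockSys.N A (h⁻¹ • y) y ≤ ε := fun h hh => by
    rw [← N_smul A h, smul_inv_smul]; exact hh.2
  have hxB : ∀ h ∈ T, ∀ j, ε + 1 ≤ j → j < n → h⁻¹ • x ∈ S.PS (B j) := fun h hh j hj hjn =>
    hB.near_left (by have := hTx h hh; omega) hjn
  have hyB : ∀ h ∈ T, ∀ j, j + 1 + ε < n → h⁻¹ • y ∈ S.QS (B j) := fun h hh j hj =>
    hB.near_right (by have := hTy h hh; omega)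
  have hlt : ∀ i j, i < j → j < n → S.Lt (B i) (B j) := hB.lt
  set i := ε + 3 with hi
  have hrank : ∀ h ∈ T, S.rank A x y (tr h (B i)) < 2 * ε + 5 := by
    intro h hh
    have h1 := rank_add_le (S := S) (A := A) (x := x) (y := y) (D := fun j => tr h (B j)) (n := n) i
      (fun j _ hj => hB.idx j hj) (fun j k _ hjk hk => (hlt j k hjk hk).tr h) (y' := h • y)
      (fun j hj hjn => mem_PS_tr.2 (hxB h hh j (by omega) hjn))
      (fun j hj hjn => mem_QS_tr.2 (by
        rw [inv_smul_smul]; simpa using hB.right j hjn)) (by omega)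
    have h2 := S.toBlockSys.N_triangle A x y (h • y)
    have h3 := hh.2
    omega
  have hF : ∀ F : Finset G, (F : Set G) ⊆ T → F.card ≤ 10 * S.N₀ * (2 * ε + 5) := by
    intro F hF
    have := Finset.card_le_mul_card_image_of_maps_to (s := F) (t := Finset.range (2 * ε + 5))
      (f := fun h => S.rank A x y (tr h (B i)))
      (fun h hh => Finset.mem_range.2 (hrank h (hF hh))) (10 * S.N₀) ?_
    · rwa [Finset.card_range] at this
    intro b _
    refine card_antichain (T := T) (x := x) (y := y) (hlt (ε + 2) i (by omega) (by omega))
      (hlt i (ε + 4) (by omega) (by omega)) (fun h hh => hxB h hh _ (by omega) (by omega))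
      (fun h hh => hxB h hh _ (by omega) (by omega)) (fun h hh => hyB h hh _ (by omega))
      (fun h hh => hyB h hh _ (by omega)) _ (fun h hh => hF (Finset.mem_filter.1 hh).1) ?_
    intro h hh h' hh' hl
    have r1 := (Finset.mem_filter.1 hh).2
    have r2 := (Finset.mem_filter.1 hh').2
    have hhT := hF (Finset.mem_filter.1 hh).1
    have := rank_lt_rank (A := A) hl (hB.idx i (by omega))
      (mem_PS_tr.2 (hxB h hhT i (by omega) (by omega))) (mem_QS_tr.2 (hyB h hhT i (by omega)))
    omega
  have hfin : T.Finite := by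
    by_contra hinf
    obtain ⟨F, hFT, hFc⟩ := Set.Infinite.exists_subset_card_eq hinf (10 * S.N₀ * (2 * ε + 5) + 1)
    have := hF F hFT
    omega
  refine ⟨hfin, ?_⟩
  have := hF hfin.toFinset (by simp)
  rwa [Nat.card_coe_set_eq, Set.ncard_eq_toFinset_card T hfin]

end BlockAxisSys

namespace BlockAxisSys

variable {G X : Type*} [Group G] [MulAction G X] (S : BlockAxisSys G X)

theorem acylHypDist (A : Set ℕ) :
    AcylHypDist fun g h : G => S.toBlockSys.N A (g • S.o) (h • S.o) where
  inv g x y := by simp only [mul_smul, N_smul]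
  self x := BlockSys.N_self A _
  symm x y := BlockSys.N_symm A _ _
  tri x y z := BlockSys.N_triangle A _ _ _
  four x y z w := BlockSys.four_point A _ _ _ _
  btw x y k hk := by
    obtain ⟨b, hb⟩ := BlockSys.exists_between A _ _ k hk
    exact ⟨b.1, hb⟩
  acyl ε := ⟨2 * ε + 8, _, fun x y h => by
    simpa only [mul_smul] using acyl_N (S := S) A ε (x • S.o) (y • S.o) h⟩

/-- The element whose powers are followed by blocks of index `i`. -/
def step (i : ℕ) : G := S.t * S.g ^ S.m i

variable {S}

theorem m_large (i : ℕ) : 300 * S.c ≤ S.m i := by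
  have := S.hm i
  have := S.hK
  omega

theorem step_notMem (i : ℕ) : S.step i ∉ S.E := fun h =>
  S.t_notMem (by simpa [step] using S.E.mul_mem h (S.E.inv_mem (S.E.zpow_mem S.g_mem (S.m i))))

theorem b_step (i : ℕ) : Near (3 * S.c) (S.b (S.step i • S.o)) 0 := by
  have h1 := S.proj S.t S.t_notMem _ (S.E.zpow_mem S.g_mem (S.m i))
  have h2 := S.t_near 1
  have h3 := S.b_o
  rw [one_smul, one_smul] at h2
  rw [smul_smul] at h1
  unfold step
  omega

theorem b_step_inv (i : ℕ) : Near (3 * S.c) (S.b ((S.step i)⁻¹ • S.o)) (- S.m i) := by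
  have h1 := S.shift (- S.m i) (S.t⁻¹ • S.o)
  have h2 := S.t_near S.t⁻¹
  have h3 := S.b_o
  rw [inv_smul_smul] at h2
  rw [smul_smul, zpow_neg, ← mul_inv_rev] at h1
  unfold step
  omega

theorem b_step_pow (i j : ℕ) : Near (4 * S.c) (S.b (S.step i ^ j • S.o)) 0 := by
  have hc := S.one_le
  induction j with
  | zero => have := S.b_o; simp; omega
  | succ j ih =>
    have h1 := S.b_step i
    have h2 := S.b_step_inv i
    have h3 := S.behrstock _ (step_notMem i) (S.step i ^ (j + 1) • S.o)
    rw [pow_succ', mul_smul, inv_smul_smul] at h3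
    rw [pow_succ', mul_smul]
    have := S.m_large i
    omega

theorem b_step_pow_inv (i j : ℕ) :
    Near (4 * S.c) (S.b ((S.step i ^ (j + 1))⁻¹ • S.o)) (- S.m i) := by
  have hc := S.one_le
  induction j with
  | zero => have := S.b_step_inv i; simp only [zero_add, pow_one]; omega
  | succ j ih =>
    have h1 := S.b_step i
    have h2 := S.b_step_inv i
    have h3 := S.behrstock (S.step i)⁻¹ (fun h => step_notMem i (inv_mem_iff.1 h))
      ((S.step i ^ (j + 2))⁻¹ • S.o)
    rw [show (S.step i ^ (j + 2))⁻¹ = (S.step i)⁻¹ * (S.step i ^ (j + 1))⁻¹ by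
      rw [← mul_inv_rev, ← pow_succ], mul_smul, inv_inv, smul_inv_smul] at h3
    rw [show (S.step i ^ (j + 1 + 1))⁻¹ = (S.step i)⁻¹ * (S.step i ^ (j + 1))⁻¹ by
      rw [← mul_inv_rev, ← pow_succ], mul_smul]
    have := S.m_large i
    omega

theorem co_step_of_le {i k j : ℕ} (h : k ≤ j) :
    Near (4 * S.c) (S.co false (S.step i ^ k) (S.step i ^ j • S.o)) 0 := by
  obtain ⟨l, rfl⟩ := Nat.exists_eq_add_of_le h
  have := S.b_step_pow i l
  simp only [AxisSys.co]
  rwa [pow_add, mul_smul, inv_smul_smul]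

theorem co_step_of_lt {i k j : ℕ} (h : j < k) :
    Near (4 * S.c) (S.co false (S.step i ^ k) (S.step i ^ j • S.o)) (- S.m i) := by
  obtain ⟨l, rfl⟩ := Nat.exists_eq_add_of_lt h
  have := S.b_step_pow_inv i l
  simp only [AxisSys.co]
  rwa [show j + l + 1 = j + (l + 1) by ring, pow_add, mul_inv_rev, mul_smul, inv_smul_smul]

theorem not_rel_step {i k j : ℕ} (h : k < j) : ¬ S.Rel (S.step i ^ k) (S.step i ^ j) := by
  intro hr
  have h1 := co_step_of_le (S := S) (i := i) (k := k) (j := k) le_rfl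
  obtain ⟨l, rfl⟩ := Nat.exists_eq_add_of_lt h
  have he : S.step i ^ (l + 1) ∈ S.E := by
    have : S.step i ^ (k + l + 1) = S.step i ^ k * S.step i ^ (l + 1) := by
      rw [← pow_add, add_assoc]
    rwa [AxisSys.Rel, this, inv_mul_cancel_left] at hr
  have h2 := S.elem _ he ((S.step i ^ 1)⁻¹ • S.o) ((S.step i ^ (l + 1 + 1))⁻¹ • S.o)
  have h3 := S.b_step_pow_inv i 0
  have h4 := S.b_step_pow_inv i (l + 1)
  have h5 := S.b_step_pow i l
  rw [smul_smul, smul_smul, show S.step i ^ (l + 1) * (S.step i ^ 1)⁻¹ = S.step i ^ l by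
    rw [pow_succ]; group, show S.step i ^ (l + 1) * (S.step i ^ (l + 1 + 1))⁻¹ =
      (S.step i ^ (0 + 1))⁻¹ by rw [pow_succ _ (l + 1)]; group] at h2
  have hm := S.m_large i
  have hc := S.one_le
  rw [zero_add] at h2 h3
  have h6 : |S.b ((S.step i ^ 1)⁻¹ • S.o) - S.b ((S.step i ^ (l + 1 + 1))⁻¹ • S.o)| ≤ 8 * S.c := by
    rw [abs_le]; omega
  have h7 := le_abs_self (S.b (S.step i ^ l • S.o) - S.b ((S.step i ^ 1)⁻¹ • S.o))
  omega

theorem rel_step (i k : ℕ) : S.Rel (S.step i ^ k * S.t) (S.step i ^ (k + 1)) := by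
  have := S.rel_g (S.step i ^ k * S.t) (S.m i)
  rwa [mul_assoc, ← show S.step i = S.t * S.g ^ S.m i from rfl, ← pow_succ] at this

variable (S) in
/-- The `k`-th block along the powers of `S.step i`. -/
def stepBlk (i k : ℕ) : Blk G := (S.step i ^ k, i, false)

theorem zEnd_stepBlk (i k : ℕ) : S.zEnd (S.stepBlk i k) = S.step i ^ (k + 1) * S.t := by
  simp [zEnd, stepBlk, far, step, pow_succ, mul_assoc]

theorem om_stepBlk (i k : ℕ) (p : X) : Near S.c (S.om (S.stepBlk i k) p)
    (- S.m i - S.co false (S.step i ^ (k + 2)) p) := by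
  have h1 := S.co_shift (S.step i ^ (k + 1) * S.t) (S.m i) p
  rw [mul_assoc, ← show S.step i = S.t * S.g ^ S.m i from rfl, ← pow_succ,
    show k + 1 + 1 = k + 2 from rfl] at h1
  have h2 : S.om (S.stepBlk i k) p = - S.co false (S.step i ^ (k + 1) * S.t) p := by
    unfold om
    rw [zEnd_stepBlk]
    simp [stepBlk, AxisSys.co]
  rw [h2]
  omega

theorem al_stepBlk (i k : ℕ) (p : X) :
    S.al (S.stepBlk i k) p = S.co false (S.step i ^ k) p := rfl

theorem stepBlk_lt {i k l : ℕ} (h : k + 3 ≤ l) : S.Lt (S.stepBlk i k) (S.stepBlk i l) := by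
  intro q
  rw [or_iff_not_imp_left]
  intro hq
  have hK := S.hK
  have hc := S.one_le
  have hm := S.hm i
  have hr : S.Rel (S.step i ^ (k + 1) * S.t) (S.step i ^ (k + 2)) := rel_step i (k + 1)
  have hnr : ¬ S.Rel (S.step i ^ (k + 2)) (S.step i ^ l) := not_rel_step (by omega)
  have hnr' : ¬ S.Rel (S.zEnd (S.stepBlk i k)) (S.step i ^ l) := by
    rw [zEnd_stepBlk]; exact fun h => hnr (hr.symm.trans h)
  have h1 := S.co_behrstock hnr' true false q
  change Near _ (S.om (S.stepBlk i k) _) (S.om (S.stepBlk i k) _) ∨ _ at h1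
  have h2 := om_stepBlk (S := S) i k (S.step i ^ l • S.o)
  have h3 := co_step_of_le (S := S) (i := i) (k := k + 2) (j := l) (by omega)
  have h4 := S.co_proj (fun h => hnr' h.symm) (by rw [zEnd_stepBlk]; exact hr) false
  have h5 := co_step_of_lt (S := S) (i := i) (k := l) (j := k + 2) (by omega)
  rw [mem_QS] at hq
  rw [mem_PS, al_stepBlk]
  omega

theorem le_N_step {A : Set ℕ} {i : ℕ} (hi : i ∈ A) (L : ℕ) :
    L ≤ S.toBlockSys.N A S.o (S.step i ^ (3 * L) • S.o) := by
  have hK := S.hK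
  have hc := S.one_le
  have hm := S.hm i
  refine BlockSys.Sep.le_N ⟨fun j => S.stepBlk i (3 * j + 1), fun j _ => hi,
    fun j l hjl _ => stepBlk_lt (by omega), fun j hj => ?_, fun j hj => ?_⟩
  · rw [Set.singleton_subset_iff, toBlockSys_P, mem_PS, al_stepBlk]
    have := co_step_of_lt (S := S) (i := i) (k := 3 * j + 1) (j := 0) (by omega)
    rw [pow_zero, one_smul] at this
    omega
  · rw [Set.singleton_subset_iff, toBlockSys_Q, mem_QS]
    have h1 := om_stepBlk (S := S) i (3 * j + 1) (S.step i ^ (3 * L) • S.o)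
    have h2 := co_step_of_le (S := S) (i := i) (k := 3 * j + 1 + 2) (j := 3 * L) (by omega)
    omega

theorem displacement_step (i n : ℕ) (w : G) :
    |S.co false w S.o - S.co false w (S.step i ^ n • S.o)| ≤ 10 * S.c ∨
      Near (10 * S.c) (|S.co false w S.o - S.co false w (S.step i ^ n • S.o)|) (S.m i) := by
  have hc := S.one_le
  have hm := S.m_large i
  by_cases hw : ∃ k ≤ n, S.Rel w (S.step i ^ k)
  · obtain ⟨k, hk, hr⟩ := hw
    have h1 := S.co_elem hr false false S.o (S.step i ^ n • S.o)
    have h2 := S.co_elem hr.symm false false S.o (S.step i ^ n • S.o)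
    have h3 := co_step_of_le (S := S) (i := i) hk
    rcases Nat.eq_zero_or_pos k with rfl | hk0
    · left
      have h4 := co_step_of_le (S := S) (i := i) (k := 0) (j := 0) le_rfl
      rw [pow_zero, one_smul] at h4
      rw [pow_zero] at *
      have : |S.co false 1 S.o - S.co false 1 (S.step i ^ n • S.o)| ≤ 8 * S.c := by
        rw [abs_le]; omega
      omega
    · right
      have h4 := co_step_of_lt (S := S) (i := i) (k := k) (j := 0) hk0
      rw [pow_zero, one_smul] at h4
      have : |S.co false (S.step i ^ k) S.o - S.co false (S.step i ^ k) (S.step i ^ n • S.o)| =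
          - (S.co false (S.step i ^ k) S.o - S.co false (S.step i ^ k) (S.step i ^ n • S.o)) :=
        abs_of_nonpos (by omega)
      omega
  · left
    push Not at hw
    suffices h : Near (4 * S.c) (S.co false w S.o) (S.co false w (S.step i ^ n • S.o)) by
      rw [abs_le]; omega
    by_contra hcon
    have hall : ∀ k ≤ n, Near S.c (S.co false w S.o) (S.co false w (S.step i ^ k • S.o)) := by
      intro k
      induction k with
      | zero => intro _; rw [pow_zero, one_smul]; omega
      | succ k ih =>
        intro hk
        have h0 := ih (by omega)
        have h1 := S.co_t w (S.step i ^ k) false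
        have h2 := S.co_proj (fun h => hw (k + 1) hk (h.trans (rel_step i k)))
          (rel_step i k) false
        have h3 := S.co_behrstock (hw (k + 1) hk) false false S.o
        have h4 := S.co_behrstock (hw (k + 1) hk) false false (S.step i ^ n • S.o)
        have h5 := co_step_of_le (S := S) (i := i) hk
        have h6 := co_step_of_lt (S := S) (i := i) (k := k + 1) (j := 0) (by omega)
        rw [pow_zero, one_smul] at h6
        omega
    have := hall n le_rfl
    omega

theorem N_step_eq_zero {A : Set ℕ} {i : ℕ} (hi : i ∉ A) (n : ℕ) :
    S.toBlockSys.N A S.o (S.step i ^ n • S.o) = 0 := by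
  by_contra hne
  obtain ⟨D, hD⟩ := S.toBlockSys.sep_N A S.o (S.step i ^ n • S.o)
  have hpos := Nat.pos_of_ne_zero hne
  have h1 : S.o ∈ S.PS (D 0) := by simpa using hD.left 0 hpos
  have h2 : S.step i ^ n • S.o ∈ S.QS (D 0) := by simpa using hD.right 0 hpos
  have h3 : (D 0).2.1 ≠ i := fun h => hi (h ▸ hD.idx 0 hpos)
  have hK := S.hK
  have hc := S.one_le
  have hs := S.m_sep _ _ h3
  have hm := S.m_large (D 0).2.1
  have h4 := be_of_al (S := S) (B := D 0) (p := S.o) (by rw [mem_PS] at h1; omega)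
  have h5 := be_of_om (S := S) (B := D 0) (p := S.step i ^ n • S.o)
    (by rw [mem_QS] at h2; omega)
  have h6 := S.displacement_step i n (S.mid (D 0))
  have h7 : |S.co false (S.mid (D 0)) S.o - S.co false (S.mid (D 0)) (S.step i ^ n • S.o)| =
      |S.be (D 0) S.o - S.be (D 0) (S.step i ^ n • S.o)| := by
    unfold be
    split_ifs
    · rw [← abs_neg]; congr 1; ring
    · rfl
  have h8 : |S.be (D 0) S.o - S.be (D 0) (S.step i ^ n • S.o)| =
      - (S.be (D 0) S.o - S.be (D 0) (S.step i ^ n • S.o)) := abs_of_nonpos (by omega)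
  rw [h7, h8] at h6
  rcases abs_cases (S.m (D 0).2.1 - S.m i) with h | h <;> omega

end BlockAxisSys

theorem ExactAxisSys.exists_embedding {G : Type uG} {X : Type*} [Group G] [MulAction G X]
    (S : ExactAxisSys G X) : Cardinal.continuum ≤ Cardinal.mk (AHStructures G) ∧
    ∃ f : Set ℕ → {S : Set G // IsAHGenSet S},
      ∀ A B : Set ℕ, A ⊆ B ↔ GenSetDominated (f A).1 (f B).1 := by
  obtain ⟨T, -⟩ := S.exists_blockAxisSys
  refine exists_embedding_of_dist
    (fun A (g h : G) => T.toBlockSys.N A (g • T.o) (h • T.o)) T.acylHypDist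
    (fun A B h x y => BlockSys.N_mono h _ _) fun A B i hA hB n => ⟨T.step i ^ (3 * n), ?_, ?_⟩
  · rw [one_smul]; exact BlockAxisSys.N_step_eq_zero hB _
  · rw [one_smul]; exact BlockAxisSys.le_N_step hA n

namespace AxisSys

variable {G X : Type*} [Group G] [MulAction G X] (S : AxisSys G X)

/-- The projection of `p` to the axis of `v` is at distance more than `r` from that of `o`. -/
def Guard (r : ℤ) (v : G) (p : X) : Prop := ¬ Near r (S.b (v⁻¹ • p)) (S.b (v⁻¹ • S.o))

variable {S}

theorem Guard.b_near {r : ℤ} {v : G} {p : X} (h : S.Guard r v p) (hv : v ∉ S.E) (hr : S.c ≤ r) :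
    Near S.c (S.b p) (S.b (v • S.o)) := by
  refine (S.behrstock v hv p).resolve_right fun h' => ?_
  unfold Guard at h
  omega

theorem Guard.transfer {v w : G} (hvw : ¬ S.Rel v w)
    (ho : Near S.c (S.b (v⁻¹ • S.o)) (S.b (v⁻¹ • w • S.o))) {p q : X}
    (hp : S.Guard (2 * S.c) v p) (hq : S.Guard (2 * S.c) v q) (hpw : S.Guard (4 * S.c) w p) :
    S.Guard (2 * S.c) w q := by
  have h1 := S.co_behrstock hvw false false p
  have h2 := S.co_behrstock hvw false false q
  simp only [co] at h1 h2
  unfold Guard at *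
  have hc := S.one_le
  simp only [Bool.false_eq_true, if_false] at *
  omega

theorem exists_barrier (L : ℕ) : ∀ (p : ℕ → X) (v : ℕ → G),
    (∀ j k, j < L + 1 → k < L + 1 → v j = v k ∨ ¬ S.Rel (v j) (v k)) →
    (∀ k < L + 1, S.Guard (4 * S.c) (v k) (p k) ∧ S.Guard (4 * S.c) (v k) (p (k + 1))) →
    ∃ j < L + 1, ∀ i ≤ L + 1, S.Guard (2 * S.c) (v j) (p i) := by
  have hc := S.one_le
  have hweak : ∀ v p, S.Guard (4 * S.c) v p → S.Guard (2 * S.c) v p := fun v p h => by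
    unfold Guard at *; omega
  induction L with
  | zero =>
    intro p v _ h
    refine ⟨0, by omega, fun i hi => ?_⟩
    obtain rfl | rfl : i = 0 ∨ i = 1 := by omega
    · exact hweak _ _ (h 0 (by omega)).1
    · exact hweak _ _ (h 0 (by omega)).2
  | succ L ih =>
    intro p v hv h
    obtain ⟨j, hj, hjg⟩ := ih p v (fun j k hj hk => hv j k (by omega) (by omega))
      fun k hk => h k (by omega)
    obtain ⟨k, hk, hkg⟩ := ih (fun i => p (i + 1)) (fun i => v (i + 1))
      (fun j k hj hk => hv _ _ (by omega) (by omega)) fun k hk => h (k + 1) (by omega)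
    have hkg' : ∀ i, 1 ≤ i → i ≤ L + 2 → S.Guard (2 * S.c) (v (k + 1)) (p i) := by
      intro i h1 h2
      have := hkg (i - 1) (by omega)
      rwa [Nat.sub_add_cancel h1] at this
    rcases hv j (k + 1) (by omega) (by omega) with he | hr
    · refine ⟨j, by omega, fun i hi => ?_⟩
      rcases Nat.eq_zero_or_pos i with rfl | h0
      · exact hjg 0 (by omega)
      · rw [he]; exact hkg' i h0 hi
    · have ho := S.co_behrstock hr false false S.o
      simp only [co, Bool.false_eq_true, if_false] at ho
      rcases ho with ho | ho
      · refine ⟨k + 1, by omega, fun i hi => ?_⟩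
        rcases Nat.lt_or_ge i (L + 2) with hi' | hi'
        · exact Guard.transfer hr ho (hjg (k + 1) (by omega)) (hjg i (by omega))
            (h (k + 1) (by omega)).1
        · exact hkg' i (by omega) hi
      · refine ⟨j, by omega, fun i hi => ?_⟩
        rcases Nat.eq_zero_or_pos i with rfl | h0
        · exact hjg 0 (by omega)
        · exact Guard.transfer (fun h => hr h.symm) ho (hkg' (j + 1) (by omega) (by omega))
            (hkg' i h0 hi) (h j (by omega)).2

variable (S) in
/-- Both points are guarded by a common axis. -/
def Guarded (p q : X) : Prop := ∃ v : G ⧸ S.E, v.out ∉ S.E ∧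
  S.Guard (4 * S.c) v.out p ∧ S.Guard (4 * S.c) v.out q

theorem exists_chain_of_eqvGen {α : Type*} {r : α → α → Prop} (hr : ∀ a b, r a b → r b a) {a b : α}
    (h : Relation.EqvGen r a b) :
    ∃ (L : ℕ) (f : ℕ → α), f 0 = a ∧ f L = b ∧ ∀ k < L, r (f k) (f (k + 1)) := by
  induction h with
  | rel a b h =>
    exact ⟨1, fun k => if k = 0 then a else b, rfl, rfl, fun k hk => by
      obtain rfl : k = 0 := by omega
      simpa using h⟩
  | refl a => exact ⟨0, fun _ => a, rfl, rfl, by simp⟩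
  | symm a b _ ih =>
    obtain ⟨L, f, h0, hL, h⟩ := ih
    refine ⟨L, fun k => f (L - k), by simpa, by simpa, fun k hk => hr _ _ ?_⟩
    have := h (L - (k + 1)) (by omega)
    rwa [show L - (k + 1) + 1 = L - k by omega] at this
  | trans a b c _ _ ih ih' =>
    obtain ⟨L, f, h0, hL, h⟩ := ih
    obtain ⟨L', f', h0', hL', h'⟩ := ih'
    refine ⟨L + L', fun k => if k < L then f k else f' (k - L), ?_, ?_, fun k hk => ?_⟩
    · rcases Nat.eq_zero_or_pos L with rfl | h1
      · simp; rw [h0', ← hL, h0]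
      · simpa [h1] using h0
    · simpa using hL'
    · by_cases h1 : k + 1 < L
      · simpa [h1, show k < L by omega] using h k (by omega)
      · by_cases h2 : k < L
        · have := h k h2
          simp only [h2, h1, if_true, if_false, show k + 1 - L = 0 by omega]
          rwa [h0', ← hL, ← show k + 1 = L by omega]
        · simp only [h2, h1, if_false]
          rw [show k + 1 - L = k - L + 1 by omega]
          exact h' _ (by omega)

theorem near_of_eqvGen {p q : X} (h : Relation.EqvGen S.Guarded p q) :
    Near (2 * S.c) (S.b p) (S.b q) := by
  have hc := S.one_le
  obtain ⟨L, f, rfl, rfl, hf⟩ :=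
    exists_chain_of_eqvGen (fun a b ⟨v, h1, h2, h3⟩ => ⟨v, h1, h3, h2⟩) h
  rcases L with _ | L
  · omega
  choose! v hvE hv using hf
  obtain ⟨j, hj, hg⟩ := S.exists_barrier L f (fun k => (v k).out) (fun j k _ _ => by
    by_cases hr : S.Rel (v j).out (v k).out
    · left
      have := QuotientGroup.eq.2 hr
      have e : v j = v k := (Quotient.out_eq' (v j)).symm.trans (this.trans (Quotient.out_eq' (v k)))
      simp only [e]
    · exact Or.inr hr) hv
  have h1 := (hg 0 (by omega)).b_near (hvE j hj) (by omega)
  have h2 := (hg (L + 1) le_rfl).b_near (hvE j hj) (by omega)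
  omega

variable (S) in
/-- The corrected projection. -/
def hatB (p : X) : ℤ := S.b (Quot.mk S.Guarded p).out

theorem hatB_near (p : X) : Near (2 * S.c) (S.hatB p) (S.b p) :=
  near_of_eqvGen (Quot.eqvGen_exact (Quot.out_eq _))

theorem guarded_of {v : G} (hv : v ∉ S.E) {p q : X} (hp : S.Guard (5 * S.c) v p)
    (hq : S.Guard (5 * S.c) v q) : S.Guarded p q := by
  have hr : S.Rel v (QuotientGroup.mk (s := S.E) v).out :=
    QuotientGroup.eq.1 (Quotient.out_eq' _).symm
  have key : ∀ p, S.Guard (5 * S.c) v p →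
      S.Guard (4 * S.c) (QuotientGroup.mk (s := S.E) v).out p := by
    intro p hp hp'
    have := S.co_elem_near hr (s := false) (s' := false) hp'
    simp only [co, Bool.false_eq_true, if_false] at this
    unfold Guard at hp
    omega
  refine ⟨QuotientGroup.mk v, fun h => hv ?_, key p hp, key q hq⟩
  have := S.E.mul_mem h (S.E.inv_mem hr)
  simpa using this

theorem hatB_eq (p q : X) (h : S.Guarded p q) : S.hatB p = S.hatB q := by
  unfold hatB
  rw [Quot.sound h]

variable (S) in
/-- Any axis system can be corrected to an exact one. -/
def toExact : ExactAxisSys G X where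
  o := S.o
  E := S.E
  b := S.hatB
  g := S.g
  t := S.t
  c := 10 * S.c
  one_le := by linarith [S.one_le]
  g_mem := S.g_mem
  t_notMem := S.t_notMem
  path p q := by
    obtain ⟨L, f, h0, hL, h⟩ := S.path p q
    refine ⟨L, f, h0, hL, fun i hi u => ?_⟩
    have h1 := h i hi u
    have h2 := S.hatB_near (u • f i)
    have h3 := S.hatB_near (u • f (i + 1))
    have := S.one_le
    omega
  t_near v := by
    have h1 := S.t_near v
    have h2 := S.hatB_near (v • S.t • S.o)
    have h3 := S.hatB_near (v • S.o)
    have := S.one_le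
    omega
  proj u hu e he := by
    have h1 := S.proj u hu e he
    have h2 := S.hatB_near (u • e • S.o)
    have h3 := S.hatB_near (u • S.o)
    have := S.one_le
    omega
  behrstock u hu p := by
    have h1 := S.behrstock u hu p
    have h2 := S.hatB_near p
    have h3 := S.hatB_near (u • S.o)
    have h4 := S.hatB_near (u⁻¹ • p)
    have h5 := S.hatB_near (u⁻¹ • S.o)
    have := S.one_le
    omega
  elem e he p q := by
    have h1 := S.elem e he p q
    have h2 := S.hatB_near (e • p)
    have h3 := S.hatB_near (e • q)
    have h4 := S.hatB_near p
    have h5 := S.hatB_near q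
    have := S.one_le
    rcases abs_cases (S.hatB (e • p) - S.hatB (e • q)) with h | h <;>
    rcases abs_cases (S.b (e • p) - S.b (e • q)) with h' | h' <;>
    rcases abs_cases (S.hatB p - S.hatB q) with h'' | h'' <;>
    rcases abs_cases (S.b p - S.b q) with h''' | h''' <;> omega
  shift k p := by
    have h1 := S.shift k p
    have h2 := S.hatB_near (S.g ^ k • p)
    have h3 := S.hatB_near p
    have := S.one_le
    omega
  b_o := by
    have h1 := S.b_o
    have h2 := S.hatB_near S.o
    have := S.one_le
    omega
  acyl r := by
    obtain ⟨M, N, h⟩ := S.acyl (r + 4 * S.c)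
    refine ⟨M + 4 * S.c, N, fun p q hpq => ?_⟩
    have hsub : {e : G | e ∈ S.E ∧ Near r (S.hatB (e • p)) (S.hatB p) ∧
          Near r (S.hatB (e • q)) (S.hatB q)} ⊆
        {e : G | e ∈ S.E ∧ Near (r + 4 * S.c) (S.b (e • p)) (S.b p) ∧
          Near (r + 4 * S.c) (S.b (e • q)) (S.b q)} := by
      rintro e ⟨he, h1, h2⟩
      have h3 := S.hatB_near (e • p)
      have h4 := S.hatB_near (e • q)
      have h5 := S.hatB_near p
      have h6 := S.hatB_near q
      exact ⟨he, by omega, by omega⟩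
    have h5 := S.hatB_near p
    have h6 := S.hatB_near q
    obtain ⟨hf, hn⟩ := h p q (by
      rcases abs_cases (S.hatB q - S.hatB p) with h | h <;>
      rcases abs_cases (S.b q - S.b p) with h' | h' <;> omega)
    exact ⟨hf.subset hsub, (Set.ncard_le_ncard hsub hf).trans hn⟩
  exact v hv p q hp hq := by
    refine hatB_eq p q (guarded_of hv ?_ ?_)
    · intro h
      have h1 := S.hatB_near (v⁻¹ • p)
      have h2 := S.hatB_near (v⁻¹ • S.o)
      have := S.one_le
      omega
    · intro h
      have h1 := S.hatB_near (v⁻¹ • q)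
      have h2 := S.hatB_near (v⁻¹ • S.o)
      have := S.one_le
      omega

end AxisSys

section Rips

variable {X : Type*} [MetricSpace X]

theorem IsGeodesicSeg.continuousOn {x y : X} {f : ℝ → X} (hf : IsGeodesicSeg x y f) :
    ContinuousOn f (Set.Icc 0 (dist x y)) := by
  have : LipschitzOnWith 1 f (Set.Icc 0 (dist x y)) := by
    refine LipschitzOnWith.of_dist_le_mul fun s hs t ht => ?_
    rw [hf.2.2 s hs t ht, Real.dist_eq]; simp
  exact this.continuousOn

theorem IsGeodesicSeg.dist_add_dist {x y p : X} {f : ℝ → X} (hf : IsGeodesicSeg x y f)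
    (hp : p ∈ geodSet x y f) : dist x p + dist p y = dist x y := by
  obtain ⟨s, hs, rfl⟩ := hp
  have h1 := hf.2.2 0 ⟨le_rfl, dist_nonneg⟩ s hs
  have h2 := hf.2.2 s hs _ ⟨dist_nonneg, le_rfl⟩
  rw [hf.1] at h1
  rw [hf.2.1] at h2
  rw [h1, h2, abs_of_nonpos (by linarith [hs.1]), abs_of_nonpos (by linarith [hs.2])]
  ring

/-- Some point of the side `[x, y]` is close to both other sides of a geodesic triangle. -/
theorem RipsHyperbolic.exists_near_both {δ : ℝ} (hr : RipsHyperbolic X δ) {x y w : X}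
    {fxy fyw fxw : ℝ → X} (hxy : IsGeodesicSeg x y fxy) (hyw : IsGeodesicSeg y w fyw)
    (hxw : IsGeodesicSeg x w fxw) :
    ∃ q ∈ geodSet x y fxy, (∃ q₁ ∈ geodSet x w fxw, dist q q₁ < δ + 1) ∧
      ∃ q₂ ∈ geodSet y w fyw, dist q q₂ < δ + 1 := by
  have hδ : 0 ≤ δ := by
    obtain ⟨q, -, h⟩ := (hr x y w _ _ _ hxy hyw hxw).1 x ⟨0, ⟨le_rfl, dist_nonneg⟩, hxy.1⟩
    exact dist_nonneg.trans h
  have hd0 : (0 : ℝ) ∈ Set.Icc 0 (dist x y) := ⟨le_rfl, dist_nonneg⟩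
  have hd1 : dist x y ∈ Set.Icc 0 (dist x y) := ⟨dist_nonneg, le_rfl⟩
  have key := (isPreconnected_Icc (a := (0 : ℝ)) (b := dist x y)).image _ hxy.continuousOn
  obtain ⟨q, hq, h1, h2⟩ := key (⋃ q₁ ∈ geodSet x w fxw, ball q₁ (δ + 1))
    (⋃ q₂ ∈ geodSet y w fyw, ball q₂ (δ + 1))
    (isOpen_biUnion fun _ _ => isOpen_ball) (isOpen_biUnion fun _ _ => isOpen_ball)
    (fun p hp => by
      obtain ⟨q, hq | hq, h⟩ := (hr x y w _ _ _ hxy hyw hxw).1 p hp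
      · exact Or.inr (Set.mem_biUnion hq (by rw [mem_ball]; linarith))
      · exact Or.inl (Set.mem_biUnion hq (by rw [mem_ball]; linarith)))
    ⟨x, ⟨0, hd0, hxy.1⟩, Set.mem_biUnion (x := x) ⟨0, ⟨le_rfl, dist_nonneg⟩, hxw.1⟩
      (by rw [mem_ball, dist_self]; linarith)⟩
    ⟨y, ⟨_, hd1, hxy.2.1⟩, Set.mem_biUnion (x := y) ⟨0, ⟨le_rfl, dist_nonneg⟩, hyw.1⟩
      (by rw [mem_ball, dist_self]; linarith)⟩
  simp only [Set.mem_iUnion, mem_ball, exists_prop] at h1 h2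
  exact ⟨q, hq, h1, h2⟩

/-- The four-point inequality in a geodesic space with thin triangles. -/
theorem RipsHyperbolic.four_point {δ : ℝ} (hr : RipsHyperbolic X δ) (hg : GeodesicSpace X)
    (x y z w : X) :
    dist x y + dist z w ≤ dist x z + dist y w + (6 * δ + 4) ∨
      dist x y + dist z w ≤ dist x w + dist y z + (6 * δ + 4) := by
  obtain ⟨fxy, hxy⟩ := hg x y
  obtain ⟨fyw, hyw⟩ := hg y w
  obtain ⟨fxw, hxw⟩ := hg x w
  obtain ⟨fyz, hyz⟩ := hg y z
  obtain ⟨fxz, hxz⟩ := hg x z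
  obtain ⟨q, hq, ⟨q₁, hq₁, h1⟩, q₂, hq₂, h2⟩ := hr.exists_near_both hxy hyw hxw
  have e := hxy.dist_add_dist hq
  have e1 := hxw.dist_add_dist hq₁
  have e2 := hyw.dist_add_dist hq₂
  obtain ⟨r, hr', h3⟩ := (hr x y z _ _ _ hxy hyz hxz).1 q hq
  have t1 := dist_triangle x q₁ q
  have t2 := dist_triangle q q₁ w
  have t3 := dist_triangle y q₂ q
  have t4 := dist_triangle q q₂ w
  have t5 := dist_triangle r q w
  rw [dist_comm q₁ q] at t1
  rw [dist_comm q₂ q] at t3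
  rw [dist_comm q y] at e
  rw [dist_comm r q] at t5
  rcases hr' with h | h
  · right
    have e3 := hyz.dist_add_dist h
    have t6 := dist_triangle y r w
    have t7 := dist_triangle z r w
    rw [dist_comm z r] at t7
    have := dist_triangle x q w
    linarith
  · left
    have e3 := hxz.dist_add_dist h
    have t6 := dist_triangle x r w
    have t7 := dist_triangle z r w
    rw [dist_comm z r] at t7
    linarith

theorem GeodesicSpace.exists_midpoint (hg : GeodesicSpace X) (x y : X) :
    ∃ m, dist x m = dist x y / 2 ∧ dist m y = dist x y / 2 := by
  obtain ⟨f, hf⟩ := hg x y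
  have hd : (0 : ℝ) ≤ dist x y := dist_nonneg
  have h1 := hf.2.2 0 ⟨le_rfl, hd⟩ (dist x y / 2) ⟨by linarith, by linarith⟩
  have h2 := hf.dist_add_dist (p := f (dist x y / 2)) ⟨_, ⟨by linarith, by linarith⟩, rfl⟩
  rw [hf.1, abs_of_nonpos (by linarith)] at h1
  exact ⟨f (dist x y / 2), by linarith, by linarith⟩

theorem GeodesicSpace.exists_chain (hg : GeodesicSpace X) (x y : X) :
    ∃ (L : ℕ) (f : ℕ → X), f 0 = x ∧ f L = y ∧ ∀ i < L, dist (f i) (f (i + 1)) ≤ 1 := by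
  obtain ⟨f, hf⟩ := hg x y
  have hd : (0 : ℝ) ≤ dist x y := dist_nonneg
  refine ⟨⌈dist x y⌉₊, fun i => f (min i (dist x y)), ?_, ?_, fun i _ => ?_⟩
  · simp [hf.1, hd]
  · simp only [min_eq_right (Nat.le_ceil (dist x y)), hf.2.1]
  · rw [hf.2.2 _ ⟨le_min (by positivity) hd, min_le_right _ _⟩ _
      ⟨le_min (by positivity) hd, min_le_right _ _⟩]
    refine (abs_min_sub_min_le_max _ _ _ _).trans ?_
    push_cast
    simp

end Rips

/-- The four-point condition with constant `δ`. -/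
def FourPoint (X : Type*) [MetricSpace X] (δ : ℝ) : Prop :=
  ∀ x y z w : X, dist x y + dist z w ≤ dist x z + dist y w + δ ∨
    dist x y + dist z w ≤ dist x w + dist y z + δ

theorem FourPoint.nonneg {X : Type*} [MetricSpace X] {δ : ℝ} (h : FourPoint X δ) (o : X) :
    0 ≤ δ := by
  have := h o o o o
  simp at this
  exact this

section Loxodromic

variable {G X : Type*} [Group G] [MetricSpace X] [MulAction G X] [IsIsometricSMul G X]

theorem dist_smul_smul_same (o : X) (a b : G) :
    dist (a • o) (b • o) = dist o ((a⁻¹ * b) • o) := by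
  rw [mul_smul, ← dist_smul a o, smul_inv_smul]

theorem dist_inv_smul_same (o : X) (a : G) : dist o (a⁻¹ • o) = dist o (a • o) := by
  rw [← dist_smul a, smul_inv_smul, dist_comm]

/-- If squares are not much longer than their roots, then multiplying on the left by a shorter
element does not increase the displacement. -/
theorem FourPoint.dist_mul_le {δ C : ℝ} (h4 : FourPoint X δ) (hC : 0 ≤ C) (o : X)
    (hsq : ∀ k : G, dist o ((k * k) • o) ≤ dist o (k • o) + C) {g h : G}
    (hgh : dist o (g • o) ≤ dist o (h • o)) :
    dist o ((g * h) • o) ≤ dist o (h • o) + (C + 4 * δ) := by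
  have hδ : 0 ≤ δ := h4.nonneg o
  by_contra! hlt
  have eg := hsq g
  have eh := hsq h
  have ek := hsq (g * h)
  have b1 : dist (g⁻¹ • o) (h • o) = dist o ((g * h) • o) := by
    rw [dist_smul_smul_same, inv_inv]
  have b2 : dist (g⁻¹ • o) (g • o) = dist o ((g * g) • o) := by
    rw [dist_smul_smul_same, inv_inv]
  have b3 : dist (h • o) (h⁻¹ • o) = dist o ((h * h) • o) := by
    rw [dist_comm, dist_smul_smul_same, inv_inv]
  have b4 : dist (g • o) ((g * h) • o) = dist o (h • o) := by
    rw [dist_smul_smul_same, inv_mul_cancel_left]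
  have b5 : dist (h⁻¹ • o) ((g * h)⁻¹ • o) = dist o (g • o) := by
    rw [dist_smul_smul_same, mul_inv_rev, inv_inv, mul_inv_cancel_left, dist_inv_smul_same]
  have b6 : dist ((g * h) • o) ((g * h)⁻¹ • o) = dist o ((g * h * (g * h)) • o) := by
    rw [dist_comm, dist_smul_smul_same, inv_inv]
  have c1 := dist_inv_smul_same o g
  have c2 := dist_inv_smul_same o h
  have c3 := dist_inv_smul_same o (g * h)
  have d1 := h4 (g⁻¹ • o) (h • o) o (g • o)
  have d2 := h4 (h • o) (g • o) o (h⁻¹ • o)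
  have d3 := h4 (g • o) (h⁻¹ • o) o ((g * h) • o)
  have d4 := h4 (h⁻¹ • o) ((g * h) • o) o ((g * h)⁻¹ • o)
  simp only [dist_comm _ o, b1, b2, b3, b4, b5, b6, c1, c2, c3] at d1 d2 d3 d4
  have f1 : dist o ((g * h) • o) ≤ dist (h • o) (g • o) + δ := by
    rcases d1 with d | d <;> linarith
  have f2 : dist o ((g * h) • o) ≤ dist (g • o) (h⁻¹ • o) + 2 * δ := by
    rcases d2 with d | d <;> linarith
  have f3 : dist (g • o) (h⁻¹ • o) + dist o ((g * h) • o) ≤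
      dist o (g • o) + dist (h⁻¹ • o) ((g * h) • o) + δ := by
    rcases d3 with d | d <;> linarith
  have f4 : dist (h⁻¹ • o) ((g * h) • o) ≤ dist o (h • o) + C + δ := by
    rcases d4 with d | d <;> linarith
  linarith

/-- If squares are not much longer than their roots, then short elements almost fix the midpoint
of a long orbit segment. -/
theorem FourPoint.dist_midpoint_le {δ C : ℝ} (h4 : FourPoint X δ) (hC : 0 ≤ C) (o : X)
    (hsq : ∀ k : G, dist o ((k * k) • o) ≤ dist o (k • o) + C) {g h : G}
    (hgh : 2 * dist o (g • o) ≤ dist o (h • o)) {x : X}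
    (h1 : dist o x = dist o (h • o) / 2) (h2 : dist x (h • o) = dist o (h • o) / 2) :
    dist x (g • x) ≤ 4 * (C + 4 * δ) + 2 * δ := by
  have hδ : 0 ≤ δ := h4.nonneg o
  have h0 : 0 ≤ dist o (g • o) := dist_nonneg
  have hh : 0 ≤ dist o (h • o) := dist_nonneg
  have k1 : dist o ((g * h) • o) ≤ dist o (h • o) + (C + 4 * δ) :=
    h4.dist_mul_le hC o hsq (by linarith)
  have k2 : dist (g • o) (h • o) ≤ dist o (h • o) + (C + 4 * δ) := by
    rw [dist_smul_smul_same]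
    exact h4.dist_mul_le hC o hsq (by rw [dist_inv_smul_same]; linarith)
  have k3 : dist (g • o) ((g * h) • o) = dist o (h • o) := by
    rw [dist_smul_smul_same, inv_mul_cancel_left]
  have k4 : dist (h • o) ((g * h) • o) ≤ dist o (h • o) + 3 * (C + 4 * δ) := by
    rw [dist_smul_smul_same]
    rcases le_total (dist o (h • o)) (dist o ((g * h) • o)) with hle | hle
    · have := h4.dist_mul_le hC o hsq (g := h⁻¹) (h := g * h) (by rwa [dist_inv_smul_same])
      linarith
    · have := h4.dist_mul_le hC o hsq (g := (g * h)⁻¹) (h := h) (by rwa [dist_inv_smul_same])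
      rw [← dist_inv_smul_same, show (h⁻¹ * (g * h))⁻¹ = (g * h)⁻¹ * h by group]
      linarith
  have m1 : dist (g • o) (g • x) = dist o (h • o) / 2 := by rw [dist_smul, h1]
  have m2 : dist (g • x) ((g * h) • o) = dist o (h • o) / 2 := by rw [mul_smul, dist_smul, h2]
  have d1 := h4 o (g • x) (g • o) ((g * h) • o)
  have d2 := h4 (h • o) (g • x) (g • o) ((g * h) • o)
  have d3 := h4 x (g • x) o (h • o)
  simp only [dist_comm x o, dist_comm (g • x) o, dist_comm (g • x) (h • o), h1, h2,
    dist_comm (g • x) (g • o), dist_comm (h • o) (g • o), m1, m2, k3] at d1 d2 d3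
  have f1 : dist o (g • x) ≤ dist o (h • o) / 2 + (C + 4 * δ) + δ := by
    rcases d1 with d | d <;> linarith
  have f2 : dist (h • o) (g • x) ≤ dist o (h • o) / 2 + 3 * (C + 4 * δ) + δ := by
    rcases d2 with d | d <;> linarith
  rcases d3 with d | d <;> linarith

/-- In an acylindrical action with unbounded orbits, some square is much longer than its root. -/
theorem FourPoint.exists_long_square {δ C : ℝ} (h4 : FourPoint X δ) (hg : GeodesicSpace X)
    (hac : AcylindricalWith (fun a b : X => dist a b) (fun (g : G) x => g • x)) (o : X)
    (hunb : ∀ r : ℝ, ∃ g : G, r ≤ dist o (g • o)) (hC : 0 ≤ C) :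
    ∃ g : G, dist o (g • o) + C ≤ dist o ((g * g) • o) := by
  by_contra! hsq
  have hsq' := fun k => (hsq k).le
  have hδ : 0 ≤ δ := h4.nonneg o
  obtain ⟨R, N, hR, hN⟩ := hac (4 * (C + 4 * δ) + 2 * δ + 1) (by linarith)
  have hinf : Infinite G := by
    by_contra hfin
    rw [not_infinite_iff_finite] at hfin
    obtain ⟨r, hr⟩ := (Set.finite_range fun g : G => dist o (g • o)).bddAbove
    obtain ⟨g, hg⟩ := hunb (r + 1)
    have := hr ⟨g, rfl⟩
    simp only at this
    linarith
  obtain ⟨F, hF⟩ := Infinite.exists_subset_card_eq G (N + 1)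
  obtain ⟨r, hr⟩ := (F.image fun g : G => dist o (g • o)).bddAbove
  have hr' : ∀ g ∈ F, dist o (g • o) ≤ r := fun g hg => hr (by
    simpa using ⟨g, hg, rfl⟩)
  obtain ⟨h, hh⟩ := hunb (2 * r)
  obtain ⟨h', hh'⟩ := hunb (2 * r + dist o (h • o) + 2 * R)
  obtain ⟨x, hx1, hx2⟩ := hg.exists_midpoint o (h • o)
  obtain ⟨y, hy1, hy2⟩ := hg.exists_midpoint o (h' • o)
  have hrnn : 0 ≤ r := by
    obtain ⟨g, hg⟩ := Finset.card_pos.1 (by omega : 0 < F.card)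
    exact dist_nonneg.trans (hr' g hg)
  have h0 : 0 ≤ dist o (h • o) := dist_nonneg
  obtain ⟨hfin, hcard⟩ := hN x y (by
    have := dist_triangle o x y
    simp only
    linarith)
  have hsub : (F : Set G) ⊆ {g : G | dist x (g • x) ≤ 4 * (C + 4 * δ) + 2 * δ + 1 ∧
      dist y (g • y) ≤ 4 * (C + 4 * δ) + 2 * δ + 1} := by
    intro g hgF
    have := hr' g hgF
    have e1 := h4.dist_midpoint_le hC o hsq' (g := g) (by linarith) hx1 hx2
    have e2 := h4.dist_midpoint_le hC o hsq' (g := g) (by linarith) hy1 hy2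
    exact ⟨by linarith, by linarith⟩
  have := Set.ncard_le_ncard hsub hfin
  rw [Set.ncard_coe_finset, hF] at this
  rw [Nat.card_coe_set_eq] at hcard
  exact absurd (this.trans hcard) (by omega)

end Loxodromic

/-- The orbit of `o` under `⟨g⟩` is a quasi-axis with constant `κ`, which is also a hyperbolicity
constant. -/
structure IsQuasiAxis {G X : Type*} [Group G] [MetricSpace X] [MulAction G X]
    (g : G) (o : X) (κ : ℝ) : Prop where
  one_le : 1 ≤ κ
  four : FourPoint X κ
  dist_le : ∀ i j : ℤ, dist (g ^ i • o) (g ^ j • o) ≤ κ * |(i : ℝ) - j|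
  dist_add : ∀ i j k : ℤ, i ≤ j → j ≤ k →
    dist (g ^ i • o) (g ^ j • o) + dist (g ^ j • o) (g ^ k • o) ≤
      dist (g ^ i • o) (g ^ k • o) + κ
  dist_sub_ge : ∀ i j k l : ℤ, |(i : ℝ) - j| ≤ |(k : ℝ) - l| →
    |(k : ℝ) - l| - |(i : ℝ) - j| ≤ dist (g ^ k • o) (g ^ l • o) - dist (g ^ i • o) (g ^ j • o)

section Loxodromic

variable {G X : Type*} [Group G] [MetricSpace X] [MulAction G X] [IsIsometricSMul G X]

theorem dist_zpow_smul (g : G) (o : X) (i j : ℤ) :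
    dist (g ^ i • o) (g ^ j • o) = dist o (g ^ (i - j).natAbs • o) := by
  rw [dist_smul_smul_same]
  rcases Int.natAbs_eq (i - j) with h | h
  · rw [← dist_inv_smul_same, ← zpow_natCast g, ← h]
    congr 2
    group
  · rw [← zpow_natCast g, show (((i - j).natAbs : ℕ) : ℤ) = j - i by omega]
    congr 2
    group

theorem dist_pow_smul_pow_smul (g : G) (o : X) (m n : ℕ) :
    dist (g ^ m • o) (g ^ (m + n) • o) = dist o (g ^ n • o) := by
  rw [pow_add, mul_smul, dist_smul]

theorem FourPoint.dist_pow_step {δ s : ℝ} (h4 : FourPoint X δ) {g : G} {o : X} (hs : 0 < s)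
    (h : dist o (g • o) + (δ + s) ≤ dist o ((g * g) • o)) (n : ℕ) :
    dist o (g ^ n • o) + s ≤ dist o (g ^ (n + 1) • o) := by
  have hδ : 0 ≤ δ := h4.nonneg o
  have h2 : dist o (g • o) + (δ + s) ≤ dist o (g ^ 2 • o) := by rwa [pow_two]
  induction n with
  | zero =>
    have t := dist_triangle o (g ^ 1 • o) (g ^ 2 • o)
    rw [dist_pow_smul_pow_smul g o 1 1, pow_one] at t
    simp
    linarith
  | succ n ih =>
    rcases Nat.eq_zero_or_pos n with rfl | hn
    · simp only [zero_add, pow_one]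
      norm_num
      linarith
    obtain ⟨n, rfl⟩ : ∃ m, n = m + 1 := ⟨n - 1, by omega⟩
    have d := h4 o (g ^ 2 • o) (g ^ 1 • o) (g ^ (n + 1 + 1 + 1) • o)
    have e1 : dist (g ^ 1 • o) (g ^ (n + 1 + 1 + 1) • o) = dist o (g ^ (n + 1 + 1) • o) := by
      rw [← dist_pow_smul_pow_smul g o 1 (n + 1 + 1)]; congr 3; ring
    have e2 : dist (g ^ 2 • o) (g ^ (n + 1 + 1 + 1) • o) = dist o (g ^ (n + 1) • o) := by
      rw [← dist_pow_smul_pow_smul g o 2 (n + 1)]; congr 3; ring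
    have e3 : dist (g ^ 2 • o) (g ^ 1 • o) = dist o (g • o) := by
      rw [dist_comm, dist_pow_smul_pow_smul g o 1 1, pow_one]
    rw [e1, e2, e3, pow_one] at d
    rcases d with d | d <;> linarith

theorem FourPoint.exists_isQuasiAxis {δ : ℝ} (h4 : FourPoint X δ) {g : G} {o : X}
    (h : dist o (g • o) + (2 * δ + 1) ≤ dist o ((g * g) • o)) : ∃ κ, IsQuasiAxis g o κ := by
  have hδ : 0 ≤ δ := h4.nonneg o
  have hl : 0 ≤ dist o (g • o) := dist_nonneg
  have step := fun n => h4.dist_pow_step (g := g) (o := o) (s := δ + 1) (by linarith)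
    (by linarith) n
  have hup : ∀ n : ℕ, dist o (g ^ n • o) ≤ dist o (g • o) * n := by
    intro n
    induction n with
    | zero => simp
    | succ n ih =>
      have := dist_triangle o (g ^ n • o) (g ^ (n + 1) • o)
      rw [dist_pow_smul_pow_smul g o n 1, pow_one] at this
      push_cast
      linarith
  have hrate : ∀ m n : ℕ, dist o (g ^ m • o) + n ≤ dist o (g ^ (m + n) • o) := by
    intro m n
    induction n with
    | zero => simp
    | succ n ih =>
      have := step (m + n)
      rw [← add_assoc]
      push_cast
      linarith
  have hadd : ∀ m n : ℕ, dist o (g ^ m • o) + dist o (g ^ n • o) ≤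
      dist o (g ^ (m + n) • o) + (dist o (g • o) + δ) := by
    intro m n
    rcases n with _ | n
    · simp; linarith
    have d := h4 o (g ^ (m + 1) • o) (g ^ m • o) (g ^ (m + (n + 1)) • o)
    have e1 : dist (g ^ (m + 1) • o) (g ^ (m + (n + 1)) • o) = dist o (g ^ n • o) := by
      rw [← dist_pow_smul_pow_smul g o (m + 1) n]; congr 3; ring
    rw [dist_pow_smul_pow_smul, e1, dist_comm (g ^ (m + 1) • o), dist_pow_smul_pow_smul,
      pow_one] at d
    have := step m
    have := step n
    rcases d with d | d <;> linarith
  have hcast : ∀ i j : ℤ, |(i : ℝ) - j| = ((i - j).natAbs : ℕ) := by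
    intro i j
    rw [Nat.cast_natAbs]; push_cast; rfl
  refine ⟨dist o (g • o) + δ + 1, by linarith, ?_, ?_, ?_, ?_⟩
  · intro x y z w
    rcases h4 x y z w with h | h
    · left; linarith
    · right; linarith
  · intro i j
    rw [dist_zpow_smul, hcast]
    refine (hup _).trans (mul_le_mul_of_nonneg_right (by linarith) (by positivity))
  · intro i j k hij hjk
    rw [dist_zpow_smul, dist_zpow_smul, dist_zpow_smul,
      show (i - k).natAbs = (i - j).natAbs + (j - k).natAbs by omega]
    have := hadd (i - j).natAbs (j - k).natAbs
    linarith
  · intro i j k l hle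
    rw [hcast, hcast] at hle ⊢
    rw [dist_zpow_smul, dist_zpow_smul]
    have hle' : (i - j).natAbs ≤ (k - l).natAbs := by exact_mod_cast hle
    obtain ⟨n, hn⟩ := Nat.exists_eq_add_of_le hle'
    have := hrate (i - j).natAbs n
    rw [hn]
    push_cast
    linarith

end Loxodromic

/-- A quasi-axis with a coarse nearest-point projection `b` to it. -/
structure IsProjAxis {G X : Type*} [Group G] [MetricSpace X] [MulAction G X]
    (g : G) (o : X) (κ : ℝ) (b : X → ℤ) : Prop extends IsQuasiAxis g o κ where
  near : ∀ p (m : ℤ), dist p (g ^ b p • o) ≤ dist p (g ^ m • o) + 1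
  proj : ∀ p (m : ℤ), dist p (g ^ b p • o) + dist (g ^ b p • o) (g ^ m • o) ≤
    dist p (g ^ m • o) + κ

section Projection

variable {G X : Type*} [Group G] [MetricSpace X] [MulAction G X]

theorem IsQuasiAxis.mono {g : G} {o : X} {κ κ' : ℝ} (h : IsQuasiAxis g o κ) (hle : κ ≤ κ') :
    IsQuasiAxis g o κ' where
  one_le := h.one_le.trans hle
  four x y z w := by
    rcases h.four x y z w with d | d
    · left; linarith
    · right; linarith
  dist_le i j := (h.dist_le i j).trans (by gcongr)
  dist_add i j k h1 h2 := (h.dist_add i j k h1 h2).trans (by linarith)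
  dist_sub_ge := h.dist_sub_ge

theorem IsQuasiAxis.dist_ge {g : G} {o : X} {κ : ℝ} (h : IsQuasiAxis g o κ) (i j : ℤ) :
    |(i : ℝ) - j| ≤ dist (g ^ i • o) (g ^ j • o) := by
  have := h.dist_sub_ge i i i j (by simp)
  simpa using this

theorem IsQuasiAxis.exists_isProjAxis {g : G} {o : X} {κ : ℝ} (h : IsQuasiAxis g o κ) :
    ∃ κ' b, IsProjAxis g o κ' b := by
  have hκ := h.one_le
  have hex : ∀ p, ∃ n : ℤ, ∀ m : ℤ, dist p (g ^ n • o) ≤ dist p (g ^ m • o) + 1 := by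
    intro p
    have hb : BddBelow (Set.range fun n : ℤ => dist p (g ^ n • o)) :=
      ⟨0, by rintro _ ⟨n, rfl⟩; exact dist_nonneg⟩
    obtain ⟨n, hn⟩ := exists_lt_of_ciInf_lt
      (lt_add_one (⨅ n : ℤ, dist p (g ^ n • o)))
    exact ⟨n, fun m => by linarith [ciInf_le hb m]⟩
  choose b hb using hex
  set T : ℤ := ⌈1 + 2 * κ⌉ + 1 with hT
  have hT1 : 1 + 2 * κ < T := by
    rw [hT]; push_cast; linarith [Int.le_ceil (1 + 2 * κ)]
  have hT0 : 0 < T := by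
    have : (0 : ℝ) < T := by linarith
    exact_mod_cast this
  have hκT : 0 ≤ κ * T := by positivity
  refine ⟨κ * T + 1 + 2 * κ, b, h.mono (by linarith), hb, fun p m => ?_⟩
  by_cases hm : |b p - m| < T
  · have h1 : |((b p : ℤ) : ℝ) - m| ≤ T := by exact_mod_cast hm.le
    have h2 := h.dist_le (b p) m
    have h3 : κ * |((b p : ℤ) : ℝ) - m| ≤ κ * T := by gcongr
    have h4 := hb p m
    linarith
  · obtain ⟨i, hi, hadd⟩ : ∃ i : ℤ, |b p - i| = T ∧
        dist (g ^ b p • o) (g ^ i • o) + dist (g ^ i • o) (g ^ m • o) ≤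
          dist (g ^ b p • o) (g ^ m • o) + κ := by
      rcases le_total (b p) m with hle | hle
      · rw [abs_of_nonpos (by omega)] at hm
        refine ⟨b p + T, ?_, h.dist_add _ _ _ (by omega) (by omega)⟩
        rw [abs_of_nonpos (by omega)]; omega
      · rw [abs_of_nonneg (by omega)] at hm
        refine ⟨b p - T, ?_, ?_⟩
        · rw [abs_of_nonneg (by omega)]; omega
        · have := h.dist_add m (b p - T) (b p) (by omega) (by omega)
          rw [dist_comm (g ^ b p • o), dist_comm (g ^ b p • o), dist_comm _ (g ^ m • o)]
          linarith
    have hi' : |((b p : ℤ) : ℝ) - i| = T := by exact_mod_cast hi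
    have h2 := h.dist_le (b p) i
    have h3 := h.dist_ge (b p) i
    rw [hi'] at h2 h3
    have h4 := hb p i
    have h5 := dist_triangle (g ^ b p • o) (g ^ i • o) (g ^ m • o)
    rcases h.four p (g ^ i • o) (g ^ b p • o) (g ^ m • o) with d | d
    · linarith
    · rw [dist_comm (g ^ i • o) (g ^ b p • o)] at d
      linarith

end Projection

namespace IsProjAxis

variable {G X : Type*} [Group G] [MetricSpace X] [MulAction G X] {g : G} {o : X} {κ : ℝ}
  {b : X → ℤ} (h : IsProjAxis g o κ b)
include h

theorem contract (p q : X) : dist (g ^ b p • o) (g ^ b q • o) ≤ 2 * κ ∨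
    dist p (g ^ b p • o) + dist (g ^ b p • o) (g ^ b q • o) + dist q (g ^ b q • o) ≤
      dist p q + 3 * κ := by
  have h1 := h.proj p (b q)
  have h2 := h.proj q (b p)
  have h3 := h.one_le
  rw [dist_comm (g ^ b q • o) (g ^ b p • o)] at h2
  rcases h.four p (g ^ b q • o) q (g ^ b p • o) with d | d
  · right
    rw [dist_comm (g ^ b q • o) (g ^ b p • o)] at d
    linarith
  · left
    rw [dist_comm (g ^ b q • o) q] at d
    linarith

theorem lipschitz (p q : X) : |(b p : ℝ) - b q| ≤ dist p q + 3 * κ := by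
  have h1 := h.dist_ge (b p) (b q)
  have h3 := h.one_le
  have : 0 ≤ dist p q := dist_nonneg
  have : 0 ≤ dist p (g ^ b p • o) := dist_nonneg
  have : 0 ≤ dist q (g ^ b q • o) := dist_nonneg
  rcases h.contract p q with d | d <;> linarith

/-- Almost nearest points have almost the same index. -/
theorem index_near {p : X} {m : ℤ} {r : ℝ}
    (hm : ∀ i : ℤ, dist p (g ^ m • o) ≤ dist p (g ^ i • o) + r) : |(b p : ℝ) - m| ≤ κ + r := by
  have h1 := h.dist_ge (b p) m
  have h2 := h.proj p m
  have h3 := hm (b p)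
  linarith

/-- Points almost between two points of the quasi-axis are close to it. -/
theorem dist_of_between {x : X} {i j : ℤ} {r : ℝ}
    (hx : dist x (g ^ i • o) + dist x (g ^ j • o) ≤ dist (g ^ i • o) (g ^ j • o) + 2 * r) :
    dist x (g ^ b x • o) ≤ r + κ := by
  have h1 := h.proj x i
  have h2 := h.proj x j
  have h3 := dist_triangle (g ^ i • o) (g ^ b x • o) (g ^ j • o)
  rw [dist_comm (g ^ i • o) (g ^ b x • o)] at h3
  linarith

theorem shift [IsIsometricSMul G X] (k : ℤ) (p : X) :
    |(b (g ^ k • p) : ℝ) - (b p + k : ℤ)| ≤ κ + 1 := by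
  refine h.index_near fun i => ?_
  have h1 := h.near p (i - k)
  have e1 : dist (g ^ k • p) (g ^ (b p + k) • o) = dist p (g ^ b p • o) := by
    rw [add_comm, zpow_add, mul_smul, dist_smul]
  have e2 : dist (g ^ k • p) (g ^ i • o) = dist p (g ^ (i - k) • o) := by
    rw [show i = k + (i - k) by ring, zpow_add, mul_smul, dist_smul]
    simp
  rw [e1, e2]
  exact h1

theorem b_o : |(b o : ℝ)| ≤ 1 := by
  have h1 := h.near o 0
  have h2 := h.dist_ge 0 (b o)
  simp at h1 h2
  linarith

end IsProjAxis

/-- The group of elements conjugating some nontrivial power of `g` to itself or its inverse. -/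
def elemClosure {G : Type*} [Group G] (g : G) : Subgroup G where
  carrier := {u | ∃ n σ : ℤ, n ≠ 0 ∧ (σ = 1 ∨ σ = -1) ∧ SemiconjBy u (g ^ n) (g ^ (σ * n))}
  one_mem' := ⟨1, 1, one_ne_zero, Or.inl rfl, by simp⟩
  mul_mem' := by
    rintro u v ⟨n, σ, hn, hσ, hu⟩ ⟨m, τ, hm, hτ, hv⟩
    refine ⟨m * n, σ * τ, mul_ne_zero hm hn, by
      rcases hσ with rfl | rfl <;> rcases hτ with rfl | rfl <;> simp, ?_⟩
    have h1 := hu.zpow_right (τ * m)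
    have h2 := hv.zpow_right n
    rw [← zpow_mul, ← zpow_mul] at h1 h2
    rw [show n * (τ * m) = τ * m * n by ring] at h1
    rw [show σ * τ * (m * n) = σ * n * (τ * m) by ring]
    exact h1.mul_left h2
  inv_mem' := by
    rintro u ⟨n, σ, hn, hσ, hu⟩
    refine ⟨σ * n, σ, by rcases hσ with rfl | rfl <;> simpa using hn, hσ, ?_⟩
    rw [← mul_assoc, show σ * σ * n = n by rcases hσ with rfl | rfl <;> simp]
    exact hu.inv_symm_left

namespace IsProjAxis

variable {G X : Type*} [Group G] [MetricSpace X] [MulAction G X] [IsIsometricSMul G X] {g : G}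
  {o : X} {κ : ℝ} {b : X → ℤ} (h : IsProjAxis g o κ b)
include h

theorem fellow {u : G} {i j k : ℤ} (hlt : 2 * κ < |(b (u • g ^ i • o) : ℝ) - b (u • g ^ j • o)|)
    (h1 : b (u • g ^ i • o) ≤ k) (h2 : k ≤ b (u • g ^ j • o)) :
    dist (g ^ k • o) (u • g ^ b (u⁻¹ • g ^ k • o) • o) ≤ 3 * κ := by
  have d1 := h.dist_ge (b (u • g ^ i • o)) (b (u • g ^ j • o))
  have d2 := h.dist_add _ _ _ h1 h2
  rcases h.contract (u • g ^ i • o) (u • g ^ j • o) with d | d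
  · linarith
  rw [dist_smul] at d
  rw [← dist_smul u⁻¹, inv_smul_smul]
  have := h.dist_of_between (x := u⁻¹ • g ^ k • o) (i := i) (j := j) (r := 2 * κ) (by
    rw [← dist_smul u, ← dist_smul u (u⁻¹ • g ^ k • o), smul_inv_smul]
    have t1 := dist_triangle_right (g ^ k • o) (u • g ^ i • o) (g ^ b (u • g ^ i • o) • o)
    have t2 := dist_triangle_right (g ^ k • o) (u • g ^ j • o) (g ^ b (u • g ^ j • o) • o)
    rw [dist_comm (g ^ k • o) (g ^ b (u • g ^ i • o) • o)] at t1
    linarith)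
  linarith

theorem abs_sub_abs_le {u : G} {k k' s s' : ℤ} {r : ℝ} (h1 : dist (g ^ k • o) (u • g ^ s • o) ≤ r)
    (h2 : dist (g ^ k' • o) (u • g ^ s' • o) ≤ r) :
    |(|(s : ℝ) - s'| - |(k : ℝ) - k'|)| ≤ 2 * r := by
  have t1 := dist_triangle4 (g ^ k • o) (u • g ^ s • o) (u • g ^ s' • o) (g ^ k' • o)
  have t2 := dist_triangle4 (u • g ^ s • o) (g ^ k • o) (g ^ k' • o) (u • g ^ s' • o)
  rw [dist_comm (u • g ^ s' • o)] at t1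
  rw [dist_comm _ (g ^ k • o)] at t2
  rw [dist_smul] at t1 t2
  rcases le_total |(s : ℝ) - s'| |(k : ℝ) - k'| with hle | hle
  · have := h.dist_sub_ge _ _ _ _ hle
    rw [abs_of_nonpos (by linarith)]
    linarith
  · have := h.dist_sub_ge _ _ _ _ hle
    rw [abs_of_nonneg (by linarith)]
    linarith

theorem fellow_linear {u : G} {i j : ℤ}
    (hlt : 2 * κ < |(b (u • g ^ i • o) : ℝ) - b (u • g ^ j • o)|)
    (hle : b (u • g ^ i • o) ≤ b (u • g ^ j • o)) :
    ∃ s σ : ℤ, (σ = 1 ∨ σ = -1) ∧ ∀ x : ℤ, 0 ≤ x → b (u • g ^ i • o) + x ≤ b (u • g ^ j • o) →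
      dist (g ^ (b (u • g ^ i • o) + x) • o) (u • g ^ (s + σ * x) • o) ≤ 3 * κ + κ * (24 * κ) := by
  have hκ := h.one_le
  set m := b (u • g ^ i • o) with hm
  set m' := b (u • g ^ j • o) with hm'
  set φ : ℤ → ℤ := fun k => b (u⁻¹ • g ^ k • o) with hφ
  have hf : ∀ k, m ≤ k → k ≤ m' → dist (g ^ k • o) (u • g ^ φ k • o) ≤ 3 * κ :=
    fun k h1 h2 => h.fellow hlt h1 h2
  have hd : ∀ k k', m ≤ k → k ≤ m' → m ≤ k' → k' ≤ m' →
      |(|(φ k : ℝ) - φ k'| - |(k : ℝ) - k'|)| ≤ 6 * κ := by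
    intro k k' h1 h2 h3 h4
    have := h.abs_sub_abs_le (hf k h1 h2) (hf k' h3 h4)
    linarith
  suffices hs : ∃ σ : ℤ, (σ = 1 ∨ σ = -1) ∧ ∀ x : ℤ, 0 ≤ x → m + x ≤ m' →
      |(φ (m + x) : ℝ) - (φ m + σ * x : ℤ)| ≤ 24 * κ by
    obtain ⟨σ, hσ, hs⟩ := hs
    refine ⟨φ m, σ, hσ, fun x h1 h2 => ?_⟩
    have d1 := hf (m + x) (by omega) h2
    have d2 := h.dist_le (φ (m + x)) (φ m + σ * x)
    have d3 := dist_triangle (g ^ (m + x) • o) (u • g ^ φ (m + x) • o)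
      (u • g ^ (φ m + σ * x) • o)
    have d4 : κ * |(φ (m + x) : ℝ) - (φ m + σ * x : ℤ)| ≤ κ * (24 * κ) :=
      mul_le_mul_of_nonneg_left (hs x h1 h2) (by linarith)
    rw [dist_smul] at d3
    linarith
  have key : ∀ x : ℤ, 0 ≤ x → m + x ≤ m' → (0 ≤ (φ m' : ℝ) - φ m →
      |(φ (m + x) : ℝ) - φ m - x| ≤ 24 * κ) ∧ ((φ m' : ℝ) - φ m ≤ 0 →
      |(φ (m + x) : ℝ) - φ m + x| ≤ 24 * κ) := by
    intro x h1 h2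
    have h1' : (0 : ℝ) ≤ x := by exact_mod_cast h1
    have h2' : (m : ℝ) + x ≤ m' := by exact_mod_cast h2
    have e1 := hd (m + x) m (by omega) h2 le_rfl hle
    have e2 := hd m' (m + x) hle le_rfl (by omega) h2
    have e3 := hd m' m hle le_rfl le_rfl hle
    push_cast at e1 e2
    rw [abs_le] at e1 e2 e3
    rw [abs_of_nonneg (a := (m : ℝ) + x - m) (by linarith)] at e1
    rw [abs_of_nonneg (a := (m' : ℝ) - (m + x)) (by linarith)] at e2
    rw [abs_of_nonneg (a := (m' : ℝ) - m) (by linarith)] at e3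
    constructor
    · intro h0
      rw [abs_of_nonneg h0] at e3
      rw [abs_le]
      rcases abs_cases ((φ (m + x) : ℝ) - φ m) with ⟨c1, -⟩ | ⟨c1, -⟩ <;>
      rcases abs_cases ((φ m' : ℝ) - φ (m + x)) with ⟨c2, -⟩ | ⟨c2, -⟩ <;>
      rw [c1] at e1 <;> rw [c2] at e2 <;> constructor <;> linarith
    · intro h0
      rw [abs_of_nonpos h0] at e3
      rw [abs_le]
      rcases abs_cases ((φ (m + x) : ℝ) - φ m) with ⟨c1, -⟩ | ⟨c1, -⟩ <;>
      rcases abs_cases ((φ m' : ℝ) - φ (m + x)) with ⟨c2, -⟩ | ⟨c2, -⟩ <;>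
      rw [c1] at e1 <;> rw [c2] at e2 <;> constructor <;> linarith
  rcases le_total 0 ((φ m' : ℝ) - φ m) with h0 | h0
  · refine ⟨1, Or.inl rfl, fun x h1 h2 => ?_⟩
    convert (key x h1 h2).1 h0 using 2
    push_cast; ring
  · refine ⟨-1, Or.inr rfl, fun x h1 h2 => ?_⟩
    convert (key x h1 h2).2 h0 using 2
    push_cast; ring

theorem exists_proj_bound
    (hac : AcylindricalWith (fun a b : X => dist a b) (fun (g : G) x => g • x)) :
    ∃ Θ : ℝ, 0 ≤ Θ ∧ ∀ u ∉ elemClosure g, ∀ i j : ℤ,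
      |(b (u • g ^ i • o) : ℝ) - b (u • g ^ j • o)| ≤ Θ := by
  have hκ := h.one_le
  set ε := 3 * κ + κ * (24 * κ) with hε
  have hεpos : 0 < ε := by positivity
  obtain ⟨R, N, hR, hN⟩ := hac (2 * ε) (by linarith)
  refine ⟨⌈R⌉₊ + N + 2 * κ, by positivity, fun u hu i j => ?_⟩
  wlog hle : b (u • g ^ i • o) ≤ b (u • g ^ j • o) generalizing i j
  · rw [abs_sub_comm]
    exact this j i (by omega)
  by_contra! hlt
  have hRN : (0 : ℝ) ≤ ⌈R⌉₊ + N := by positivity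
  obtain ⟨s, σ, hσ, hx⟩ := h.fellow_linear (u := u) (i := i) (j := j) (by linarith) hle
  set m := b (u • g ^ i • o)
  set m' := b (u • g ^ j • o)
  have hL : m + (⌈R⌉₊ + N : ℤ) ≤ m' := by
    rw [abs_of_nonpos (sub_nonpos.2 (by exact_mod_cast hle))] at hlt
    have : (m : ℝ) + (⌈R⌉₊ + N) ≤ m' := by linarith
    exact_mod_cast this
  set y : ℕ → G := fun k => g ^ (-(k : ℤ)) * u * g ^ (σ * k) * u⁻¹ with hy
  have hmove : ∀ x : ℤ, ∀ k : ℕ, 0 ≤ x → m + x + k ≤ m' →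
      dist (g ^ (m + x) • o) (y k • g ^ (m + x) • o) ≤ 2 * ε := by
    intro x k h0 h1
    have d1 := hx x h0 (by omega)
    have d2 := hx (x + k) (by omega) (by omega)
    have e1 : dist (y k • g ^ (m + x) • o) (y k • u • g ^ (s + σ * x) • o) ≤ ε := by
      rwa [dist_smul]
    have e2 : y k • u • g ^ (s + σ * x) • o =
        g ^ (-(k : ℤ)) • u • g ^ (s + σ * (x + k)) • o := by
      simp only [hy, ← mul_smul]
      congr 1
      rw [show s + σ * (x + k) = σ * k + (s + σ * x) by ring, zpow_add]
      group
    have e3 : g ^ (m + x) • o = g ^ (-(k : ℤ)) • g ^ (m + (x + k)) • o := by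
      rw [← mul_smul, ← zpow_add]; congr 2; ring
    have t := dist_triangle (g ^ (m + x) • o) (y k • u • g ^ (s + σ * x) • o)
      (y k • g ^ (m + x) • o)
    rw [dist_comm (y k • u • g ^ (s + σ * x) • o)] at t
    have e4 : dist (g ^ (m + x) • o) (y k • u • g ^ (s + σ * x) • o) ≤ ε := by
      rw [e2]; nth_rewrite 1 [e3]; rwa [dist_smul]
    linarith
  obtain ⟨hfin, hcard⟩ := hN (g ^ m • o) (g ^ (m + ⌈R⌉₊) • o) (by
    have := h.dist_ge m (m + ⌈R⌉₊)
    push_cast at this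
    rw [abs_of_nonpos (by simp)] at this
    have := Nat.le_ceil R
    simp only
    linarith)
  rw [Nat.card_coe_set_eq] at hcard
  have hnot : ¬ Set.InjOn y (Finset.range (N + 1) : Set ℕ) := by
    intro hinj
    have h1 := Set.ncard_le_ncard (s := y '' (Finset.range (N + 1) : Set ℕ)) (by
      rintro _ ⟨k, hk, rfl⟩
      have hk' : k ≤ N := by simpa [Nat.lt_succ_iff] using hk
      have h1 := hmove 0 k le_rfl (by omega)
      have h2 := hmove ⌈R⌉₊ k (by omega) (by omega)
      rw [add_zero] at h1
      exact ⟨h1, h2⟩) hfin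
    rw [hinj.ncard_image, Set.ncard_coe_finset, Finset.card_range] at h1
    exact absurd (h1.trans hcard) (by omega)
  simp only [Set.InjOn, not_forall] at hnot
  obtain ⟨k, -, k', -, hkk, hne⟩ := hnot
  refine hu ⟨σ * (k' - k), σ, ?_, hσ, ?_⟩
  · rcases hσ with rfl | rfl <;> omega
  · rw [show σ * (σ * ((k' : ℤ) - k)) = k' - k by rcases hσ with rfl | rfl <;> ring]
    have e := mul_right_cancel hkk
    show u * g ^ (σ * ((k' : ℤ) - k)) = g ^ ((k' : ℤ) - k) * u
    rw [show σ * ((k' : ℤ) - k) = σ * k' + -(σ * k) by ring, zpow_add, zpow_neg, sub_eq_add_neg,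
      zpow_add]
    rw [mul_assoc, mul_assoc] at e
    have e' : u * g ^ (σ * (k' : ℤ)) = g ^ (k' : ℤ) * (g ^ (-(k : ℤ)) * (u * g ^ (σ * (k : ℤ)))) := by
      rw [e, zpow_neg, mul_inv_cancel_left]
    rw [← mul_assoc, e']
    group

end IsProjAxis

theorem near_of_abs_le {c x y : ℤ} {r : ℝ} (h : |(x : ℝ) - y| ≤ r) (hr : r ≤ c) : Near c x y := by
  have : |(x : ℝ) - y| ≤ c := h.trans hr
  have : |x - y| ≤ c := by exact_mod_cast this
  rw [abs_le] at this
  omega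

theorem abs_le_of_near {c x y : ℤ} (h : Near c x y) : |(x : ℝ) - y| ≤ c := by
  have : |x - y| ≤ c := by rw [abs_le]; omega
  exact_mod_cast this

theorem abs_sub_le_add {x y z r s : ℝ} (h1 : |x - y| ≤ r) (h2 : |y - z| ≤ s) :
    |x - z| ≤ r + s :=
  (abs_sub_le x y z).trans (add_le_add h1 h2)

namespace IsProjAxis

variable {G X : Type*} [Group G] [MetricSpace X] [MulAction G X] [IsIsometricSMul G X] {g : G}
  {o : X} {κ : ℝ} {b : X → ℤ} (h : IsProjAxis g o κ b)
include h

theorem dist_axis_elem {e : G} (he : e ∈ elemClosure g) (k : ℤ) :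
    dist (g ^ k • o) (e • g ^ b (e⁻¹ • g ^ k • o) • o) ≤ 3 * κ := by
  have hκ := h.one_le
  obtain ⟨n, σ, hn, hσ, hs⟩ := he
  have hD : 0 ≤ dist (e • o) o := dist_nonneg
  have hb : ∀ j : ℤ, |(b (e • g ^ (n * j) • o) : ℝ) - (σ * n * j : ℤ)| ≤ dist (e • o) o + κ := by
    intro j
    have h1 := h.proj (e • g ^ (n * j) • o) (σ * n * j)
    have h2 := h.dist_ge (b (e • g ^ (n * j) • o)) (σ * n * j)
    have h3 : e • g ^ (n * j) • o = g ^ (σ * n * j) • e • o := by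
      have := (hs.zpow_right j).eq
      rw [← zpow_mul, ← zpow_mul] at this
      rw [← mul_smul, this, mul_smul]
    have h4 : dist (e • g ^ (n * j) • o) (g ^ (σ * n * j) • o) = dist (e • o) o := by
      rw [h3, dist_smul]
    have h5 : 0 ≤ dist (e • g ^ (n * j) • o) (g ^ b (e • g ^ (n * j) • o) • o) := dist_nonneg
    linarith
  set T : ℤ := ⌈|(k : ℝ)| + dist (e • o) o + 3 * κ⌉ with hT
  have hT1 := Int.le_ceil (|(k : ℝ)| + dist (e • o) o + 3 * κ)
  rw [← hT] at hT1
  have hT0 : (0 : ℝ) ≤ T := by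
    have := abs_nonneg (k : ℝ)
    linarith
  have hnn : (1 : ℝ) ≤ n * n := by
    have : (1 : ℤ) ≤ n * n := by
      have := mul_self_pos.2 hn
      omega
    exact_mod_cast this
  have hσσ : (σ : ℝ) * σ = 1 := by rcases hσ with rfl | rfl <;> simp
  have hbig : (T : ℝ) ≤ n * n * T := by nlinarith
  have hplus := hb (n * σ * T)
  have hminus := hb (-(n * σ * T))
  have e1 : ((σ * n * (n * σ * T) : ℤ) : ℝ) = n * n * T := by
    push_cast
    linear_combination (n * n * T : ℝ) * hσσ
  have e2 : ((σ * n * (-(n * σ * T)) : ℤ) : ℝ) = -(n * n * T) := by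
    push_cast
    linear_combination (-(n * n * T) : ℝ) * hσσ
  rw [e1, abs_le] at hplus
  rw [e2, abs_le] at hminus
  have hk := abs_le.1 (le_refl |(k : ℝ)|)
  have hk0 := abs_nonneg (k : ℝ)
  refine h.fellow (i := n * -(n * σ * T)) (j := n * (n * σ * T)) ?_ ?_ ?_
  · rw [abs_of_nonpos (by linarith)]
    linarith
  · have : (b (e • g ^ (n * -(n * σ * T)) • o) : ℝ) ≤ k := by linarith
    exact_mod_cast this
  · have : (k : ℝ) ≤ b (e • g ^ (n * (n * σ * T)) • o) := by linarith
    exact_mod_cast this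

theorem dist_elem_axis {e : G} (he : e ∈ elemClosure g) (k : ℤ) :
    dist (e • g ^ k • o) (g ^ b (e • g ^ k • o) • o) ≤ 3 * κ := by
  have := h.dist_axis_elem (inv_mem he) k
  rwa [inv_inv, dist_comm, dist_comm, ← dist_smul e, smul_inv_smul] at this

theorem b_elem_near {e : G} (he : e ∈ elemClosure g) (p : X) :
    |(b (e • p) : ℝ) - b (e • g ^ b p • o)| ≤ 8 * κ := by
  have hκ := h.one_le
  have := h.index_near (p := e • p) (m := b (e • g ^ b p • o)) (r := 6 * κ + 1) fun i => by
    have h1 := h.dist_axis_elem he i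
    have h2 := h.dist_elem_axis he (b p)
    have h3 := h.near p (b (e⁻¹ • g ^ i • o))
    rw [← dist_smul e, ← dist_smul e p] at h3
    have t1 := dist_triangle (e • p) (e • g ^ b p • o) (g ^ b (e • g ^ b p • o) • o)
    have t2 := dist_triangle (e • p) (g ^ i • o) (e • g ^ b (e⁻¹ • g ^ i • o) • o)
    linarith
  linarith

theorem abs_b_elem_sub {e : G} (he : e ∈ elemClosure g) (i j : ℤ) :
    |(|(b (e • g ^ i • o) : ℝ) - b (e • g ^ j • o)| - |(i : ℝ) - j|)| ≤ 6 * κ := by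
  have h1 := h.dist_axis_elem (inv_mem he) i
  have h2 := h.dist_axis_elem (inv_mem he) j
  rw [inv_inv] at h1 h2
  have := h.abs_sub_abs_le h1 h2
  linarith

theorem elem_le {e : G} (he : e ∈ elemClosure g) (p q : X) :
    |(b (e • p) : ℝ) - b (e • q)| ≤ |(b p : ℝ) - b q| + 22 * κ := by
  have h1 := h.b_elem_near he p
  have h2 := h.b_elem_near he q
  rw [abs_sub_comm] at h2
  have h3 := abs_le.1 (h.abs_b_elem_sub he (b p) (b q))
  have h4 := abs_sub_le_add h1 (abs_sub_le_add le_rfl h2)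
  linarith

theorem dist_axis_near {e : G} (he : e ∈ elemClosure g) {k : ℤ} {r : ℝ}
    (hk : |(b (e • g ^ k • o) : ℝ) - k| ≤ r) :
    dist (g ^ k • o) (e • g ^ k • o) ≤ 3 * κ + κ * r := by
  have hκ := h.one_le
  have h1 := h.dist_elem_axis he k
  have h2 := h.dist_le (b (e • g ^ k • o)) k
  have h3 := dist_triangle (e • g ^ k • o) (g ^ b (e • g ^ k • o) • o) (g ^ k • o)
  have h4 : κ * |(b (e • g ^ k • o) : ℝ) - k| ≤ κ * r :=
    mul_le_mul_of_nonneg_left hk (by linarith)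
  rw [dist_comm]
  linarith

theorem proj_elem {Θ : ℝ}
    (hΘ : ∀ u ∉ elemClosure g, ∀ i j : ℤ, |(b (u • g ^ i • o) : ℝ) - b (u • g ^ j • o)| ≤ Θ)
    {u e : G} (hu : u ∉ elemClosure g) (he : e ∈ elemClosure g) :
    |(b (u • e • o) : ℝ) - b (u • o)| ≤ Θ + 6 * κ := by
  have h1 := h.dist_elem_axis he 0
  have h2 := h.lipschitz (u • e • o) (u • g ^ b (e • o) • o)
  have h3 := hΘ u hu (b (e • o)) 0
  simp only [zpow_zero, one_smul] at h1 h3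
  rw [dist_smul] at h2
  have := abs_sub_le_add h2 h3
  linarith

omit [IsIsometricSMul G X] in
theorem dist_lt_of_far {Θ : ℝ}
    (hΘ : ∀ u ∉ elemClosure g, ∀ i j : ℤ, |(b (u • g ^ i • o) : ℝ) - b (u • g ^ j • o)| ≤ Θ)
    {u : G} (hu : u ∉ elemClosure g) {p : X} (hp : Θ + 6 * κ < |(b p : ℝ) - b (u • o)|) (l : ℤ) :
    dist p (g ^ b p • o) < dist p (u • g ^ l • o) := by
  have hκ := h.one_le
  have h1 := hΘ u hu l 0
  simp only [zpow_zero, one_smul] at h1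
  have h2 := abs_sub_le (b p : ℝ) (b (u • g ^ l • o)) (b (u • o))
  have h3 := h.dist_ge (b p) (b (u • g ^ l • o))
  have h4 : 0 ≤ dist (u • g ^ l • o) (g ^ b (u • g ^ l • o) • o) := dist_nonneg
  rcases h.contract p (u • g ^ l • o) with d | d <;> linarith

theorem behrstock {Θ : ℝ}
    (hΘ : ∀ u ∉ elemClosure g, ∀ i j : ℤ, |(b (u • g ^ i • o) : ℝ) - b (u • g ^ j • o)| ≤ Θ)
    {u : G} (hu : u ∉ elemClosure g) (p : X) :
    |(b p : ℝ) - b (u • o)| ≤ Θ + 6 * κ ∨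
      |(b (u⁻¹ • p) : ℝ) - b (u⁻¹ • o)| ≤ Θ + 6 * κ := by
  by_contra! hc
  have h1 := h.dist_lt_of_far hΘ hu hc.1 (b (u⁻¹ • p))
  have h2 := h.dist_lt_of_far hΘ (u := u⁻¹) (by rwa [inv_mem_iff]) hc.2 (b p)
  rw [dist_smul, ← dist_smul u, smul_inv_smul] at h2
  linarith

theorem acyl (hac : AcylindricalWith (fun a b : X => dist a b) (fun (g : G) x => g • x)) (r : ℤ) :
    ∃ (M : ℤ) (N : ℕ), ∀ p q, M ≤ |b q - b p| →
    {e : G | e ∈ elemClosure g ∧ Near r (b (e • p)) (b p) ∧ Near r (b (e • q)) (b q)}.Finite ∧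
    {e : G | e ∈ elemClosure g ∧ Near r (b (e • p)) (b p) ∧ Near r (b (e • q)) (b q)}.ncard ≤ N := by
  have hκ := h.one_le
  obtain ⟨R, N, hR, hN⟩ := hac (3 * κ + κ * (8 * κ + |(r : ℝ)|)) (by positivity)
  refine ⟨⌈R⌉, N, fun p q hpq => ?_⟩
  obtain ⟨hfin, hcard⟩ := hN (g ^ b q • o) (g ^ b p • o) (by
    have h1 := h.dist_ge (b q) (b p)
    have h2 := Int.le_ceil R
    have h3 : (⌈R⌉ : ℝ) ≤ |(b q : ℝ) - b p| := by exact_mod_cast hpq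
    simp only
    linarith)
  rw [Nat.card_coe_set_eq] at hcard
  have hmv : ∀ e ∈ elemClosure g, ∀ p, Near r (b (e • p)) (b p) →
      dist (g ^ b p • o) (e • g ^ b p • o) ≤ 3 * κ + κ * (8 * κ + |(r : ℝ)|) := by
    intro e he p hp
    refine h.dist_axis_near he ?_
    have h1 := h.b_elem_near he p
    rw [abs_sub_comm] at h1
    exact abs_sub_le_add h1 ((abs_le_of_near hp).trans (le_abs_self _))
  have hsub : {e : G | e ∈ elemClosure g ∧ Near r (b (e • p)) (b p) ∧ Near r (b (e • q)) (b q)} ⊆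
      {e : G | dist (g ^ b q • o) (e • g ^ b q • o) ≤ 3 * κ + κ * (8 * κ + |(r : ℝ)|) ∧
        dist (g ^ b p • o) (e • g ^ b p • o) ≤ 3 * κ + κ * (8 * κ + |(r : ℝ)|)} :=
    fun e ⟨he, h1, h2⟩ => ⟨hmv e he q h2, hmv e he p h1⟩
  exact ⟨hfin.subset hsub, (Set.ncard_le_ncard hsub hfin).trans hcard⟩

theorem exists_notMem
    (hac : AcylindricalWith (fun a b : X => dist a b) (fun (g : G) x => g • x))
    (hvc : ¬ VirtuallyCyclic G) : ∃ t, t ∉ elemClosure g := by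
  by_contra! htop
  apply hvc
  have hκ := h.one_le
  set C := 3 * κ + κ * (2 * κ) with hC
  have hCpos : 0 < C := by positivity
  have h3C : 3 * κ ≤ C := by rw [hC]; nlinarith
  obtain ⟨R, N, hR, hN⟩ := hac (2 * C) (by linarith)
  set M : ℤ := ⌈R⌉ with hM
  obtain ⟨hfin, -⟩ := hN o (g ^ M • o) (by
    have h1 := h.dist_ge 0 M
    have h2 := Int.le_ceil R
    have h3 := neg_abs_le ((0 : ℤ) - M : ℝ)
    simp only [zpow_zero, one_smul] at h1
    push_cast at h1 h3
    simp only
    linarith)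
  have hF : ∀ s : ℤ, {f : G | dist o (f • o) ≤ C ∧
      dist (f • g ^ M • o) (g ^ s • o) ≤ C}.Finite := by
    intro s
    rcases Set.eq_empty_or_nonempty {f : G | dist o (f • o) ≤ C ∧
      dist (f • g ^ M • o) (g ^ s • o) ≤ C} with he | ⟨f, hf1, hf2⟩
    · rw [he]; exact Set.finite_empty
    · refine (hfin.image (f * ·)).subset ?_
      rintro f' ⟨hf1', hf2'⟩
      refine ⟨f⁻¹ * f', ⟨?_, ?_⟩, by simp⟩
      · show dist o ((f⁻¹ * f') • o) ≤ 2 * C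
        rw [← dist_smul f, mul_smul, smul_inv_smul]
        have := dist_triangle_left (f • o) (f' • o) o
        linarith
      · show dist (g ^ M • o) ((f⁻¹ * f') • g ^ M • o) ≤ 2 * C
        rw [← dist_smul f, mul_smul, smul_inv_smul]
        have := dist_triangle_right (f • g ^ M • o) (f' • g ^ M • o) (g ^ s • o)
        linarith
  set B : ℤ := ⌈|(M : ℝ)| + 8 * κ⌉ with hB
  have hFin : {f : G | |(b (f • o) : ℝ)| ≤ 2 * κ}.Finite := by
    refine ((Set.finite_Icc (-B) B).biUnion fun s _ => hF s).subset fun f hf => ?_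
    have hf' : |(b (f • g ^ (0 : ℤ) • o) : ℝ) - (0 : ℤ)| ≤ 2 * κ := by simpa using hf
    have h1 := h.dist_axis_near (htop f) hf'
    have h2 := h.dist_elem_axis (htop f) M
    have h3 := abs_le.1 (h.abs_b_elem_sub (htop f) M 0)
    have h4 := Int.le_ceil (|(M : ℝ)| + 8 * κ)
    simp only [zpow_zero, one_smul, Int.cast_zero, sub_zero] at h1 h3
    refine Set.mem_biUnion (x := b (f • g ^ M • o)) ?_ ⟨h1, by linarith⟩
    have h5 := abs_add_le ((b (f • g ^ M • o) : ℝ) - b (f • o)) (b (f • o))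
    rw [sub_add_cancel] at h5
    have hf2 : |(b (f • o) : ℝ)| ≤ 2 * κ := hf
    have h6 : |(b (f • g ^ M • o) : ℝ)| ≤ B := by
      rw [← hB] at h4
      linarith
    have h7 : |b (f • g ^ M • o)| ≤ B := by exact_mod_cast h6
    exact abs_le.1 h7
  refine ⟨Subgroup.zpowers g, inferInstance, ?_⟩
  have : Finite (G ⧸ Subgroup.zpowers g) := by
    refine Set.finite_univ_iff.1 ((hFin.image fun f => ((f⁻¹ : G) : G ⧸ Subgroup.zpowers g)).subset
      fun e' _ => ?_)
    obtain ⟨e, rfl⟩ := QuotientGroup.mk_surjective e'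
    refine ⟨g ^ (-b (e⁻¹ • o)) * e⁻¹, ?_, ?_⟩
    · have := h.shift (-b (e⁻¹ • o)) (e⁻¹ • o)
      rw [add_neg_cancel, Int.cast_zero, sub_zero, ← mul_smul] at this
      show |(b ((g ^ (-b (e⁻¹ • o)) * e⁻¹) • o) : ℝ)| ≤ 2 * κ
      linarith
    · simp only
      rw [QuotientGroup.eq]
      exact ⟨-b (e⁻¹ • o), by simp⟩
  exact Subgroup.finiteIndex_of_finite_quotient

theorem nonempty_axisSys
    (hac : AcylindricalWith (fun a b : X => dist a b) (fun (g : G) x => g • x))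
    (hgeo : GeodesicSpace X) (hvc : ¬ VirtuallyCyclic G) : Nonempty (AxisSys G X) := by
  have hκ := h.one_le
  obtain ⟨t, ht⟩ := h.exists_notMem hac hvc
  obtain ⟨Θ, hΘ0, hΘ⟩ := h.exists_proj_bound hac
  have hd : 0 ≤ dist (t • o) o := dist_nonneg
  set c : ℤ := ⌈Θ + dist (t • o) o + 22 * κ⌉ with hc
  have hc' := Int.le_ceil (Θ + dist (t • o) o + 22 * κ)
  rw [← hc] at hc'
  exact ⟨{
    o := o
    E := elemClosure g
    b := b
    g := g
    t := t
    c := c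
    one_le := by
      have : (1 : ℝ) ≤ c := by linarith
      exact_mod_cast this
    g_mem := ⟨1, 1, one_ne_zero, Or.inl rfl, by simp [SemiconjBy]⟩
    t_notMem := ht
    path := fun p q => by
      obtain ⟨L, f, h0, hL, hf⟩ := hgeo.exists_chain p q
      refine ⟨L, f, h0, hL, fun i hi u => ?_⟩
      have h1 := h.lipschitz (u • f i) (u • f (i + 1))
      have h2 := hf i hi
      rw [dist_smul] at h1
      exact near_of_abs_le h1 (by linarith)
    t_near := fun v => by
      have h1 := h.lipschitz (v • t • o) (v • o)
      rw [dist_smul] at h1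
      exact near_of_abs_le h1 (by linarith)
    proj := fun u hu e he => near_of_abs_le (h.proj_elem hΘ hu he) (by linarith)
    behrstock := fun u hu p => (h.behrstock hΘ hu p).imp
      (fun h1 => near_of_abs_le h1 (by linarith)) (fun h1 => near_of_abs_le h1 (by linarith))
    elem := fun e he p q => by
      have h1 := h.elem_le he p q
      have h2 : (|(b (e • p) : ℝ) - b (e • q)|) ≤ |(b p : ℝ) - b q| + c := by linarith
      exact_mod_cast h2
    shift := fun k p => near_of_abs_le (h.shift k p) (by linarith)
    b_o := near_of_abs_le (r := 1) (by simpa using h.b_o) (by linarith)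
    acyl := h.acyl hac }⟩

end IsProjAxis

theorem AcylindricallyHyperbolic.nonempty_axisSys {G : Type uG} [Group G]
    (h : AcylindricallyHyperbolic.{uX, uG} G) :
    ∃ (X : Type uX) (_ : MulAction G X), Nonempty (AxisSys G X) := by
  obtain ⟨hvc, A, hac, o, hunb⟩ := h
  let inst : MulAction G A.carrier :=
    { smul := A.act
      one_smul := A.isIsomAction.act_one
      mul_smul := A.isIsomAction.act_mul }
  have : IsIsometricSMul G A.carrier :=
    ⟨fun g => Isometry.of_dist_eq (A.isIsomAction.isometry g)⟩
  have hac' : AcylindricalWith (fun a b : A.carrier => dist a b) (fun (g : G) x => g • x) := hac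
  have h4 : FourPoint A.carrier (6 * A.δ + 4) := fun x y z w => A.rips.four_point A.geodesic x y z w
  have hunb' : ∀ r : ℝ, ∃ g : G, r ≤ dist o (g • o) := by
    by_contra! hr
    obtain ⟨r, hr⟩ := hr
    refine hunb ((isBounded_closedBall (x := o) (r := r)).subset ?_)
    rintro _ ⟨g, rfl⟩
    exact mem_closedBall'.2 (hr g).le
  obtain ⟨g, hg⟩ := h4.exists_long_square A.geodesic hac' o hunb'
    (C := 2 * (6 * A.δ + 4) + 1) (by linarith [A.δ_nonneg])
  obtain ⟨κ, hκ⟩ := h4.exists_isQuasiAxis hg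
  obtain ⟨κ', b, hb⟩ := hκ.exists_isProjAxis
  exact ⟨A.carrier, inst, hb.nonempty_axisSys hac' A.geodesic hvc⟩

/-- [ABO, Theorem 2.6]. -/
theorem stmt_4 (G : Type uG) [Group G] (h : AcylindricallyHyperbolic.{uX, uG} G) :
    Cardinal.continuum ≤ Cardinal.mk (AHStructures G) ∧
    ∃ f : Set ℕ → {S : Set G // IsAHGenSet S},
      ∀ A B : Set ℕ, A ⊆ B ↔ GenSetDominated (f A).1 (f B).1 := by
  obtain ⟨X, _, ⟨S⟩⟩ := h.nonempty_axisSys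
  exact S.toExact.exists_embedding
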